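/- arXiv:1512.06121 — 2 statements merged into one kernel-verified Lean document; each statement's English description precedes it below -/
import Mathlib

section
/- Let N ≥ 3 be an integer. There exists a constant α > 0, depending only on N, such that for every smooth compactly supported function φ : ℝᴺ → ℝ one has C_N² ‖∇φ‖_2² − ‖φ‖_{2N/(N−2)}² ≥ α · δ(φ,M)², where δ(φ,M)² = inf over z ∈ ℝ, t > 0, x₀ ∈ ℝᴺ of ∫_{ℝᴺ} |∇φ(x) − z ∇F_{t,x₀}(x)|² dx. -/
open MeasureTheory

noncomputable section

/-- The Sobolev extremal (Aubin–Talenti bubble)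
`F_{t,x₀}(x) = (t / (1 + t²|x−x₀|²))^{(N−2)/2}` on `ℝᴺ`. -/
def sobolevBubble (N : ℕ) (t : ℝ) (x₀ : EuclideanSpace ℝ (Fin N)) :
    EuclideanSpace ℝ (Fin N) → ℝ :=
  fun x => (t / (1 + t ^ 2 * ‖x - x₀‖ ^ 2)) ^ (((N : ℝ) - 2) / 2)

/-- The `L^q` norm (w.r.t. Lebesgue measure) of a real-valued function on `ℝᴺ`. -/
def LqNorm (N : ℕ) (q : ℝ) (φ : EuclideanSpace ℝ (Fin N) → ℝ) : ℝ :=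
  (∫ x, |φ x| ^ q) ^ (1 / q)

/-- The `L²` norm of the gradient, `‖∇φ‖₂ = (∫ |∇φ|² dx)^{1/2}`. -/
def gradL2 (N : ℕ) (φ : EuclideanSpace ℝ (Fin N) → ℝ) : ℝ :=
  Real.sqrt (∫ x, ‖gradient φ x‖ ^ 2)

/-- Squared distance of `φ` to the manifold `M = {z F_{t,x₀}}` of Sobolev extremals,
measured in the gradient `L²` norm:
`δ(φ,M)² = inf_{z,t>0,x₀} ∫ |∇φ − z∇F_{t,x₀}|²`. -/
def distToExtremalsSq (N : ℕ) (φ : EuclideanSpace ℝ (Fin N) → ℝ) : ℝ :=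
  ⨅ p : ℝ × {t : ℝ // 0 < t} × EuclideanSpace ℝ (Fin N),
    ∫ x, ‖gradient φ x - p.1 • gradient (sobolevBubble N p.2.1.1 p.2.2) x‖ ^ 2


abbrev EE (N : ℕ) := EuclideanSpace ℝ (Fin N)

def kk (N : ℕ) : ℝ := ((N : ℝ) - 2) / 2
def qq (N : ℕ) : ℝ := 2 * N / ((N : ℝ) - 2)

def PP {N : ℕ} (β γ : ℝ) (a x : EE N) : ℝ := β * ‖x‖ ^ 2 - 2 * inner ℝ a x + γ

def VV {N : ℕ} (s β γ : ℝ) (a x : EE N) : ℝ := (s / PP β γ a x) ^ (kk N)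

/-- admissible functions -/
def Adm {N : ℕ} (u : EE N → ℝ) : Prop := ContDiff ℝ 1 u ∧ HasCompactSupport u

lemma grad_mul {N : ℕ} {f g : EE N → ℝ} {x : EE N} (hf : DifferentiableAt ℝ f x)
    (hg : DifferentiableAt ℝ g x) :
    gradient (fun y => f y * g y) x = f x • gradient g x + g x • gradient f x := by
  unfold gradient
  rw [fderiv_fun_mul hf hg]; simp

lemma norm_grad {N : ℕ} (f : EE N → ℝ) (x : EE N) : ‖gradient f x‖ = ‖fderiv ℝ f x‖ := by
  unfold gradient; simp

lemma continuous_grad {N : ℕ} {f : EE N → ℝ} (hf : ContDiff ℝ 1 f) :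
    Continuous (gradient f) := by
  unfold gradient
  exact (LinearIsometryEquiv.continuous _).comp (hf.continuous_fderiv (by simp))

lemma grad_compact {N : ℕ} {f : EE N → ℝ} (hf : HasCompactSupport f) :
    HasCompactSupport (gradient f) := by
  have := hf.fderiv (𝕜 := ℝ)
  unfold gradient
  exact this.comp_left (g := fun y => (InnerProductSpace.toDual ℝ (EE N)).symm y) (by simp)

lemma div_zero' {N : ℕ} {f : EE N → ℝ} (hf : Adm f) (β : ℝ) (a : EE N) :
    ∫ x, (inner ℝ (gradient f x) (β • x - a) + N * β * f x) = 0 := by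
  obtain ⟨hc, hs⟩ := hf
  have hfd : Continuous (fderiv ℝ f) := hc.continuous_fderiv (by simp)
  have hsd : HasCompactSupport (fderiv ℝ f) := hs.fderiv (𝕜 := ℝ)
  have key : ∀ i : Fin N, ∫ x, (fderiv ℝ f x (EuclideanSpace.single i 1) * (β * x i - a i) + f x * β) = 0 := by
    intro i
    have hg : ∀ x : EE N, HasFDerivAt (fun x : EE N => β * x i - a i) (β • (EuclideanSpace.proj i : EE N →L[ℝ] ℝ)) x := by
      intro x
      have := ((EuclideanSpace.proj i : EE N →L[ℝ] ℝ).hasFDerivAt (x := x)).const_mul β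
      simpa using this.sub_const (a i)
    have hgc : Continuous (fun x : EE N => β * x i - a i) := by fun_prop
    have hcd : Continuous fun x => fderiv ℝ f x (EuclideanSpace.single i 1) := by fun_prop
    have hsdd : HasCompactSupport fun x => fderiv ℝ f x (EuclideanSpace.single i 1) :=
      hsd.comp_left (g := fun (y : EE N →L[ℝ] ℝ) => y (EuclideanSpace.single i 1)) (by simp)
    have e : ∀ x : EE N, fderiv ℝ (fun x : EE N => β * x i - a i) x (EuclideanSpace.single i 1) = β := by
      intro x; rw [(hg x).fderiv]; simp
    have i1 : Integrable (fun x => fderiv ℝ f x (EuclideanSpace.single i 1) * (β * x i - a i)) :=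
      (hcd.mul hgc).integrable_of_hasCompactSupport hsdd.mul_right
    have i2 : Integrable (fun x => f x * β) :=
      (hc.continuous.mul continuous_const).integrable_of_hasCompactSupport hs.mul_right
    have i3 : Integrable (fun x => f x * (β * x i - a i)) :=
      (hc.continuous.mul hgc).integrable_of_hasCompactSupport hs.mul_right
    have := integral_mul_fderiv_eq_neg_fderiv_mul_of_integrable (μ := (volume : Measure (EE N))) (𝕜 := ℝ) (f := f) (g := fun x : EE N => β * x i - a i) (v := EuclideanSpace.single i 1)
      i1 (by simpa only [e] using i2) i3 (fun x _ => (hc.differentiable (by simp)) x) (fun x _ => (hg x).differentiableAt)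
    rw [integral_add i1 i2]
    simp only [e] at this
    linarith
  have : ∀ x : EE N, inner ℝ (gradient f x) (β • x - a) + N * β * f x =
      ∑ i : Fin N, (fderiv ℝ f x (EuclideanSpace.single i 1) * (β * x i - a i) + f x * β) := by
    intro x
    rw [inner_gradient_left, Finset.sum_add_distrib]
    congr 1
    · have h : β • x - a = ∑ i : Fin N, (β * x i - a i) • EuclideanSpace.single i (1:ℝ) := by
        ext j
        simp [Finset.sum_apply, Pi.single_apply]
      rw [h, map_sum]
      simp [mul_comm]
    · simp; ring
  simp only [this]
  rw [integral_finsetSum]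
  · exact Finset.sum_eq_zero fun i _ => key i
  · intro i _
    refine Continuous.integrable_of_hasCompactSupport (by fun_prop) ?_
    refine HasCompactSupport.add ?_ hs.mul_right
    exact (hsd.comp_left (g := fun (y : EE N →L[ℝ] ℝ) => y (EuclideanSpace.single i 1)) (by simp)).mul_right


lemma hasGrad_comp {N : ℕ} {g : EE N → ℝ} {g' x : EE N} {h : ℝ → ℝ} {h' : ℝ}
    (hg : HasGradientAt g g' x) (hh : HasDerivAt h h' (g x)) :
    HasGradientAt (fun y => h (g y)) (h' • g') x := by
  rw [hasGradientAt_iff_hasFDerivAt] at *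
  rw [map_smul]
  exact hh.comp_hasFDerivAt x hg

lemma hasGrad_PP {N : ℕ} (β γ : ℝ) (a x : EE N) :
    HasGradientAt (PP β γ a) ((2:ℝ) • (β • x - a)) x := by
  rw [hasGradientAt_iff_hasFDerivAt]
  have h1 := (hasStrictFDerivAt_norm_sq x).hasFDerivAt.const_mul β
  have h2 := ((innerSL ℝ a).hasFDerivAt (x := x)).const_mul 2
  have := (h1.sub h2).add_const γ
  refine (this.congr_fderiv ?_)
  ext y
  simp [inner_sub_left, inner_smul_left]
  ring

lemma norm_gradPP {N : ℕ} {β γ s : ℝ} {a : EE N} (rel : β * γ - ‖a‖ ^ 2 = s ^ 2) (x : EE N) :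
    ‖β • x - a‖ ^ 2 = β * PP β γ a x - s ^ 2 := by
  rw [norm_sub_sq_real, norm_smul, inner_smul_left, PP, ← rel, mul_pow]
  have : ‖β‖ ^ 2 = β ^ 2 := by simp
  rw [this, real_inner_comm x a]; simp; ring

lemma hasGrad_VV {N : ℕ} {β γ s : ℝ} {a : EE N} (hs : 0 < s) (x : EE N) (hpos : 0 < PP β γ a x) :
    HasGradientAt (VV s β γ a) (-(2 * kk N * VV s β γ a x / PP β γ a x) • (β • x - a)) x := by
  have hd : HasDerivAt (fun t : ℝ => (s / t) ^ (kk N))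
      (-(kk N * VV s β γ a x / PP β γ a x)) (PP β γ a x) := by
    have h1 : HasDerivAt (fun t : ℝ => s / t) (-(s / PP β γ a x ^ 2)) (PP β γ a x) := by
      have := (hasDerivAt_inv hpos.ne').const_mul s
      simpa [div_eq_mul_inv] using this
    have hr : 0 < s / PP β γ a x := div_pos hs hpos
    have := h1.rpow_const (p := kk N) (Or.inl hr.ne')
    refine this.congr_deriv ?_
    rw [VV, Real.rpow_sub_one hr.ne']
    field_simp
  have := hasGrad_comp (hasGrad_PP β γ a x) hd
  rw [smul_smul] at this
  rw [show -(2 * kk N * VV s β γ a x / PP β γ a x) = -(kk N * VV s β γ a x / PP β γ a x) * 2 by ring]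
  exact this

lemma PP_cont {N : ℕ} (β γ : ℝ) (a : EE N) : ContDiff ℝ 1 (PP β γ a) := by
  unfold PP
  have : ContDiff ℝ 1 fun x : EE N => inner ℝ a x := (innerSL ℝ a).contDiff
  exact ((contDiff_const.mul (contDiff_norm_sq ℝ)).sub (contDiff_const.mul this)).add contDiff_const

lemma VV_cont {N : ℕ} {β γ s : ℝ} {a : EE N} (hs : 0 < s) (hpos : ∀ x, 0 < PP β γ a x) :
    ContDiff ℝ 1 (VV s β γ a) := by
  unfold VV
  exact (contDiff_const.div (PP_cont β γ a) (fun x => (hpos x).ne')).rpow_const_of_ne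
    (fun x => (div_pos hs (hpos x)).ne')

lemma VV_pos {N : ℕ} {β γ s : ℝ} {a x : EE N} (hs : 0 < s) (hpos : 0 < PP β γ a x) :
    0 < VV s β γ a x := Real.rpow_pos_of_pos (div_pos hs hpos) _

lemma VV_sq {N : ℕ} (hN : 3 ≤ N) {β γ s : ℝ} {a x : EE N} (hs : 0 < s) (hpos : 0 < PP β γ a x) :
    VV s β γ a x ^ 2 = (s / PP β γ a x) ^ (N - 2) := by
  have hr := div_pos hs hpos
  rw [VV, ← Real.rpow_natCast, ← Real.rpow_mul hr.le, ← Real.rpow_natCast]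
  congr 1
  rw [kk, Nat.cast_sub (by omega)]; push_cast; ring

lemma VV_q {N : ℕ} (hN : 3 ≤ N) {β γ s : ℝ} {a x : EE N} (hs : 0 < s) (hpos : 0 < PP β γ a x) :
    VV s β γ a x ^ (qq N) = (s / PP β γ a x) ^ N := by
  have hr := div_pos hs hpos
  rw [VV, ← Real.rpow_mul hr.le, ← Real.rpow_natCast]
  congr 1
  have : (3:ℝ) ≤ N := by exact_mod_cast hN
  rw [kk, qq]; field_simp [show (N:ℝ) - 2 ≠ 0 by linarith]

lemma Adm.mul {N : ℕ} {u v : EE N → ℝ} (hu : Adm u) (hv : ContDiff ℝ 1 v) :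
    Adm (fun x => u x * v x) := ⟨hu.1.mul hv, hu.2.mul_right⟩

lemma ground {N : ℕ} (hN : 3 ≤ N) {β γ s : ℝ} {a : EE N} (hs : 0 < s) (hpos : ∀ x, 0 < PP β γ a x)
    (rel : β * γ - ‖a‖ ^ 2 = s ^ 2) {u : EE N → ℝ} (hu : Adm u) :
    ∫ x, ‖gradient (fun y => u y * VV s β γ a y) x‖ ^ 2 =
      (∫ x, (s / PP β γ a x) ^ (N - 2) * ‖gradient u x‖ ^ 2) +
      (N * ((N:ℝ) - 2)) * ∫ x, u x ^ 2 * (s / PP β γ a x) ^ N := by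
  have hPc := PP_cont β γ a
  have hrc : ContDiff ℝ 1 (fun x => s / PP β γ a x) := contDiff_const.div hPc (fun x => (hpos x).ne')
  set f : EE N → ℝ := fun x => (u x * (u x * (-(2 * kk N) / s))) * (s / PP β γ a x) ^ (N - 1) with hf
  have hfa : Adm f := (hu.mul (hu.1.mul contDiff_const)).mul (hrc.pow _)
  have hgf : ∀ x, gradient f x = (-(4 * kk N) / s * u x * (s / PP β γ a x) ^ (N - 1)) • gradient u x
      + ((4 * kk N) * ((N:ℝ) - 1) * u x ^ 2 * (s / PP β γ a x) ^ N / s ^ 2) • (β • x - a) := by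
    intro x
    have hud := (hu.1.differentiable (by simp)) x
    have h1 : HasDerivAt (fun t : ℝ => (s / t) ^ (N - 1))
      (-(((N:ℝ) - 1) * (s / PP β γ a x) ^ N / s)) (PP β γ a x) := by
      have hp := hpos x
      have h1 : HasDerivAt (fun t : ℝ => s / t) (-(s / PP β γ a x ^ 2)) (PP β γ a x) := by
        have := (hasDerivAt_inv hp.ne').const_mul s
        simpa [div_eq_mul_inv] using this
      refine (h1.fun_pow (N - 1)).congr_deriv ?_
      obtain ⟨n, rfl⟩ : ∃ n, N = n + 2 := ⟨N - 2, by omega⟩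
      simp only [Nat.add_sub_cancel, show n + 2 - 1 = n + 1 by omega]
      push_cast
      rw [pow_succ (s / PP β γ a x) (n + 1), pow_succ (s / PP β γ a x) n]
      generalize (s / PP β γ a x) ^ n = W
      field_simp
      ring
    have h2 := hasGrad_comp (hasGrad_PP β γ a x) h1
    have h3 : gradient (fun x => u x * (u x * (-(2 * kk N) / s))) x = (-(4 * kk N) / s * u x) • gradient u x := by
      rw [grad_mul hud (hud.mul_const _)]
      have : gradient (fun y => u y * (-(2 * kk N) / s)) x = (-(2 * kk N) / s) • gradient u x := by
        rw [grad_mul hud (by fun_prop)]; simp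
      rw [this, smul_smul, ← add_smul]; congr 1; ring
    rw [hf, grad_mul (by fun_prop) h2.differentiableAt, h2.gradient, h3, smul_smul, smul_smul, smul_smul, add_comm]
    congr 2 <;> ring
  have hdiv := div_zero' hfa β a
  have pt : ∀ x, ‖gradient (fun y => u y * VV s β γ a y) x‖ ^ 2 =
      (inner ℝ (gradient f x) (β • x - a) + N * β * f x) +
      ((s / PP β γ a x) ^ (N - 2) * ‖gradient u x‖ ^ 2 +
        (N * ((N:ℝ) - 2)) * (u x ^ 2 * (s / PP β γ a x) ^ N)) := by
    intro x
    have hud := (hu.1.differentiable (by simp)) x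
    have hV := hasGrad_VV hs x (hpos x)
    have hn := norm_gradPP rel x
    rw [grad_mul hud hV.differentiableAt, hV.gradient, hgf x, norm_add_sq_real, inner_add_left,
      inner_smul_left, inner_smul_left, inner_smul_left, inner_smul_right, inner_smul_left, real_inner_self_eq_norm_sq,
      smul_smul, norm_smul, norm_smul, mul_pow, mul_pow, hn, real_inner_comm (gradient u x) (β • x - a)]
    simp only [Real.norm_eq_abs, sq_abs, conj_trivial, hf]
    have hv2 := VV_sq hN hs (hpos x) (x := x)
    set V := VV s β γ a x
    have hp := hpos x
    set P := PP β γ a x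
    set I := inner ℝ (gradient u x) (β • x - a)
    set G := ‖gradient u x‖ ^ 2
    obtain ⟨n, rfl⟩ : ∃ n, N = n + 2 := ⟨N - 2, by omega⟩
    simp only [Nat.add_sub_cancel, show n + 2 - 1 = n + 1 by omega] at *
    rw [pow_succ (s / P) (n + 1), pow_succ (s / P) n]
    set W := (s / P) ^ n
    have e1 : (u x * -(2 * kk (n+2) * V / P)) ^ 2 = u x ^ 2 * (4 * kk (n+2) ^ 2 / P ^ 2) * W := by
      rw [← hv2]; ring
    rw [e1, hv2]
    have e2 : 2 * (u x * -(2 * kk (n+2) * V / P) * (V * I)) = - (u x * (4 * kk (n+2) / P) * W * I) := by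
      rw [← hv2]; ring
    simp only [← mul_assoc] at e2 ⊢
    rw [e2]
    unfold kk; push_cast
    field_simp
    ring
  simp only [pt]
  have i1 : Integrable (fun x => inner ℝ (gradient f x) (β • x - a) + N * β * f x) := by
    refine Continuous.integrable_of_hasCompactSupport ?_ ?_
    · have := continuous_grad hfa.1
      have := hfa.1.continuous
      fun_prop
    · refine HasCompactSupport.add ?_ hfa.2.mul_left
      refine (grad_compact hfa.2).mono ?_
      intro x hx
      simp only [Function.mem_support] at *
      contrapose! hx; rw [hx]; simp
  have i2 : Integrable (fun x => (s / PP β γ a x) ^ (N - 2) * ‖gradient u x‖ ^ 2) := by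
    refine Continuous.integrable_of_hasCompactSupport ?_ ?_
    · have := continuous_grad hu.1
      have := hrc.continuous
      fun_prop
    · refine HasCompactSupport.mul_left ?_
      exact (grad_compact hu.2).comp_left (g := fun y => ‖y‖ ^ 2) (by simp)
  have i3 : Integrable (fun x => u x ^ 2 * (s / PP β γ a x) ^ N) := by
    refine Continuous.integrable_of_hasCompactSupport ?_ ?_
    · have := hu.1.continuous
      have := hrc.continuous
      fun_prop
    · refine HasCompactSupport.mul_right ?_
      exact hu.2.comp_left (g := fun y => y ^ 2) (by simp)
  have i4 := i3.const_mul (N * ((N:ℝ) - 2))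
  have i5 : Integrable (fun x => (s / PP β γ a x) ^ (N - 2) * ‖gradient u x‖ ^ 2 +
        (N * ((N:ℝ) - 2)) * (u x ^ 2 * (s / PP β γ a x) ^ N)) := i2.add i4
  rw [integral_add i1 i5, hdiv, integral_add i2 i4, integral_const_mul]
  simp


abbrev EP (N : ℕ) := WithLp 2 (EE N × ℝ)

def ell {N : ℕ} (x : EE N) : ℝ := 1 + ‖x‖ ^ 2

lemma ell_pos {N : ℕ} (x : EE N) : 0 < ell x := by unfold ell; positivity
lemma one_le_ell {N : ℕ} (x : EE N) : 1 ≤ ell x := by unfold ell; nlinarith [sq_nonneg ‖x‖]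

lemma ell_cont {N : ℕ} : Continuous (ell : EE N → ℝ) := by unfold ell; fun_prop

def om {N : ℕ} (x : EE N) : EP N := WithLp.toLp 2 ((2 / ell x) • x, (‖x‖ ^ 2 - 1) / ell x)

lemma om_cont {N : ℕ} : Continuous (om : EE N → EP N) := by
  unfold om
  have := ell_cont (N := N)
  have h : ∀ x : EE N, ell x ≠ 0 := fun x => (ell_pos x).ne'
  refine (WithLp.prod_continuous_toLp 2 (EE N) ℝ).comp ?_
  fun_prop (disch := assumption)

lemma om_norm {N : ℕ} (x : EE N) : ‖om x‖ = 1 := by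
  have h := ell_pos x
  have : ‖om x‖ ^ 2 = 1 := by
    rw [WithLp.prod_norm_sq_eq_of_L2]
    simp only [om, WithLp.toLp_fst, WithLp.toLp_snd, norm_smul, Real.norm_eq_abs, mul_pow, sq_abs]
    field_simp
    unfold ell; ring
  nlinarith [norm_nonneg (om x)]

def sx {N : ℕ} (ξ : EP N) : ℝ := √(1 - ‖ξ‖ ^ 2)

lemma PP_om {N : ℕ} (ξ : EP N) (x : EE N) :
    PP (1 - ξ.snd) (1 + ξ.snd) ξ.fst x = ell x * (1 - inner ℝ ξ (om x)) := by
  have h := ell_pos x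
  rw [WithLp.prod_inner_apply]
  simp only [om, PP, inner_smul_right]
  simp
  field_simp
  unfold ell; ring

lemma inner_om_le {N : ℕ} (ξ : EP N) (x : EE N) : |inner ℝ ξ (om x)| ≤ ‖ξ‖ := by
  have := abs_real_inner_le_norm ξ (om x)
  rwa [om_norm, mul_one] at this

lemma sx_pos {N : ℕ} {ξ : EP N} (h : ‖ξ‖ < 1) : 0 < sx ξ := by
  apply Real.sqrt_pos.2; nlinarith [norm_nonneg ξ]

lemma sx_sq {N : ℕ} {ξ : EP N} (h : ‖ξ‖ < 1) : sx ξ ^ 2 = 1 - ‖ξ‖ ^ 2 := by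
  apply Real.sq_sqrt; nlinarith [norm_nonneg ξ]

lemma PP_rel {N : ℕ} {ξ : EP N} (h : ‖ξ‖ < 1) :
    (1 - ξ.snd) * (1 + ξ.snd) - ‖ξ.fst‖ ^ 2 = sx ξ ^ 2 := by
  rw [sx_sq h, WithLp.prod_norm_sq_eq_of_L2]; simp; ring

lemma PP_pos {N : ℕ} {ξ : EP N} (h : ‖ξ‖ < 1) (x : EE N) :
    0 < PP (1 - ξ.snd) (1 + ξ.snd) ξ.fst x := by
  rw [PP_om]
  have := (abs_le.1 (inner_om_le ξ x)).2
  exact mul_pos (ell_pos x) (by linarith)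

def rr {N : ℕ} (ξ : EP N) (x : EE N) : ℝ := sx ξ / (1 - inner ℝ ξ (om x))

lemma s_div_PP {N : ℕ} {ξ : EP N} (x : EE N) :
    sx ξ / PP (1 - ξ.snd) (1 + ξ.snd) ξ.fst x = rr ξ x / ell x := by
  rw [PP_om, rr, div_div, mul_comm]

lemma snd_lt {N : ℕ} {ξ : EP N} (h : ‖ξ‖ < 1) : 0 < 1 - ξ.snd := by
  have h2 := WithLp.prod_norm_sq_eq_of_L2 ξ
  simp at h2
  have : |ξ.snd| < 1 := by
    rw [← sq_lt_one_iff_abs_lt_one]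
    nlinarith [norm_nonneg ξ, sq_nonneg ‖ξ.fst‖]
  linarith [(abs_lt.1 this).2]

/-- bubble form -/
lemma rr_bubble {N : ℕ} {ξ : EP N} (h : ‖ξ‖ < 1) (x : EE N) :
    rr ξ x / ell x = ((1 - ξ.snd) / sx ξ) /
      (1 + ((1 - ξ.snd) / sx ξ) ^ 2 * ‖x - (1 - ξ.snd)⁻¹ • ξ.fst‖ ^ 2) := by
  rw [← s_div_PP]
  have hb := snd_lt h
  have hs := sx_pos h
  have hp := PP_pos h x
  have rel := PP_rel h
  have key : PP (1 - ξ.snd) (1 + ξ.snd) ξ.fst x * (1 - ξ.snd) = sx ξ ^ 2 *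
    (1 + ((1 - ξ.snd) / sx ξ) ^ 2 * ‖x - (1 - ξ.snd)⁻¹ • ξ.fst‖ ^ 2) := by
    rw [norm_sub_sq_real, norm_smul, inner_smul_right, real_inner_comm, PP, norm_inv, Real.norm_eq_abs, abs_of_pos hb]
    field_simp
    linear_combination rel
  have hp2 : 0 < 1 + ((1 - ξ.snd) / sx ξ) ^ 2 * ‖x - (1 - ξ.snd)⁻¹ • ξ.fst‖ ^ 2 := by positivity
  rw [div_eq_div_iff hp.ne' hp2.ne', ← mul_right_inj' hs.ne']
  rw [← mul_assoc, ← pow_two, ← key]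
  field_simp

lemma int_scale {N : ℕ} (f : EE N → ℝ) {t : ℝ} (ht : 0 < t) (y : EE N) :
    ∫ x, f (t • (x - y)) = (t ^ N)⁻¹ * ∫ x, f x := by
  rw [integral_sub_right_eq_self (fun x => f (t • x)) y, Measure.integral_comp_smul]
  simp [abs_of_pos ht]

lemma mass {N : ℕ} {ξ : EP N} (h : ‖ξ‖ < 1) :
    ∫ x : EE N, (rr ξ x / ell x) ^ N = ∫ x : EE N, (1 / ell x) ^ N := by
  simp only [rr_bubble h]
  have hb := snd_lt h
  have hs := sx_pos h
  set t := (1 - ξ.snd) / sx ξ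
  have ht : 0 < t := div_pos hb hs
  set y := (1 - ξ.snd)⁻¹ • ξ.fst
  have := int_scale (fun x : EE N => t ^ N * (1 / ell x) ^ N) ht y
  rw [integral_const_mul (t ^ N) (fun x : EE N => (1 / ell x) ^ N), ← mul_assoc, inv_mul_cancel₀ (by positivity), one_mul] at this
  rw [← this]
  congr 1; ext x
  rw [← mul_pow]; congr 1
  rw [ell, norm_smul, Real.norm_eq_abs, abs_of_pos ht, mul_pow]; ring

lemma integrable_ell {N : ℕ} {m : ℕ} (hm : N < 2 * m) : Integrable (fun x : EE N => (1 / ell x) ^ m) := by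
  have := integrable_rpow_neg_one_add_norm_sq (E := EE N) (μ := volume) (r := 2 * m)
    (by simp; exact_mod_cast hm)
  refine this.congr (Filter.Eventually.of_forall fun x => ?_)
  simp only
  rw [show -(2 * (m:ℝ)) / 2 = -(m:ℝ) by ring, Real.rpow_neg (by positivity), Real.rpow_natCast]
  simp [ell]

def nu (N : ℕ) : Measure (EP N) := ProbabilityTheory.cond volume (Metric.ball 0 1)

instance nu_prob (N : ℕ) : IsProbabilityMeasure (nu N) := by
  apply ProbabilityTheory.cond_isProbabilityMeasure_of_finite
  · exact (Metric.measure_ball_pos _ _ one_pos).ne'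
  · exact measure_ball_lt_top.ne

lemma nu_ae (N : ℕ) : ∀ᵐ η ∂(nu N), ‖η‖ < 1 := by
  have := ProbabilityTheory.ae_cond_mem (μ := (volume : Measure (EP N))) (s := Metric.ball (0 : EP N) 1) measurableSet_ball
  filter_upwards [this] with η h
  simpa using h

lemma nu_rot {N : ℕ} (R : EP N ≃ₗᵢ[ℝ] EP N) : MeasurePreserving R (nu N) (nu N) := by
  unfold nu ProbabilityTheory.cond
  refine MeasurePreserving.smul_measure ?_ _
  have h := R.measurePreserving.restrict_preimage (s := Metric.ball (0 : EP N) 1) measurableSet_ball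
  have : R ⁻¹' Metric.ball (0 : EP N) 1 = Metric.ball 0 1 := by ext x; simp
  rwa [this] at h

lemma nu_inv {N : ℕ} (F : ℝ → ℝ → ℝ) {v w : EP N} (h : ‖v‖ = ‖w‖) :
    ∫ η, F (inner ℝ η v) ‖η‖ ∂(nu N) = ∫ η, F (inner ℝ η w) ‖η‖ ∂(nu N) := by
  set R := Submodule.reflection (Submodule.span ℝ {v - w})ᗮ
  have hR : R v = w := Submodule.reflection_sub h
  have := (nu_rot R).integral_comp R.toHomeomorph.measurableEmbedding (fun η => F (inner ℝ η w) ‖η‖)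
  rw [← this]
  congr 1; ext η
  rw [← hR]; simp

lemma fubini_avg {N : ℕ} (F : ℝ → ℝ → ℝ) (hF : Measurable (Function.uncurry F)) {C : ℝ}
    (hC : ∀ σ ρ, |σ| ≤ ρ → ρ < 1 → |F σ ρ| ≤ C) {f : EE N → ℝ} (hf : Integrable f) :
    Integrable (fun η => ∫ x, F (inner ℝ η (om x)) ‖η‖ * f x) (nu N) ∧
    ∫ η, (∫ x, F (inner ℝ η (om x)) ‖η‖ * f x) ∂(nu N) =
      (∫ η, F (inner ℝ η (om (0 : EE N))) ‖η‖ ∂(nu N)) * ∫ x, f x := by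
  have hint : Integrable (fun p : EP N × EE N => F (inner ℝ p.1 (om p.2)) ‖p.1‖ * f p.2) ((nu N).prod volume) := by
    have h1 : Integrable (fun p : EP N × EE N => f p.2) ((nu N).prod volume) := hf.comp_snd _
    refine h1.bdd_mul (c := C) ?_ ?_
    · refine Measurable.aestronglyMeasurable ?_
      have hm : Measurable (fun p : EP N × EE N => (inner ℝ p.1 (om p.2), ‖p.1‖)) := by
        refine Continuous.measurable ?_
        have := om_cont (N := N)
        fun_prop
      exact hF.comp hm
    · have := Measure.quasiMeasurePreserving_fst (μ := nu N) (ν := (volume : Measure (EE N))) |>.ae (nu_ae N)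
      filter_upwards [this] with p hp
      exact hC _ _ (inner_om_le _ _) hp
  refine ⟨hint.integral_prod_left, ?_⟩
  rw [integral_integral_swap hint, ← integral_const_mul]
  congr 1; ext x
  rw [integral_mul_const]
  congr 1
  exact nu_inv F (by rw [om_norm, om_norm])


lemma seg {N : ℕ} {u : EE N → ℝ} (hu : ContDiff ℝ 1 u) (x y : EE N) :
    (u x - u y) ^ 2 ≤ ∫ s in (0:ℝ)..1, ‖x - y‖ ^ 2 * ‖gradient u ((1 - s) • x + s • y)‖ ^ 2 := by
  have hg := continuous_grad hu
  set g : ℝ → ℝ := fun s => inner ℝ (gradient u ((1 - s) • x + s • y)) (y - x) with hgdef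
  have hgc : Continuous g := by fun_prop
  have hd : ∀ s ∈ Set.uIcc (0:ℝ) 1, HasDerivAt (fun s : ℝ => u ((1 - s) • x + s • y)) (g s) s := by
    intro s _
    have h1 : HasDerivAt (fun s : ℝ => (1 - s) • x + s • y) (y - x) s := by
      have := (((hasDerivAt_id s).const_sub 1).smul_const x).add ((hasDerivAt_id s).smul_const y)
      have e : y - x = (-1:ℝ) • x + (1:ℝ) • y := by module
      rw [e]; exact this
    have h2 := (hu.differentiable (by simp) ((1 - s) • x + s • y)).hasGradientAt.hasFDerivAt
    have := h2.comp_hasDerivAt s h1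
    exact this
  have hI := intervalIntegral.integral_eq_sub_of_hasDerivAt hd (hgc.intervalIntegrable _ _)
  simp at hI
  set m := ∫ s in (0:ℝ)..1, g s
  have h0 : 0 ≤ ∫ s in (0:ℝ)..1, (g s - m) ^ 2 :=
    intervalIntegral.integral_nonneg (by norm_num) (fun s _ => sq_nonneg _)
  have e : ∫ s in (0:ℝ)..1, (g s - m) ^ 2 = (∫ s in (0:ℝ)..1, (g s)^2) - m ^ 2 := by
    have : ∀ s, (g s - m) ^ 2 = (g s) ^ 2 - 2 * m * g s + m ^ 2 := fun s => by ring
    simp only [this]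
    rw [intervalIntegral.integral_add, intervalIntegral.integral_sub, intervalIntegral.integral_const_mul]
    · change _ - 2 * m * m + _ = _
      simp; ring
    all_goals apply Continuous.intervalIntegrable; fun_prop
  have h2 : ∫ s in (0:ℝ)..1, (g s)^2 ≤ ∫ s in (0:ℝ)..1, ‖x - y‖ ^ 2 * ‖gradient u ((1 - s) • x + s • y)‖ ^ 2 := by
    apply intervalIntegral.integral_mono_on (by norm_num)
    · apply Continuous.intervalIntegrable; fun_prop
    · apply Continuous.intervalIntegrable; fun_prop
    · intro s _
      have := abs_real_inner_le_norm (gradient u ((1 - s) • x + s • y)) (y - x)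
      rw [norm_sub_rev x y, ← mul_pow, ← sq_abs, mul_comm ‖y - x‖]
      exact pow_le_pow_left₀ (abs_nonneg _) this 2
  have : (u x - u y) ^ 2 = m ^ 2 := by rw [hI]; ring
  linarith

lemma weights {N n : ℕ} (x y : EE N) {s : ℝ} (h0 : 0 ≤ s) (h1 : s ≤ 1) :
    ‖x - y‖ ^ 2 * (1 / ell x) ^ (n+1) * (1 / ell y) ^ (n+1) ≤
      2 * 4 ^ n * (1 / ell ((1 - s) • x + s • y)) ^ n *
        ((1-s) ^ (2*n) * (1/ell y) ^ n + s ^ (2*n) * (1/ell x) ^ n) := by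
  have hx := ell_pos x
  have hy := ell_pos y
  set z := (1 - s) • x + s • y with hz
  have hzp := ell_pos z
  have a1 : ‖x - y‖ ^ 2 ≤ 2 * (ell x * ell y) := by
    have : ‖x - y‖ ≤ ‖x‖ + ‖y‖ := norm_sub_le _ _
    have h2 := pow_le_pow_left₀ (norm_nonneg _) this 2
    unfold ell
    nlinarith [sq_nonneg (‖x‖ - ‖y‖), mul_nonneg (sq_nonneg ‖x‖) (sq_nonneg ‖y‖)]
  have a2 : ell z ≤ 2 * ((1-s)^2 * ell x + s ^2 * ell y) := by
    have : ‖z‖ ≤ (1-s) * ‖x‖ + s * ‖y‖ := by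
      refine (norm_add_le _ _).trans ?_
      rw [norm_smul, norm_smul, Real.norm_eq_abs, Real.norm_eq_abs, abs_of_nonneg h0, abs_of_nonneg (by linarith : 0 ≤ 1 - s)]
    have h2 := pow_le_pow_left₀ (norm_nonneg _) this 2
    unfold ell
    nlinarith [sq_nonneg ((1-s) * ‖x‖ - s * ‖y‖), sq_nonneg (1 - 2 * s)]
  have a3 : ell z ^ n ≤ 4 ^ n * (((1-s)^2 * ell x) ^ n + (s ^2 * ell y)^n) := by
    refine (pow_le_pow_left₀ hzp.le a2 n).trans ?_
    rw [mul_pow, show (4:ℝ)^n = 2^n * 2^n by rw [← mul_pow]; norm_num, mul_assoc]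
    refine mul_le_mul_of_nonneg_left ?_ (by positivity)
    refine (add_pow_le (by positivity) (by positivity) n).trans ?_
    refine mul_le_mul_of_nonneg_right ?_ (by positivity)
    exact pow_le_pow_right₀ (by norm_num) (Nat.sub_le _ _)
  have e1 : ‖x - y‖ ^ 2 * (1 / ell x) ^ (n+1) * (1 / ell y) ^ (n+1) ≤ 2 * ((1/ell x)^n * (1/ell y)^n) := by
    have : 2 * ((1/ell x)^n * (1/ell y)^n) = 2 * (ell x * ell y) * (1 / ell x) ^ (n+1) * (1 / ell y) ^ (n+1) := by
      simp only [one_div, inv_pow, pow_succ]; field_simp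
    rw [this]
    gcongr
  refine e1.trans ?_
  have e2 : 2 * 4 ^ n * (1 / ell z) ^ n *
        ((1-s) ^ (2*n) * (1/ell y) ^ n + s ^ (2*n) * (1/ell x) ^ n) =
     2 * ((1/ell x)^n * (1/ell y)^n) * ((1/ell z)^n * (4 ^ n * (((1-s)^2 * ell x) ^ n + (s ^2 * ell y)^n))) := by
    rw [mul_pow, mul_pow, ← pow_mul, ← pow_mul]; simp only [one_div, inv_pow]; field_simp
  rw [e2]
  refine le_mul_of_one_le_right (by positivity) ?_
  calc (1:ℝ) = (1/ell z)^n * ell z ^ n := by rw [← mul_pow]; simp [hzp.ne']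
    _ ≤ _ := by gcongr

lemma lint_aff {N : ℕ} (h : EE N → ENNReal) (hm : Measurable h) {t : ℝ} (ht : 0 < t) (y : EE N) :
    ∫⁻ x, h (t • x + y) = ENNReal.ofReal ((t ^ N)⁻¹) * ∫⁻ x, h x := by
  rw [lintegral_add_right_eq_self (fun x => h (t • x + y)) 0 |>.symm]
  have : ∫⁻ x : EE N, h (t • (x + 0) + y) = ∫⁻ z, h (z + y) ∂(Measure.map (fun x : EE N => t • x) volume) := by
    rw [lintegral_map (by fun_prop) (by fun_prop)]; simp
  rw [this, Measure.map_addHaar_smul _ ht.ne', lintegral_smul_measure, lintegral_add_right_eq_self]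
  simp [abs_of_pos ht]

lemma triple {N n : ℕ} (hn : N ≤ 2 * n) {h W : EE N → ENNReal} (hm : Measurable h) (hW : Measurable W)
    {κ : ℝ → ℝ} (hκ : Measurable κ) (h01 : ∀ s ∈ Set.Ioo (0:ℝ) 1, 0 < κ s ∧ κ s < 1) :
    ∫⁻ y, ∫⁻ x, ∫⁻ s in Set.Ioo (0:ℝ) 1, h (κ s • x + (1 - κ s) • y) * (ENNReal.ofReal (κ s ^ (2 * n)) * W y)
      ≤ (∫⁻ y, W y) * ∫⁻ x, h x := by
  rw [← lintegral_mul_const _ hW]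
  refine lintegral_mono fun y => ?_
  rw [lintegral_lintegral_swap]
  swap
  · apply Measurable.aemeasurable
    refine Measurable.mul (hm.comp (by fun_prop)) (Measurable.mul ?_ measurable_const)
    exact ENNReal.measurable_ofReal.comp (by fun_prop)
  have : ∀ s ∈ Set.Ioo (0:ℝ) 1, ∫⁻ x, h (κ s • x + (1 - κ s) • y) * (ENNReal.ofReal (κ s ^ (2 * n)) * W y) ≤ W y * ∫⁻ x, h x := by
    intro s hs
    obtain ⟨hk, hk1⟩ := h01 s hs
    have hmm : Measurable (fun x => h (κ s • x + (1 - κ s) • y)) := hm.comp (by fun_prop)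
    rw [lintegral_mul_const _ hmm, lint_aff h hm hk]
    calc _ = (ENNReal.ofReal ((κ s ^ N)⁻¹) * ENNReal.ofReal (κ s ^ (2 * n))) * (W y * ∫⁻ x, h x) := by ring
      _ ≤ 1 * (W y * ∫⁻ x, h x) := by
        gcongr
        rw [← ENNReal.ofReal_mul (by positivity), ← ENNReal.ofReal_one]
        apply ENNReal.ofReal_le_ofReal
        rw [inv_mul_le_one₀ (by positivity)]
        exact pow_le_pow_of_le_one hk.le hk1.le hn
      _ = _ := one_mul _
  refine (setLIntegral_mono' measurableSet_Ioo this).trans ?_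
  simp

set_option maxHeartbeats 1600000 in
lemma poincare {N : ℕ} (hN : 3 ≤ N) : ∃ C : ℝ, 0 < C ∧ ∀ u : EE N → ℝ, Adm u → ∃ c : ℝ,
    ∫ x, (u x - c) ^ 2 * (1 / ell x) ^ N ≤ C * ∫ x, (1 / ell x) ^ (N-2) * ‖gradient u x‖ ^ 2 := by
  obtain ⟨n, rfl⟩ : ∃ n, N = n + 1 := ⟨N - 1, by omega⟩
  have hec := ell_cont (N := n+1)
  have hel := fun x : EE (n+1) => (ell_pos x).ne'
  set M := ∫ x : EE (n+1), (1 / ell x) ^ (n+1) with hM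
  set w := ∫ x : EE (n+1), (1 / ell x) ^ n with hw
  have iM := integrable_ell (N := n+1) (m := n+1) (by omega)
  have iw := integrable_ell (N := n+1) (m := n) (by omega)
  have cpow : ∀ m : ℕ, Continuous (fun x : EE (n+1) => (1 / ell x) ^ m) := fun m => by fun_prop (disch := assumption)
  have ppos : ∀ m : ℕ, ∀ x : EE (n+1), 0 < (1 / ell x) ^ m := fun m x => by have := ell_pos x; positivity
  have posi : ∀ m : ℕ, Integrable (fun x : EE (n+1) => (1 / ell x) ^ m) → 0 < ∫ x : EE (n+1), (1 / ell x) ^ m := by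
    intro m hm
    refine (integral_pos_iff_support_of_nonneg (fun x => (ppos m x).le) hm).2 ?_
    have : Function.support (fun x : EE (n+1) => (1 / ell x) ^ m) = Set.univ := by
      ext x; simp [(ell_pos x).ne']
    rw [this]; simp
  have hMp : 0 < M := posi _ iM
  have hwp : 0 < w := posi _ iw
  refine ⟨2 * 4 ^ n * (2 * w) / M, by positivity, ?_⟩
  intro u hu
  have hg := continuous_grad hu.1
  have hgs := grad_compact hu.2
  have huc := hu.1.continuous
  set hr : EE (n+1) → ℝ := fun z => ‖gradient u z‖ ^ 2 * (1 / ell z) ^ n with hhr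
  have hrc : Continuous hr := (hg.norm.pow 2).mul (cpow n)
  have hri : Integrable hr := by
    apply hrc.integrable_of_hasCompactSupport
    apply HasCompactSupport.mul_right
    exact hgs.comp_left (g := fun v => ‖v‖ ^ 2) (by simp)
  set H := ∫ x, hr x with hH
  have hH0 : 0 ≤ H := integral_nonneg fun x => mul_nonneg (by positivity) (ppos n x).le
  have hrle : H ≤ ∫ x, (1 / ell x) ^ (n+1-2) * ‖gradient u x‖ ^ 2 := by
    apply integral_mono hri
    · apply Continuous.integrable_of_hasCompactSupport
      · exact (cpow _).mul (hg.norm.pow 2)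
      · apply HasCompactSupport.mul_left
        exact hgs.comp_left (g := fun v => ‖v‖ ^ 2) (by simp)
    · intro x
      simp only [hhr]
      rw [mul_comm]
      gcongr ?_ * _
      apply pow_le_pow_of_le_one
      · have := ell_pos x; positivity
      · rw [div_le_one (ell_pos x)]; exact one_le_ell x
      · omega
  set h : EE (n+1) → ENNReal := fun z => ENNReal.ofReal (hr z) with hh
  set W : EE (n+1) → ENNReal := fun z => ENNReal.ofReal ((1 / ell z) ^ n) with hWd
  have hm : Measurable h := ENNReal.measurable_ofReal.comp hrc.measurable
  have hWm : Measurable W := ENNReal.measurable_ofReal.comp (cpow n).measurable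
  have eH : ∫⁻ x, h x = ENNReal.ofReal H :=
    (ofReal_integral_eq_lintegral_ofReal hri (Filter.Eventually.of_forall fun x => mul_nonneg (by positivity) (ppos n x).le)).symm
  have eW : ∫⁻ x, W x = ENNReal.ofReal w :=
    (ofReal_integral_eq_lintegral_ofReal iw (Filter.Eventually.of_forall fun x => (ppos n x).le)).symm
  set K : ENNReal := ENNReal.ofReal (2 * 4 ^ n) * (ENNReal.ofReal w * ENNReal.ofReal H + ENNReal.ofReal w * ENNReal.ofReal H) with hK
  set A : EE (n+1) → EE (n+1) → ℝ → ENNReal := fun y x s => h ((1-s) • x + (1 - (1-s)) • y) * (ENNReal.ofReal ((1-s) ^ (2 * n)) * W y) with hA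
  set B : EE (n+1) → EE (n+1) → ℝ → ENNReal := fun y x s => h (s • y + (1 - s) • x) * (ENNReal.ofReal (s ^ (2 * n)) * W x) with hB
  have hAm : Measurable (fun q : (EE (n+1) × EE (n+1)) × ℝ => A q.1.1 q.1.2 q.2) := by
    refine Measurable.mul (hm.comp (by fun_prop)) (Measurable.mul ?_ (hWm.comp (by fun_prop)))
    exact ENNReal.measurable_ofReal.comp (by fun_prop)
  have hBm : Measurable (fun q : (EE (n+1) × EE (n+1)) × ℝ => B q.1.1 q.1.2 q.2) := by
    refine Measurable.mul (hm.comp (by fun_prop)) (Measurable.mul ?_ (hWm.comp (by fun_prop)))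
    exact ENNReal.measurable_ofReal.comp (by fun_prop)
  clear_value A B
  have pt : ∀ y x, ENNReal.ofReal ((u x - u y) ^ 2 * (1 / ell x) ^ (n+1) * (1 / ell y) ^ (n+1)) ≤
      ENNReal.ofReal (2 * 4 ^ n) * ((∫⁻ s in Set.Ioo (0:ℝ) 1, A y x s) + ∫⁻ s in Set.Ioo (0:ℝ) 1, B y x s) := by
    intro y x
    have h1 := seg hu.1 x y
    rw [intervalIntegral.integral_of_le (by norm_num), integral_Ioc_eq_integral_Ioo] at h1
    have hc2 : Continuous (fun s : ℝ => ‖x - y‖ ^ 2 * ‖gradient u ((1 - s) • x + s • y)‖ ^ 2) := by fun_prop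
    have hc2i : IntegrableOn (fun s : ℝ => ‖x - y‖ ^ 2 * ‖gradient u ((1 - s) • x + s • y)‖ ^ 2) (Set.Ioo (0:ℝ) 1) :=
      (hc2.integrableOn_Icc (a := 0) (b := 1)).mono_set Set.Ioo_subset_Icc_self
    have := ppos (n+1) x
    have := ppos (n+1) y
    rw [mul_assoc, ENNReal.ofReal_mul (sq_nonneg _)]
    have h2 := ENNReal.ofReal_le_ofReal h1
    rw [ofReal_integral_eq_lintegral_ofReal hc2i (Filter.Eventually.of_forall fun s => by positivity)] at h2
    refine (mul_le_mul_left h2 _).trans ?_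
    have m1 : Measurable (fun s : ℝ => ENNReal.ofReal (‖x - y‖ ^ 2 * ‖gradient u ((1 - s) • x + s • y)‖ ^ 2)) :=
      ENNReal.measurable_ofReal.comp hc2.measurable
    have mm : Measurable fun s : ℝ => ((y, x), s) := by fun_prop
    have m2 : Measurable (fun s => A y x s) := by have h := hAm.comp mm; exact h
    have m3 : Measurable (fun s => B y x s) := by have h := hBm.comp mm; exact h
    have m4 : Measurable (fun s => A y x s + B y x s) := m2.add m3
    rw [← lintegral_mul_const _ m1, ← lintegral_add_left m2, ← lintegral_const_mul _ m4]
    refine setLIntegral_mono' measurableSet_Ioo fun s hs => ?_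
    have hw := weights (n := n) x y hs.1.le hs.2.le
    simp only [hA, hB, hh, hWd]
    rw [show (1 - (1 - s)) = s by ring, show s • y + (1-s) • x = (1-s) • x + s • y from add_comm _ _]
    set z := (1-s) • x + s • y
    have hs0 := hs.1
    have hs1 : 0 < 1 - s := by linarith [hs.2]
    have := ppos n x
    have := ppos n y
    have := ppos n z
    rw [← ENNReal.ofReal_mul (by positivity), ← ENNReal.ofReal_mul (by positivity), ← ENNReal.ofReal_mul (by positivity),
      ← ENNReal.ofReal_mul (by positivity), ← ENNReal.ofReal_mul (by positivity),
      ← ENNReal.ofReal_add (by positivity) (by positivity), ← ENNReal.ofReal_mul (by positivity)]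
    apply ENNReal.ofReal_le_ofReal
    calc _ = ‖gradient u z‖ ^ 2 * (‖x - y‖ ^ 2 * (1 / ell x) ^ (n+1) * (1 / ell y) ^ (n+1)) := by ring
      _ ≤ ‖gradient u z‖ ^ 2 * _ := mul_le_mul_of_nonneg_left hw (by positivity)
      _ = _ := by simp only [hhr]; ring
  have tot : ∫⁻ y, ∫⁻ x, ENNReal.ofReal ((u x - u y) ^ 2 * (1 / ell x) ^ (n+1) * (1 / ell y) ^ (n+1)) ≤ K := by
    refine (lintegral_mono fun y => lintegral_mono fun x => pt y x).trans ?_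
    have mA : Measurable (fun q : EE (n+1) × EE (n+1) => ∫⁻ s in Set.Ioo (0:ℝ) 1, A q.1 q.2 s) := hAm.lintegral_prod_right'
    have mB : Measurable (fun q : EE (n+1) × EE (n+1) => ∫⁻ s in Set.Ioo (0:ℝ) 1, B q.1 q.2 s) := hBm.lintegral_prod_right'
    have mAB := mA.add mB
    have e1 : ∀ y, ∫⁻ x, ENNReal.ofReal (2 * 4 ^ n) * ((∫⁻ s in Set.Ioo (0:ℝ) 1, A y x s) + ∫⁻ s in Set.Ioo (0:ℝ) 1, B y x s)
       = ENNReal.ofReal (2 * 4 ^ n) * ((∫⁻ x, ∫⁻ s in Set.Ioo (0:ℝ) 1, A y x s) + ∫⁻ x, ∫⁻ s in Set.Ioo (0:ℝ) 1, B y x s) := by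
      intro y
      have m1 : Measurable (fun x : EE (n+1) => (y, x)) := by fun_prop
      have m2 : Measurable (fun x => ∫⁻ s in Set.Ioo (0:ℝ) 1, A y x s) := mA.comp m1
      have m3 : Measurable (fun x => (∫⁻ s in Set.Ioo (0:ℝ) 1, A y x s) + ∫⁻ s in Set.Ioo (0:ℝ) 1, B y x s) := mAB.comp m1
      rw [lintegral_const_mul _ m3, lintegral_add_left m2]
    simp only [e1]
    have nA : Measurable (fun y => ∫⁻ x, ∫⁻ s in Set.Ioo (0:ℝ) 1, A y x s) := mA.lintegral_prod_right'
    have nB : Measurable (fun y => ∫⁻ x, ∫⁻ s in Set.Ioo (0:ℝ) 1, B y x s) := mB.lintegral_prod_right'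
    have nAB : Measurable (fun y => (∫⁻ x, ∫⁻ s in Set.Ioo (0:ℝ) 1, A y x s) + ∫⁻ x, ∫⁻ s in Set.Ioo (0:ℝ) 1, B y x s) := nA.add nB
    rw [lintegral_const_mul _ nAB, lintegral_add_left nA]
    rw [hK, ← eH, ← eW]
    gcongr
    · rw [hA]; exact triple (by omega) hm hWm (κ := fun s => 1 - s) (by fun_prop) (fun s hs => ⟨by linarith [hs.2], by linarith [hs.1]⟩)
    · rw [lintegral_lintegral_swap mB.aemeasurable]
      rw [hB]; exact triple (by omega) hm hWm (κ := fun s => s) (by fun_prop) (fun s hs => hs)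
  set g : EE (n+1) → ENNReal := fun y => ∫⁻ x, ENNReal.ofReal ((u x - u y) ^ 2 * (1 / ell x) ^ (n+1)) with hgd
  have gm : Measurable g := by
    have cc : Continuous (fun q : EE (n+1) × EE (n+1) => (u q.2 - u q.1) ^ 2 * (1 / ell q.2) ^ (n+1)) :=
      (by fun_prop : Continuous (fun q : EE (n+1) × EE (n+1) => (u q.2 - u q.1) ^ 2)).mul ((cpow (n+1)).comp continuous_snd)
    exact (ENNReal.measurable_ofReal.comp cc.measurable).lintegral_prod_right'
  have mem : Measurable (fun y : EE (n+1) => ENNReal.ofReal ((1 / ell y) ^ (n+1))) := ENNReal.measurable_ofReal.comp (cpow _).measurable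
  have tot2 : ∫⁻ y, g y * ENNReal.ofReal ((1 / ell y) ^ (n+1)) ≤ K := by
    refine le_trans (le_of_eq ?_) tot
    congr 1; ext y
    rw [hgd, ← lintegral_mul_const]
    · congr 1; ext x
      rw [← ENNReal.ofReal_mul]
      have := ppos (n+1) x; positivity
    · refine ENNReal.measurable_ofReal.comp (Continuous.measurable ?_)
      exact (by fun_prop : Continuous (fun x => (u x - u y) ^ 2)).mul (cpow (n+1))
  have eM : ∫⁻ x : EE (n+1), ENNReal.ofReal ((1 / ell x) ^ (n+1)) = ENNReal.ofReal M :=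
    (ofReal_integral_eq_lintegral_ofReal iM (Filter.Eventually.of_forall fun x => (ppos _ x).le)).symm
  set Kr := 2 * 4 ^ n * (2 * w) * H with hKr
  have eK : K = ENNReal.ofReal Kr := by
    rw [hK, ← two_mul, ← ENNReal.ofReal_mul hwp.le, show (2 : ENNReal) = ENNReal.ofReal 2 by simp,
      ← ENNReal.ofReal_mul (by norm_num), ← ENNReal.ofReal_mul (by positivity)]
    congr 1; rw [hKr]; ring
  obtain ⟨y0, hy0⟩ : ∃ y, g y ≤ ENNReal.ofReal (Kr / M) := by
    by_contra! hcon
    have : ∫⁻ y : EE (n+1), ENNReal.ofReal (Kr / M) * ENNReal.ofReal ((1 / ell y) ^ (n+1)) < ∫⁻ y, g y * ENNReal.ofReal ((1 / ell y) ^ (n+1)) := by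
      apply lintegral_strict_mono (NeZero.ne _) (gm.mul mem).aemeasurable
      · rw [lintegral_const_mul _ mem, eM]
        exact ENNReal.mul_ne_top ENNReal.ofReal_ne_top ENNReal.ofReal_ne_top
      · refine Filter.Eventually.of_forall fun y => ?_
        refine ENNReal.mul_lt_mul_left (ENNReal.ofReal_pos.2 (ppos _ y)).ne' ENNReal.ofReal_ne_top (hcon y)
    rw [lintegral_const_mul _ mem, eM, ← ENNReal.ofReal_mul (by positivity), div_mul_cancel₀ _ hMp.ne', ← eK] at this
    exact absurd tot2 (not_le.2 this)
  refine ⟨u y0, ?_⟩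
  have : ∫ x, (u x - u y0) ^ 2 * (1 / ell x) ^ (n+1) ≤ Kr / M := by
    rw [integral_eq_lintegral_of_nonneg_ae]
    · exact ENNReal.toReal_le_of_le_ofReal (by positivity) hy0
    · exact Filter.Eventually.of_forall fun x => mul_nonneg (sq_nonneg _) (ppos _ x).le
    · exact ((by fun_prop : Continuous (fun x => (u x - u y0) ^ 2)).mul (cpow (n+1))).aestronglyMeasurable
  refine this.trans ?_
  rw [hKr]
  calc _ = 2 * 4 ^ n * (2 * w) / M * H := by ring
    _ ≤ _ := mul_le_mul_of_nonneg_left hrle (by positivity)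


def UU {N : ℕ} (x : EE N) : ℝ := VV 1 1 1 0 x

lemma PP_one {N : ℕ} (x : EE N) : PP 1 1 0 x = ell x := by simp [PP, ell]; ring
lemma PP_one_pos {N : ℕ} (x : EE N) : 0 < PP 1 1 0 x := by rw [PP_one]; exact ell_pos x
lemma UU_bubble {N : ℕ} : (UU : EE N → ℝ) = sobolevBubble N 1 0 := by
  ext x; simp [UU, VV, PP_one, sobolevBubble, ell, kk]
lemma UU_cd {N : ℕ} : ContDiff ℝ 1 (UU : EE N → ℝ) := VV_cont one_pos PP_one_pos
lemma UU_pos {N : ℕ} (x : EE N) : 0 < UU x := VV_pos one_pos (PP_one_pos x)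
lemma UU_sq {N : ℕ} (hN : 3 ≤ N) (x : EE N) : UU x ^ 2 = (1 / ell x) ^ (N-2) := by
  rw [UU, VV_sq hN one_pos (PP_one_pos x), PP_one]
lemma UU_q {N : ℕ} (hN : 3 ≤ N) (x : EE N) : UU x ^ (qq N) = (1 / ell x) ^ N := by
  rw [UU, VV_q hN one_pos (PP_one_pos x), PP_one]

lemma qq_gt {N : ℕ} (hN : 3 ≤ N) : 2 < qq N := by
  have : (3:ℝ) ≤ N := by exact_mod_cast hN
  rw [qq, lt_div_iff₀ (by linarith)]; linarith

lemma ground0 {N : ℕ} (hN : 3 ≤ N) {u : EE N → ℝ} (hu : Adm u) :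
    ∫ x, ‖gradient (fun y => u y * UU y) x‖ ^ 2 =
      (∫ x, (1 / ell x) ^ (N - 2) * ‖gradient u x‖ ^ 2) +
        (N * ((N:ℝ) - 2)) * ∫ x, u x ^ 2 * (1 / ell x) ^ N := by
  have := ground hN (s := 1) (β := 1) (γ := 1) (a := 0) one_pos PP_one_pos (by simp) hu
  simp only [PP_one] at this
  exact this

lemma grad_aff {N : ℕ} {f : EE N → ℝ} (hf : Differentiable ℝ f) (t : ℝ) (y x : EE N) :
    gradient (fun x => f (t • (x - y))) x = t • gradient f (t • (x - y)) := by
  have h1 : HasFDerivAt (fun x : EE N => t • (x - y)) (t • ContinuousLinearMap.id ℝ (EE N)) x :=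
    ((hasFDerivAt_id x).sub_const y).const_smul t
  have := ((hf (t • (x - y))).hasFDerivAt.comp x h1).fderiv
  unfold gradient
  rw [show (fun x => f (t • (x - y))) = f ∘ (fun x : EE N => t • (x - y)) from rfl, this]
  simp

lemma sobolev {N : ℕ} (hN : 3 ≤ N) : ∃ K : ℝ, 0 < K ∧ ∀ u : EE N → ℝ, Adm u →
    ∫ x, |u x| ^ (qq N) ≤ (K * ∫ x, ‖gradient u x‖ ^ 2) ^ (qq N / 2) := by
  have h3 : (3:ℝ) ≤ N := by exact_mod_cast hN
  have hq := qq_gt hN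
  set c : ℝ := (SNormLESNormFDerivOfEqConst ℝ (volume : Measure (EE N)) ((2 : NNReal) : ℝ) : ℝ) with hc
  refine ⟨(c + 1) ^ 2, by positivity, fun u hu => ?_⟩
  obtain ⟨r, hr⟩ : ∃ r : NNReal, (r : ℝ) = qq N := ⟨⟨qq N, by linarith⟩, rfl⟩
  have hp' : (r : ℝ)⁻¹ = ((2 : NNReal) : ℝ)⁻¹ - (Module.finrank ℝ (EE N) : ℝ)⁻¹ := by
    rw [hr]
    simp [qq]
    field_simp [show (N:ℝ) - 2 ≠ 0 by linarith]
  have key := eLpNorm_le_eLpNorm_fderiv_of_eq (volume : Measure (EE N)) hu.1 hu.2 (p := 2) (p' := r)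
    (by norm_num) (by simp; omega) hp'
  have m1 : MemLp u (r : ENNReal) := hu.1.continuous.memLp_of_hasCompactSupport hu.2
  have m2 : MemLp (fderiv ℝ u) ((2 : NNReal) : ENNReal) :=
    (hu.1.continuous_fderiv (by simp)).memLp_of_hasCompactSupport (hu.2.fderiv (𝕜 := ℝ))
  rw [m1.eLpNorm_eq_integral_rpow_norm (by rw [Ne, ENNReal.coe_eq_zero, ← NNReal.coe_eq_zero, hr]; linarith) (by simp),
    m2.eLpNorm_eq_integral_rpow_norm (by simp) (by simp)] at key
  simp only [ENNReal.coe_toReal, hr, NNReal.coe_ofNat] at key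
  have I0 : 0 ≤ ∫ x, |u x| ^ (qq N) := integral_nonneg fun x => by positivity
  have J0 : 0 ≤ ∫ x, ‖gradient u x‖ ^ 2 := integral_nonneg fun x => by positivity
  have e : ∫ x, ‖fderiv ℝ u x‖ ^ (2:ℝ) = ∫ x, ‖gradient u x‖ ^ 2 := by
    congr 1; ext x; rw [norm_grad]; simp
  rw [e, ENNReal.coe_nnreal_eq, ← ENNReal.ofReal_mul (by positivity), ENNReal.ofReal_le_ofReal_iff (by positivity)] at key
  simp only [Real.norm_eq_abs] at key
  have k2 : (∫ x, |u x| ^ (qq N)) ^ (qq N)⁻¹ ≤ (c+1) * (∫ x, ‖gradient u x‖ ^ 2) ^ (2:ℝ)⁻¹ := by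
    refine key.trans ?_
    gcongr
    exact (by linarith : c ≤ c + 1)
  have c0 : 0 ≤ c := NNReal.coe_nonneg _
  have := Real.rpow_le_rpow (by positivity) k2 (by linarith : 0 ≤ qq N)
  rw [← Real.rpow_mul I0, inv_mul_cancel₀ (by linarith), Real.rpow_one] at this
  refine this.trans (le_of_eq ?_)
  rw [show qq N / 2 = (2:ℝ)⁻¹ * qq N by ring, Real.rpow_mul (by positivity), Real.mul_rpow (by positivity) J0]
  congr 2
  rw [← Real.rpow_natCast, ← Real.rpow_mul (by linarith)]; simp

lemma fatou {N : ℕ} {f : ℕ → EE N → ℝ} {F : EE N → ℝ} {b : ℕ → ℝ} {B : ℝ}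
    (hf : ∀ n, Integrable (f n)) (hf0 : ∀ n x, 0 ≤ f n x) (hF : Continuous F)
    (hlim : ∀ x, Filter.Tendsto (fun n => f n x) Filter.atTop (nhds (F x)))
    (hb : ∀ n, ∫ x, f n x ≤ b n) (hB : Filter.Tendsto b Filter.atTop (nhds B)) :
    Integrable F ∧ ∫ x, F x ≤ B := by
  have F0 : ∀ x, 0 ≤ F x := fun x => ge_of_tendsto' (hlim x) (fun n => hf0 n x)
  have B0 : 0 ≤ B := ge_of_tendsto' hB fun n => (integral_nonneg (hf0 n)).trans (hb n)
  have key : ∫⁻ x, ENNReal.ofReal (F x) ≤ ENNReal.ofReal B := by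
    have h1 : ∀ x, ENNReal.ofReal (F x) = Filter.liminf (fun n => ENNReal.ofReal (f n x)) Filter.atTop := fun x =>
      ((ENNReal.continuous_ofReal.tendsto _).comp (hlim x)).liminf_eq.symm
    simp only [h1]
    refine (lintegral_liminf_le' fun n => (hf n).aestronglyMeasurable.aemeasurable.ennreal_ofReal).trans ?_
    rw [← ((ENNReal.continuous_ofReal.tendsto _).comp hB).liminf_eq]
    refine Filter.liminf_le_liminf (Filter.Eventually.of_forall fun n => ?_)
    simp only [Function.comp]
    rw [← ofReal_integral_eq_lintegral_ofReal (hf n) (Filter.Eventually.of_forall (hf0 n))]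
    exact ENNReal.ofReal_le_ofReal (hb n)
  constructor
  · refine ⟨hF.aestronglyMeasurable, ?_⟩
    rw [hasFiniteIntegral_iff_ofReal (Filter.Eventually.of_forall F0)]
    exact key.trans_lt ENNReal.ofReal_lt_top
  · rw [integral_eq_lintegral_of_nonneg_ae (Filter.Eventually.of_forall F0) hF.aestronglyMeasurable]
    exact ENNReal.toReal_le_of_le_ofReal B0 key


lemma cutoff (N : ℕ) : ∃ χ : ℕ → EE N → ℝ, ∃ L : ℝ, (∀ n, ContDiff ℝ 1 (χ n)) ∧ (∀ n, HasCompactSupport (χ n)) ∧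
    (∀ n x, 0 ≤ χ n x ∧ χ n x ≤ 1) ∧ (∀ (n : ℕ) x, ‖x‖ < (n:ℝ) + 1 → χ n x = 1) ∧
    (∀ n x, ‖gradient (χ n) x‖ ^ 2 ≤ L * (1 / ell x)) := by
  let g : ContDiffBump (0 : EE N) := ⟨1, 2, one_pos, by norm_num⟩
  have hg : ContDiff ℝ 1 g := g.contDiff
  have hgs : HasCompactSupport g := g.hasCompactSupport
  obtain ⟨L, hL⟩ := (continuous_grad hg).bounded_above_of_compact_support (grad_compact hgs)
  have hp : ∀ n : ℕ, (0:ℝ) < (n:ℝ) + 1 := fun n => by positivity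
  refine ⟨fun n x => g (((n:ℝ)+1)⁻¹ • (x - 0)), 5 * L ^ 2, fun n => ?_, fun n => ?_, fun n x => ⟨g.nonneg, g.le_one⟩, fun n x hx => ?_, fun n x => ?_⟩
  · exact hg.comp (by fun_prop)
  · have h := hgs.comp_homeomorph (Homeomorph.smulOfNeZero ((n:ℝ)+1)⁻¹ (inv_ne_zero (hp n).ne'))
    simp only [sub_zero]
    exact h
  · apply g.one_of_mem_closedBall
    rw [sub_zero, mem_closedBall_zero_iff, norm_smul, norm_inv, Real.norm_eq_abs, abs_of_pos (hp n), inv_mul_le_iff₀ (hp n)]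
    simp [g]; exact hx.le
  · rw [grad_aff (hg.differentiable (by simp)), sub_zero, norm_smul, norm_inv, Real.norm_eq_abs, abs_of_pos (hp n)]
    have hL0 : 0 ≤ L := (norm_nonneg _).trans (hL 0)
    rw [mul_one_div, le_div_iff₀ (ell_pos x), mul_pow]
    by_cases hx : ‖x‖ ≤ 2 * (n+1)
    · have h1 : ell x ≤ 5 * ((n:ℝ)+1)^2 := by
        unfold ell
        have := pow_le_pow_left₀ (norm_nonneg _) hx 2
        have : (1:ℝ) ≤ (n+1:ℝ)^2 := one_le_pow₀ (by linarith [(Nat.cast_nonneg n : (0:ℝ) ≤ n)])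
        nlinarith
      have h2 := pow_le_pow_left₀ (norm_nonneg _) (hL (((n:ℝ)+1)⁻¹ • x)) 2
      have := (ell_pos x).le
      calc _ ≤ (((n:ℝ)+1)⁻¹) ^ 2 * L ^ 2 * (5 * ((n:ℝ)+1)^2) := by gcongr
        _ = _ := by field_simp
    · have h0 : gradient g (((n:ℝ)+1)⁻¹ • x) = 0 := by
        apply image_eq_zero_of_notMem_tsupport
        intro hmem
        have h3 : tsupport (gradient g) ⊆ tsupport g := by
          apply closure_minimal _ (isClosed_tsupport _)
          intro y hy
          by_contra hy2
          apply hy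
          have := notMem_tsupport_iff_eventuallyEq.1 hy2
          unfold gradient
          rw [this.fderiv_eq]; simp
        have h4 := h3 hmem
        rw [g.tsupport_eq, mem_closedBall_zero_iff, norm_smul, norm_inv, Real.norm_eq_abs, abs_of_pos (hp n), inv_mul_le_iff₀ (hp n)] at h4
        simp [g] at h4
        apply hx; linarith
      rw [h0]; simp; positivity

lemma vlem {N : ℕ} (hN : 3 ≤ N) : ∃ K : ℝ, 0 < K ∧ ∀ u : EE N → ℝ, Adm u → ∀ c R : ℝ,
    R = 2 * (∫ x, (1 / ell x) ^ (N-2) * ‖gradient u x‖ ^ 2) + (N * ((N:ℝ) - 2)) * ∫ x, (u x - c) ^ 2 * (1 / ell x) ^ N →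
    (Integrable (fun x => ‖gradient (fun y => u y * UU y) x - c • gradient UU x‖ ^ 2) ∧
      ∫ x, ‖gradient (fun y => u y * UU y) x - c • gradient UU x‖ ^ 2 ≤ R) ∧
    (Integrable (fun x => |u x * UU x - c * UU x| ^ (qq N)) ∧
      ∫ x, |u x * UU x - c * UU x| ^ (qq N) ≤ (K * R) ^ (qq N / 2)) := by
  obtain ⟨K, hK, hS⟩ := sobolev hN
  refine ⟨K, hK, fun u hu c R hR => ?_⟩
  have h3 : (3:ℝ) ≤ N := by exact_mod_cast hN
  have hq := qq_gt hN
  obtain ⟨χ, L, hχ, hχs, h01, h1, hL⟩ := cutoff N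
  have hec := ell_cont (N := N)
  have hel := fun x : EE N => (ell_pos x).ne'
  have cpow : ∀ m : ℕ, Continuous (fun x : EE N => (1 / ell x) ^ m) := fun m => by fun_prop (disch := assumption)
  have ppos : ∀ m : ℕ, ∀ x : EE N, 0 < (1 / ell x) ^ m := fun m x => by have := ell_pos x; positivity
  have huc := hu.1.continuous
  obtain ⟨B0, hB0⟩ := huc.bounded_above_of_compact_support hu.2
  set B := B0 + |c| with hBd
  have hB : ∀ x, |u x - c| ≤ B := fun x => (abs_sub _ _).trans (by have := hB0 x; rw [Real.norm_eq_abs] at this; linarith)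
  have hw1 : ContDiff ℝ 1 (fun x => u x - c) := hu.1.sub contDiff_const
  set v : ℕ → EE N → ℝ := fun n x => χ n x * (u x - c) with hv
  have hvA : ∀ n, Adm (v n) := fun n => Adm.mul ⟨hχ n, hχs n⟩ hw1
  have hψA : ∀ n, Adm (fun y => v n y * UU y) := fun n => (hvA n).mul UU_cd
  set err : ℕ → EE N → ℝ := fun n x => (1 / ell x) ^ (N-2) * ‖gradient (χ n) x‖ ^ 2 with herr
  have errc : ∀ n, Continuous (err n) := fun n => (cpow _).mul ((continuous_grad (hχ n)).norm.pow 2)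
  have iN1 := integrable_ell (N := N) (m := N-1) (by omega)
  have iN := integrable_ell (N := N) (m := N) (by omega)
  have errb : ∀ n x, err n x ≤ L * (1 / ell x) ^ (N-1) := by
    intro n x
    have := mul_le_mul_of_nonneg_left (hL n x) (ppos (N-2) x).le
    refine this.trans (le_of_eq ?_)
    rw [show N - 1 = (N - 2) + 1 by omega, pow_succ]; ring
  have err0 : ∀ n x, 0 ≤ err n x := fun n x => mul_nonneg (ppos _ x).le (by positivity)
  have hev : ∀ x : EE N, ∃ n0 : ℕ, ∀ n ≥ n0, ∀ᶠ y in nhds x, χ n y = 1 := by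
    intro x
    obtain ⟨n0, hn0⟩ := exists_nat_gt ‖x‖
    refine ⟨n0, fun n hn => ?_⟩
    have : ∀ᶠ y in nhds x, ‖y‖ < (n:ℝ) + 1 := by
      apply (continuous_norm.tendsto x).eventually_lt_const
      have : (n0:ℝ) ≤ n := by exact_mod_cast hn
      linarith
    filter_upwards [this] with y hy using h1 n y hy
  have errlim : Filter.Tendsto (fun n => ∫ x, err n x) Filter.atTop (nhds 0) := by
    have := tendsto_integral_of_dominated_convergence (μ := (volume : Measure (EE N))) (F := err) (f := fun _ => (0:ℝ))
      (fun x => L * (1 / ell x) ^ (N-1)) (fun n => (errc n).aestronglyMeasurable) (iN1.const_mul L)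
      (fun n => Filter.Eventually.of_forall fun x => by rw [Real.norm_eq_abs, abs_of_nonneg (err0 n x)]; exact errb n x) ?_
    · simpa using this
    · refine Filter.Eventually.of_forall fun x => ?_
      obtain ⟨n0, hn0⟩ := hev x
      refine tendsto_const_nhds.congr' ?_
      filter_upwards [Filter.eventually_ge_atTop n0] with n hn
      have : χ n =ᶠ[nhds x] fun _ => 1 := hn0 n hn
      simp only [herr]
      unfold gradient
      rw [this.fderiv_eq]; simp
  have iu2 : Integrable (fun x => (u x - c) ^ 2 * (1 / ell x) ^ N) := by
    refine (iN.const_mul (B^2)).mono' (((huc.sub continuous_const).pow 2).mul (cpow N)).aestronglyMeasurable ?_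
    refine Filter.Eventually.of_forall fun x => ?_
    rw [Real.norm_eq_abs, abs_of_nonneg (mul_nonneg (sq_nonneg _) (ppos _ x).le)]
    refine mul_le_mul_of_nonneg_right ?_ (ppos _ x).le
    rw [← sq_abs]; exact pow_le_pow_left₀ (abs_nonneg _) (hB x) 2
  have iD : Integrable (fun x => (1 / ell x) ^ (N-2) * ‖gradient u x‖ ^ 2) := by
    apply Continuous.integrable_of_hasCompactSupport
    · exact (cpow _).mul ((continuous_grad hu.1).norm.pow 2)
    · apply HasCompactSupport.mul_left
      exact (grad_compact hu.2).comp_left (g := fun v => ‖v‖ ^ 2) (by simp)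
  have ierr : ∀ n, Integrable (err n) := fun n =>
    (iN1.const_mul L).mono' (errc n).aestronglyMeasurable (Filter.Eventually.of_forall fun x => by
      rw [Real.norm_eq_abs, abs_of_nonneg (err0 n x)]; exact errb n x)
  have main : ∀ n, ∫ x, ‖gradient (fun y => v n y * UU y) x‖ ^ 2 ≤ R + 2 * B ^ 2 * ∫ x, err n x := by
    intro n
    rw [ground0 hN (hvA n), hR]
    have a1 : ∫ x, v n x ^ 2 * (1 / ell x) ^ N ≤ ∫ x, (u x - c) ^ 2 * (1 / ell x) ^ N := by
      refine integral_mono_of_nonneg (Filter.Eventually.of_forall fun x => mul_nonneg (sq_nonneg _) (ppos _ x).le) iu2 (Filter.Eventually.of_forall fun x => ?_)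
      simp only [hv]
      refine mul_le_mul_of_nonneg_right ?_ (ppos _ x).le
      rw [mul_pow]
      exact mul_le_of_le_one_left (sq_nonneg _) (pow_le_one₀ (h01 n x).1 (h01 n x).2)
    have a2 : ∫ x, (1 / ell x) ^ (N-2) * ‖gradient (v n) x‖ ^ 2 ≤ ∫ x, (2 * ((1 / ell x) ^ (N-2) * ‖gradient u x‖ ^ 2) + 2 * B ^ 2 * err n x) := by
      refine integral_mono_of_nonneg (Filter.Eventually.of_forall fun x => mul_nonneg (ppos _ x).le (sq_nonneg _)) ((iD.const_mul 2).add ((ierr n).const_mul _)) (Filter.Eventually.of_forall fun x => ?_)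
      simp only [hv, herr]
      rw [grad_mul ((hχ n).differentiable (by simp) x) (hw1.differentiable (by simp) x)]
      have e : gradient (fun x => u x - c) x = gradient u x := by unfold gradient; rw [fderiv_sub_const]
      rw [e]
      have t1 : ‖χ n x • gradient u x + (u x - c) • gradient (χ n) x‖ ≤ ‖gradient u x‖ + B * ‖gradient (χ n) x‖ := by
        refine (norm_add_le _ _).trans ?_
        rw [norm_smul, norm_smul, Real.norm_eq_abs, Real.norm_eq_abs, abs_of_nonneg (h01 n x).1]
        refine add_le_add (mul_le_of_le_one_left (norm_nonneg _) (h01 n x).2) (mul_le_mul_of_nonneg_right (hB x) (norm_nonneg _))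
      have t2 := pow_le_pow_left₀ (norm_nonneg _) t1 2
      have t3 : (‖gradient u x‖ + B * ‖gradient (χ n) x‖) ^ 2 ≤ 2 * ‖gradient u x‖ ^ 2 + 2 * B ^ 2 * ‖gradient (χ n) x‖ ^ 2 := by
        nlinarith [sq_nonneg (‖gradient u x‖ - B * ‖gradient (χ n) x‖)]
      calc _ ≤ (1 / ell x) ^ (N-2) * (2 * ‖gradient u x‖ ^ 2 + 2 * B ^ 2 * ‖gradient (χ n) x‖ ^ 2) :=
            mul_le_mul_of_nonneg_left (t2.trans t3) (ppos _ x).le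
        _ = _ := by ring
    rw [integral_add (iD.const_mul 2) ((ierr n).const_mul _), integral_const_mul, integral_const_mul] at a2
    have hA : 0 ≤ (N:ℝ) * ((N:ℝ) - 2) := mul_nonneg (by linarith) (by linarith)
    have := mul_le_mul_of_nonneg_left a1 hA
    linarith
  have blim : Filter.Tendsto (fun n => R + 2 * B ^ 2 * ∫ x, err n x) Filter.atTop (nhds R) := by
    have := (errlim.const_mul (2 * B ^ 2)).const_add R
    simpa using this
  constructor
  · refine fatou (f := fun n x => ‖gradient (fun y => v n y * UU y) x‖ ^ 2) (fun n => ?_) (fun n x => sq_nonneg _) ?_ (fun x => ?_) main blim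
    · apply Continuous.integrable_of_hasCompactSupport
      · exact (continuous_grad (hψA n).1).norm.pow 2
      · exact (grad_compact (hψA n).2).comp_left (g := fun v => ‖v‖ ^ 2) (by simp)
    · exact ((continuous_grad (hu.mul UU_cd).1).sub ((continuous_grad UU_cd).const_smul c)).norm.pow 2
    · obtain ⟨n0, hn0⟩ := hev x
      refine tendsto_const_nhds.congr' ?_
      filter_upwards [Filter.eventually_ge_atTop n0] with n hn
      have : (fun y => v n y * UU y) =ᶠ[nhds x] fun y => u y * UU y - c * UU y := by
        filter_upwards [hn0 n hn] with y hy
        simp only [hv, hy]; ring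
      congr 2
      unfold gradient
      rw [this.fderiv_eq, fderiv_fun_sub ((hu.mul UU_cd).1.differentiable (by simp) x) ((UU_cd.differentiable (by simp) x).const_mul c),
        fderiv_const_mul (UU_cd.differentiable (by simp) x)]
      simp
  · refine fatou (f := fun n x => |v n x * UU x| ^ (qq N)) (b := fun n => (K * (R + 2 * B ^ 2 * ∫ x, err n x)) ^ (qq N / 2)) (fun n => ?_) (fun n x => by positivity) ?_ (fun x => ?_) (fun n => ?_) ?_
    · apply Continuous.integrable_of_hasCompactSupport
      · exact (hψA n).1.continuous.abs.rpow_const (fun x => Or.inr (by linarith))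
      · exact (hψA n).2.comp_left (g := fun v => |v| ^ (qq N)) (by simp; rw [Real.zero_rpow (by linarith)])
    · have := (UU_cd (N := N)).continuous
      exact ((huc.mul this).sub (this.const_mul c)).abs.rpow_const (fun x => Or.inr (by linarith))
    · obtain ⟨n0, hn0⟩ := hev x
      refine tendsto_const_nhds.congr' ?_
      filter_upwards [Filter.eventually_ge_atTop n0] with n hn
      simp only [hv, (hn0 n hn).self_of_nhds]; congr 2; ring
    · refine (hS _ (hψA n)).trans ?_
      refine Real.rpow_le_rpow (mul_nonneg hK.le (integral_nonneg fun x => sq_nonneg _)) ?_ (by linarith)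
      exact mul_le_mul_of_nonneg_left (main n) hK.le
    · exact (blim.const_mul K).rpow_const (Or.inr (by linarith))


def DD {N : ℕ} (u : EE N → ℝ) : ℝ := ∫ x, (1 / ell x) ^ (N-2) * ‖gradient u x‖ ^ 2

lemma inv_ell_pos {N : ℕ} (m : ℕ) (x : EE N) : 0 < (1 / ell x) ^ m := by have := ell_pos x; positivity

lemma DD_nonneg {N : ℕ} (u : EE N → ℝ) : 0 ≤ DD u :=
  integral_nonneg fun x => mul_nonneg (inv_ell_pos _ x).le (sq_nonneg _)

lemma close {N : ℕ} (hN : 3 ≤ N) : ∃ C : ℝ, 0 < C ∧ ∀ u : EE N → ℝ, Adm u → ∃ c : ℝ,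
    ∫ x, ‖gradient (fun y => u y * UU y) x - c • gradient UU x‖ ^ 2 ≤ C * DD u ∧
    Integrable (fun x => |u x * UU x - c * UU x| ^ (qq N)) ∧
    ∫ x, |u x * UU x - c * UU x| ^ (qq N) ≤ (C * DD u) ^ (qq N / 2) ∧
    ∫ x, (u x - c) ^ 2 * (1 / ell x) ^ N ≤ C * DD u := by
  obtain ⟨C1, h1, hP⟩ := poincare hN
  obtain ⟨K, hK, hV⟩ := vlem hN
  have h3 : (3:ℝ) ≤ N := by exact_mod_cast hN
  have hq := qq_gt hN
  set A : ℝ := (N:ℝ) * ((N:ℝ) - 2) with hA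
  have hA0 : 0 < A := mul_pos (by linarith) (by linarith)
  refine ⟨C1 + (1 + K) * (2 + A * C1), by positivity, fun u hu => ?_⟩
  obtain ⟨c, hc⟩ := hP u hu
  refine ⟨c, ?_⟩
  obtain ⟨⟨i1, v1⟩, i2, v2⟩ := hV u hu c _ rfl
  have hD := DD_nonneg u
  change _ ≤ C1 * DD u at hc
  have hR : 2 * (∫ x, (1 / ell x) ^ (N-2) * ‖gradient u x‖ ^ 2) + A * ∫ x, (u x - c) ^ 2 * (1 / ell x) ^ N ≤ (2 + A * C1) * DD u := by
    have := mul_le_mul_of_nonneg_left hc hA0.le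
    change 2 * DD u + _ ≤ _
    linarith
  have hR0 : 0 ≤ 2 * (∫ x, (1 / ell x) ^ (N-2) * ‖gradient u x‖ ^ 2) + A * ∫ x, (u x - c) ^ 2 * (1 / ell x) ^ N := by
    have : 0 ≤ ∫ x, (u x - c) ^ 2 * (1 / ell x) ^ N := integral_nonneg fun x => mul_nonneg (sq_nonneg _) (inv_ell_pos _ x).le
    change 0 ≤ 2 * DD u + _
    positivity
  refine ⟨v1.trans (hR.trans ?_), i2, v2.trans ?_, hc.trans ?_⟩
  · apply mul_le_mul_of_nonneg_right _ hD
    nlinarith [mul_pos hK (by positivity : 0 < 2 + A * C1)]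
  · refine Real.rpow_le_rpow (by positivity) ?_ (by linarith)
    refine (mul_le_mul_of_nonneg_left hR hK.le).trans ?_
    rw [← mul_assoc]
    apply mul_le_mul_of_nonneg_right _ hD
    nlinarith [mul_pos hA0 h1]
  · apply mul_le_mul_of_nonneg_right _ hD
    have : 0 < (1 + K) * (2 + A * C1) := by positivity
    linarith

lemma pw {q : ℝ} (hq : 1 ≤ q) {τ : ℝ} (h0 : 0 < τ) (h1 : τ ≤ 1) (a b : ℝ) :
    |(|a| ^ q - |b| ^ q)| ≤ (q + 2 ^ q) * (τ * |a| ^ q + τ ^ (1 - q) * |a - b| ^ q) := by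
  have hq0 : 0 ≤ q := by linarith
  have hb1 : |b| ≤ |a| + |a - b| := by
    have := abs_sub_abs_le_abs_sub b a
    rw [abs_sub_comm b a] at this; linarith
  have hb2 : |a| - |a - b| ≤ |b| := by
    have := abs_sub_abs_le_abs_sub a b; linarith
  have hτ : 1 ≤ τ ^ (1 - q) := Real.one_le_rpow_of_pos_of_le_one_of_nonpos h0 h1 (by linarith)
  have h2q : (1:ℝ) ≤ 2 ^ q := Real.one_le_rpow (by norm_num) hq0
  have ha := abs_nonneg a
  have hb := abs_nonneg b
  have he := abs_nonneg (a - b)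
  have haq := Real.rpow_nonneg ha q
  have hbq := Real.rpow_nonneg hb q
  have heq := Real.rpow_nonneg he q
  rcases le_total |a - b| |a| with hc | hc
  · rcases eq_or_lt_of_le ha with ha0 | hapos
    · have e0 : |a - b| = 0 := le_antisymm (by rw [ha0]; exact hc) he
      have b0 : |b| = 0 := by apply le_antisymm _ hb; rw [e0, ← ha0] at hb1; linarith
      rw [← ha0, b0]; simp; positivity
    · set ρ := |a - b| / |a| with hρ
      have r0 : 0 ≤ ρ := by positivity
      have r1 : ρ ≤ 1 := by rw [hρ, div_le_one hapos]; exact hc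
      have er : |a - b| = ρ * |a| := by rw [hρ]; field_simp
      have k1 : |b| ^ q ≤ |a| ^ q * (1 + 2 ^ q * ρ) := by
        have : |b| ≤ |a| * (1 + ρ) := by rw [er] at hb1; linarith
        refine (Real.rpow_le_rpow hb this hq0).trans ?_
        rw [Real.mul_rpow ha (by linarith)]
        refine mul_le_mul_of_nonneg_left ?_ haq
        have := (convexOn_rpow hq).2 (show (1:ℝ) ∈ Set.Ici 0 by simp) (show (2:ℝ) ∈ Set.Ici 0 by simp) (show 0 ≤ 1 - ρ by linarith) r0 (by ring)
        simp only [smul_eq_mul, Real.one_rpow] at this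
        rw [show (1 - ρ) * 1 + ρ * 2 = 1 + ρ by ring] at this
        linarith
      have k2 : |a| ^ q * (1 - q * ρ) ≤ |b| ^ q := by
        have : |a| * (1 - ρ) ≤ |b| := by rw [er] at hb2; linarith
        refine le_trans ?_ (Real.rpow_le_rpow (mul_nonneg ha (by linarith)) this hq0)
        rw [Real.mul_rpow ha (by linarith)]
        refine mul_le_mul_of_nonneg_left ?_ haq
        have := one_add_mul_self_le_rpow_one_add (s := -ρ) (by linarith) hq
        rw [show (1:ℝ) + -ρ = 1 - ρ by ring] at this
        linarith
      have k3 : |(|a| ^ q - |b| ^ q)| ≤ (q + 2 ^ q) * (ρ * |a| ^ q) := by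
        have m1 : 0 ≤ ρ * |a| ^ q := by positivity
        rw [abs_le]; constructor <;> nlinarith [mul_nonneg hq0 m1]
      refine k3.trans (mul_le_mul_of_nonneg_left ?_ (by linarith))
      rcases le_total ρ τ with hr | hr
      · have : 0 ≤ τ ^ (1 - q) * |a - b| ^ q := by positivity
        nlinarith
      · have hrp : 0 < ρ := lt_of_lt_of_le h0 hr
        have : ρ ≤ τ ^ (1 - q) * ρ ^ q := by
          calc ρ = ρ ^ (1 - q) * ρ ^ q := by rw [← Real.rpow_add hrp]; simp
            _ ≤ _ := mul_le_mul_of_nonneg_right (Real.rpow_le_rpow_of_nonpos h0 hr (by linarith)) (by positivity)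
        rw [er, Real.mul_rpow r0 ha]
        nlinarith [mul_nonneg h0.le haq]
  · have hb3 : |b| ≤ 2 * |a - b| := by linarith
    have k1 := Real.rpow_le_rpow hb hb3 hq0
    rw [Real.mul_rpow (by norm_num) he] at k1
    have k2 := Real.rpow_le_rpow ha hc hq0
    have k3 : |(|a| ^ q - |b| ^ q)| ≤ (q + 2 ^ q) * |a - b| ^ q := by
      rw [abs_le]; constructor <;> nlinarith [mul_nonneg hq0 heq]
    refine k3.trans (mul_le_mul_of_nonneg_left ?_ (by linarith))
    nlinarith [mul_nonneg h0.le haq]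

lemma l1close {N : ℕ} (hN : 3 ≤ N) {C : ℝ} (hC : 0 < C) : ∃ C' : ℝ, 0 < C' ∧ ∀ u : EE N → ℝ, Adm u → ∀ c : ℝ,
    Integrable (fun x => |u x * UU x - c * UU x| ^ (qq N)) →
    ∫ x, |u x * UU x - c * UU x| ^ (qq N) ≤ (C * DD u) ^ (qq N / 2) →
    ∫ x, |u x * UU x| ^ (qq N) = 1 → DD u ≤ 1 →
    ∫ x, |(|u x * UU x| ^ (qq N) - |c * UU x| ^ (qq N))| ≤ C' * √(DD u) := by
  have hq := qq_gt hN
  set q := qq N with hqd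
  set K := q + 2 ^ q
  have hK : 0 < K := by positivity
  refine ⟨K * (1 + C ^ (q / 2)), by positivity, fun u hu c hi he h1 hD1 => ?_⟩
  have iu : Integrable (fun x => |u x * UU x| ^ q) := by
    by_contra h
    rw [integral_undef h] at h1; norm_num at h1
  have hD := DD_nonneg u
  have step : ∀ d : ℝ, 0 < d → d ≤ 1 → DD u ≤ d → ∫ x, |(|u x * UU x| ^ q - |c * UU x| ^ q)| ≤ K * (1 + C ^ (q / 2)) * √d := by
    intro d hd hd1 hDd
    have hs : 0 < √d := Real.sqrt_pos.2 hd
    have hs1 : √d ≤ 1 := Real.sqrt_le_one.2 hd1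
    have i3 : Integrable (fun x => K * (√d * |u x * UU x| ^ q + √d ^ (1 - q) * |u x * UU x - c * UU x| ^ q)) :=
      ((iu.const_mul _).add (hi.const_mul _)).const_mul K
    have := integral_mono_of_nonneg (μ := (volume : Measure (EE N))) (Filter.Eventually.of_forall fun x => abs_nonneg _) i3
      (Filter.Eventually.of_forall fun x => pw (by linarith : 1 ≤ q) hs hs1 (u x * UU x) (c * UU x))
    refine this.trans ?_
    rw [integral_const_mul, integral_add (iu.const_mul _) (hi.const_mul _), integral_const_mul, integral_const_mul, h1, mul_assoc]
    refine mul_le_mul_of_nonneg_left ?_ hK.le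
    have h2 : ∫ x, |u x * UU x - c * UU x| ^ q ≤ C ^ (q/2) * √d ^ q := by
      refine he.trans ?_
      rw [Real.mul_rpow hC.le hD]
      refine mul_le_mul_of_nonneg_left ?_ (by positivity)
      rw [Real.sqrt_eq_rpow, ← Real.rpow_mul hd.le]
      refine (Real.rpow_le_rpow hD hDd (by linarith)).trans (le_of_eq ?_)
      congr 1; ring
    have h4 : √d ^ (1 - q) * √d ^ q = √d := by rw [← Real.rpow_add hs]; simp
    have := mul_le_mul_of_nonneg_left h2 (by positivity : 0 ≤ √d ^ (1 - q))
    calc _ ≤ √d * 1 + √d ^ (1 - q) * (C ^ (q/2) * √d ^ q) := by linarith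
      _ = √d + C ^ (q/2) * (√d ^ (1 - q) * √d ^ q) := by ring
      _ = _ := by rw [h4]; ring
  rcases eq_or_lt_of_le hD with h0 | h0
  · rw [← h0, Real.sqrt_zero, mul_zero]
    by_contra! hpos
    set I := ∫ x, |(|u x * UU x| ^ q - |c * UU x| ^ q)|
    set G := K * (1 + C ^ (q / 2))
    have hG : 0 < G := by positivity
    set r := min 1 (I / (2 * G))
    have hr : 0 < r := by positivity
    have := step (r ^ 2) (by positivity) (pow_le_one₀ hr.le (min_le_left _ _)) (by rw [← h0]; positivity)
    rw [Real.sqrt_sq hr.le] at this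
    have h5 : r ≤ I / (2 * G) := min_le_right _ _
    have h6 := mul_le_mul_of_nonneg_left h5 hG.le
    rw [show G * (I / (2 * G)) = I / 2 by field_simp] at h6
    linarith
  · exact step _ h0 hD1 le_rfl


lemma sc_a {r : ℝ} (hr : 0 ≤ r) (n : ℕ) (hn : 1 ≤ n) :
    2 * (r - 1) ^ 2 ≤ n * r ^ (n+2) - (n+2) * r ^ n + 2 := by
  have hm : ∀ m : ℕ, 1 ≤ m → (r - 1) ^ 2 ≤ (r - 1) * (r ^ m - 1) := by
    intro m hm
    rcases le_total 1 r with h | h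
    · have : r ≤ r ^ m := le_self_pow₀ h (by omega)
      nlinarith
    · have : r ^ m ≤ r := pow_le_of_le_one hr h (by omega)
      nlinarith
  induction n, hn using Nat.le_induction with
  | base => norm_num; nlinarith [mul_nonneg hr (sq_nonneg (r - 1))]
  | succ n hn ih =>
    have h1 := hm (n+2) (by omega)
    have h2 := hm (n+1) (by omega)
    have h3 : 0 ≤ r * (n * r ^ (n+2) - (n+2) * r ^ n + 2) := mul_nonneg hr (by nlinarith [sq_nonneg (r-1)])
    have e : ((n+1:ℕ):ℝ) * r ^ (n+1+2) - ((n+1:ℕ)+2) * r ^ (n+1) + 2 = r * (n * r ^ (n+2) - (n+2) * r ^ n + 2)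
       + ((r - 1) * (r ^ (n+2) - 1) + (r - 1) * (r ^ (n+1) - 1)) := by push_cast; ring
    rw [e]; linarith

lemma sc_b {t p : ℝ} (ht : 0 ≤ t) (h0 : 0 < p) (h1 : p < 1) : 1 + p * (t - 1) - (t - 1) ^ 2 ≤ t ^ p := by
  have hd : 0 < 1 + (1 - p) * (t - 1) := by nlinarith
  have hb := rpow_one_add_le_one_add_mul_self (s := t - 1) (by linarith) (p := 1 - p) (by linarith) (by linarith)
  rw [show 1 + (t - 1) = t by ring] at hb
  have h2 : t ≤ t ^ p * (1 + (1 - p) * (t - 1)) := by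
    rcases eq_or_lt_of_le ht with h | h
    · rw [← h, Real.zero_rpow h0.ne']; simp
    · calc t = t ^ p * t ^ (1 - p) := by rw [← Real.rpow_add h]; simp
        _ ≤ _ := mul_le_mul_of_nonneg_left hb (by positivity)
  have h3 : (1 + p * (t - 1) - (t - 1) ^ 2) * (1 + (1 - p) * (t - 1)) ≤ t := by
    nlinarith [mul_nonneg (sq_nonneg (t-1)) (sq_nonneg p), mul_nonneg (sq_nonneg (t-1)) (mul_nonneg ht (by linarith : 0 ≤ 1 - p))]
  exact le_of_mul_le_mul_right (h3.trans h2) hd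

lemma rr_facts {N : ℕ} {ξ : EP N} (h : ‖ξ‖ ≤ 1/2) (x : EE N) :
    0 ≤ rr ξ x ∧ rr ξ x ≤ 2 ∧ |rr ξ x - 1 - inner ℝ ξ (om x)| ≤ 2 * ‖ξ‖ ^ 2 ∧
    4/9 * (inner ℝ ξ (om x) ^ 2 / 2 - ‖ξ‖ ^ 4) ≤ (rr ξ x - 1) ^ 2 := by
  have hi := inner_om_le ξ x
  set τ := inner ℝ ξ (om x) with hτ
  have hn := norm_nonneg ξ
  obtain ⟨t1, t2⟩ := abs_le.1 hi
  have hs := sx_sq (ξ := ξ) (by linarith)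
  have hsp := sx_pos (ξ := ξ) (by linarith)
  have s1 : sx ξ ≤ 1 := by nlinarith
  have s2 : 1 - ‖ξ‖ ^ 2 ≤ sx ξ := by nlinarith
  have hd : 1/2 ≤ 1 - τ := by linarith
  have hd0 : 0 < 1 - τ := by linarith
  have er : rr ξ x = sx ξ / (1 - τ) := rfl
  have ht2 : τ ^ 2 ≤ ‖ξ‖ ^ 2 := by rw [← sq_abs]; exact pow_le_pow_left₀ (abs_nonneg _) hi 2
  refine ⟨by rw [er]; positivity, ?_, ?_, ?_⟩
  · rw [er, div_le_iff₀ hd0]; linarith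
  · have : rr ξ x - 1 - τ = (sx ξ - 1 + τ ^ 2) / (1 - τ) := by rw [er]; field_simp; ring
    rw [this, abs_div, abs_of_pos hd0, div_le_iff₀ hd0]
    have : |sx ξ - 1 + τ ^ 2| ≤ ‖ξ‖ ^ 2 := by rw [abs_le]; constructor <;> nlinarith [sq_nonneg τ]
    nlinarith [sq_nonneg ‖ξ‖]
  · have e : rr ξ x - 1 = (τ - (1 - sx ξ)) / (1 - τ) := by rw [er]; field_simp; ring
    rw [e, div_pow, le_div_iff₀ (by positivity)]
    have a1 : (1 - τ) ^ 2 ≤ 9/4 := by nlinarith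
    have a2 : τ ^ 2 / 2 - ‖ξ‖ ^ 4 ≤ (τ - (1 - sx ξ)) ^ 2 := by
      have : (1 - sx ξ) ^ 2 ≤ ‖ξ‖ ^ 4 := by
        calc (1 - sx ξ) ^ 2 ≤ (‖ξ‖ ^ 2) ^ 2 := pow_le_pow_left₀ (by linarith) (by linarith) 2
          _ = _ := by ring
      nlinarith [sq_nonneg (τ - 2 * (1 - sx ξ))]
    have a3 := sq_nonneg (τ - (1 - sx ξ))
    rcases le_total 0 (τ ^ 2 / 2 - ‖ξ‖ ^ 4) with h0 | h0
    · nlinarith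
    · have := mul_nonneg (neg_nonneg.2 h0) (sq_nonneg (1 - τ))
      nlinarith

lemma rr_exp (N n : ℕ) : ∃ C : ℝ, 0 < C ∧ ∀ ξ : EP N, ‖ξ‖ ≤ 1/2 → ∀ x : EE N,
    |rr ξ x ^ n - 1 - n * inner ℝ ξ (om x)| ≤ C * ‖ξ‖ ^ 2 := by
  induction n with
  | zero => exact ⟨1, one_pos, fun ξ h x => by simp⟩
  | succ n ih =>
    obtain ⟨C, hC, h⟩ := ih
    refine ⟨2 * C + 2 * (1 + n) + n, by positivity, fun ξ hξ x => ?_⟩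
    obtain ⟨r0, r2, r3, -⟩ := rr_facts hξ x
    have hi := inner_om_le ξ x
    have hh := h ξ hξ x
    set τ := inner ℝ ξ (om x) with hτ
    set r := rr ξ x
    have hn0 : (0:ℝ) ≤ n := Nat.cast_nonneg n
    have e : r ^ (n+1) - 1 - ((n+1:ℕ):ℝ) * τ = r * (r ^ n - 1 - n * τ) + (r - 1 - τ) * (1 + n * τ) + n * τ ^ 2 := by
      push_cast; ring
    rw [e]
    have a1 : |r * (r ^ n - 1 - n * τ)| ≤ 2 * (C * ‖ξ‖ ^ 2) := by
      rw [abs_mul, abs_of_nonneg r0]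
      exact mul_le_mul r2 hh (abs_nonneg _) (by norm_num)
    have a2 : |(r - 1 - τ) * (1 + n * τ)| ≤ 2 * ‖ξ‖ ^ 2 * (1 + n) := by
      rw [abs_mul]
      refine mul_le_mul r3 ?_ (abs_nonneg _) (by positivity)
      refine (abs_add_le _ _).trans ?_
      rw [abs_one, abs_mul, abs_of_nonneg hn0]
      nlinarith
    have a3 : |n * τ ^ 2| ≤ n * ‖ξ‖ ^ 2 := by
      rw [abs_mul, abs_of_nonneg hn0, abs_of_nonneg (sq_nonneg τ), ← sq_abs]
      exact mul_le_mul_of_nonneg_left (pow_le_pow_left₀ (abs_nonneg _) hi 2) hn0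
    refine (abs_add_le _ _).trans ?_
    have := abs_add_le (r * (r ^ n - 1 - n * τ)) ((r - 1 - τ) * (1 + n * τ))
    linarith

def MM (N : ℕ) : ℝ := ∫ x : EE N, (1 / ell x) ^ N

lemma cpow {N : ℕ} (m : ℕ) : Continuous (fun x : EE N => (1 / ell x) ^ m) := by
  have hec := ell_cont (N := N)
  have hel := fun x : EE N => (ell_pos x).ne'
  fun_prop (disch := assumption)

lemma iN {N : ℕ} (hN : 3 ≤ N) : Integrable (fun x : EE N => (1 / ell x) ^ N) := integrable_ell (by omega)

lemma MM_pos {N : ℕ} (hN : 3 ≤ N) : 0 < MM N := by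
  refine (integral_pos_iff_support_of_nonneg (fun x => (inv_ell_pos N x).le) (iN hN)).2 ?_
  have : Function.support (fun x : EE N => (1 / ell x) ^ N) = Set.univ := by
    ext x; simp [(ell_pos x).ne']
  rw [this]; exact Measure.measure_univ_pos.2 (NeZero.ne _)

lemma rr_cont {N : ℕ} {ξ : EP N} (h : ‖ξ‖ < 1) : Continuous (rr ξ) := by
  unfold rr
  have := om_cont (N := N)
  refine continuous_const.div (by fun_prop) fun x => ?_
  have := (abs_le.1 (inner_om_le ξ x)).2
  linarith

lemma int_bdd {N : ℕ} {f g : EE N → ℝ} (hf : Integrable f) (hg : Continuous g) {C : ℝ} (hC : ∀ x, |g x| ≤ C) :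
    Integrable (fun x => g x * f x) :=
  hf.bdd_mul (c := C) hg.aestronglyMeasurable (Filter.Eventually.of_forall hC)

lemma abs_int_bdd {N : ℕ} {f g : EE N → ℝ} (hf : Integrable f) {C : ℝ} (hC : ∀ x, |g x| ≤ C) :
    |∫ x, g x * f x| ≤ C * ∫ x, |f x| := by
  rw [← integral_const_mul]
  refine (abs_integral_le_integral_abs).trans ?_
  refine integral_mono_of_nonneg (Filter.Eventually.of_forall fun x => abs_nonneg _) (hf.abs.const_mul C)
    (Filter.Eventually.of_forall fun x => ?_)
  simp only [abs_mul]
  exact mul_le_mul_of_nonneg_right (hC x) (abs_nonneg _)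

lemma inner_cont {N : ℕ} (ξ : EP N) : Continuous (fun x : EE N => inner ℝ ξ (om x)) := by
  have := om_cont (N := N)
  fun_prop

lemma mean_zero {N : ℕ} (hN : 3 ≤ N) {ξ : EP N} (hξ : ‖ξ‖ ≤ 1/2) :
    ∫ x, inner ℝ ξ (om x) * (1 / ell x) ^ N = 0 := by
  obtain ⟨C, hC, hexp⟩ := rr_exp N N
  set I := ∫ x, inner ℝ ξ (om x) * (1 / ell x) ^ N with hI
  have hM := MM_pos hN
  have hNp : (0:ℝ) < N := by exact_mod_cast (by omega : 0 < N)
  have step : ∀ ε : ℝ, 0 < ε → ε ≤ 1 → N * |I| ≤ C * MM N * ε := by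
    intro ε h0 h1
    have hn : ‖ε • ξ‖ = ε * ‖ξ‖ := by rw [norm_smul, Real.norm_eq_abs, abs_of_pos h0]
    have hle : ‖ε • ξ‖ ≤ 1/2 := by rw [hn]; nlinarith [norm_nonneg ξ]
    have b := abs_int_bdd (iN hN) (fun x => hexp (ε • ξ) hle x)
    have e : ∫ x, (rr (ε • ξ) x ^ N - 1 - N * inner ℝ (ε • ξ) (om x)) * (1 / ell x) ^ N = - (N * ε * I) := by
      have : ∀ x : EE N, (rr (ε • ξ) x ^ N - 1 - N * inner ℝ (ε • ξ) (om x)) * (1 / ell x) ^ N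
        = (rr (ε • ξ) x / ell x) ^ N - (1 / ell x) ^ N - N * ε * (inner ℝ ξ (om x) * (1 / ell x) ^ N) := by
        intro x; rw [inner_smul_left]; simp only [div_pow, one_pow]; simp; ring
      simp only [this]
      have i1 : Integrable (fun x : EE N => (rr (ε • ξ) x / ell x) ^ N) := by
        have := int_bdd (iN hN) ((rr_cont (ξ := ε • ξ) (by linarith)).pow N) (C := 2 ^ N) (fun x => by
          obtain ⟨r0, r2, -⟩ := rr_facts hle x
          show |rr (ε • ξ) x ^ N| ≤ 2 ^ N
          rw [abs_of_nonneg (pow_nonneg r0 N)]; exact pow_le_pow_left₀ r0 r2 N)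
        refine this.congr (Filter.Eventually.of_forall fun x => ?_)
        simp [div_pow]; rfl
      have i2 := int_bdd (iN hN) (inner_cont ξ) (inner_om_le ξ)
      have i12 : Integrable (fun x : EE N => (rr (ε • ξ) x / ell x) ^ N - (1 / ell x) ^ N) := i1.sub (iN hN)
      have i2' : Integrable (fun x : EE N => N * ε * (inner ℝ ξ (om x) * (1 / ell x) ^ N)) := i2.const_mul _
      rw [integral_sub i12 i2', integral_sub i1 (iN hN), integral_const_mul, mass (by linarith)]
      ring
    rw [e, abs_neg, abs_mul, abs_mul, abs_of_pos h0, abs_of_pos hNp, hn] at b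
    have e2 : ∫ x : EE N, |(1 / ell x) ^ N| = MM N := by
      congr 1; ext x; exact abs_of_pos (inv_ell_pos N x)
    rw [e2] at b
    have : (N * |I|) * ε ≤ (C * MM N * ε) * ε := by
      refine (le_of_eq (by ring)).trans (b.trans ?_)
      have : (ε * ‖ξ‖) ^ 2 ≤ ε ^ 2 := by
        apply pow_le_pow_left₀ (by positivity)
        nlinarith [norm_nonneg ξ]
      calc _ ≤ C * ε ^ 2 * MM N := by gcongr
        _ = _ := by ring
    exact le_of_mul_le_mul_right this h0
  by_contra hne
  have hp : 0 < |I| := abs_pos.2 hne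
  set ε := min 1 (N * |I| / (2 * (C * MM N)))
  have he : 0 < ε := by positivity
  have h1 := step ε he (min_le_left _ _)
  have h2 : ε ≤ N * |I| / (2 * (C * MM N)) := min_le_right _ _
  have h3 := mul_le_mul_of_nonneg_left h2 (by positivity : 0 ≤ C * MM N)
  rw [show C * MM N * (N * |I| / (2 * (C * MM N))) = N * |I| / 2 by field_simp] at h3
  nlinarith [mul_pos hNp hp]

def kap (N : ℕ) : ℝ := ∫ η, (inner ℝ η (om (0 : EE N))) ^ 2 ∂(nu N)

lemma kap_int (N : ℕ) : Integrable (fun η => (inner ℝ η (om (0 : EE N))) ^ 2) (nu N) := by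
  refine Integrable.of_bound (C := 1) (by fun_prop) ?_
  filter_upwards [nu_ae N] with η hη
  have := inner_om_le η (0 : EE N)
  rw [Real.norm_eq_abs, abs_of_nonneg (sq_nonneg _), ← sq_abs]
  exact pow_le_one₀ (abs_nonneg _) (this.trans hη.le)

lemma kap_pos (N : ℕ) : 0 < kap N := by
  refine (integral_pos_iff_support_of_nonneg (fun x => sq_nonneg _) (kap_int N)).2 ?_
  have ho : IsOpen (Function.support (fun η => (inner ℝ η (om (0 : EE N))) ^ 2)) :=
    Continuous.isOpen_support (by fun_prop)
  unfold nu
  rw [ProbabilityTheory.cond_apply measurableSet_ball]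
  refine ENNReal.mul_pos (by simpa using measure_ball_lt_top.ne) ?_
  refine ((Metric.isOpen_ball.inter ho).measure_pos volume ⟨(1/2:ℝ) • om 0, ?_, ?_⟩).ne'
  · rw [mem_ball_zero_iff, norm_smul, om_norm]; norm_num
  · rw [Function.mem_support, inner_smul_left, real_inner_self_eq_norm_sq, om_norm]; norm_num


lemma rr_pow_abs {N : ℕ} {ξ : EP N} (h : ‖ξ‖ ≤ 1/2) (m : ℕ) (x : EE N) : |rr ξ x ^ m| ≤ 2 ^ m := by
  obtain ⟨r0, r2, -⟩ := rr_facts h x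
  rw [abs_of_nonneg (pow_nonneg r0 m)]; exact pow_le_pow_left₀ r0 r2 m

lemma J_zero {N : ℕ} (hN : 3 ≤ N) {ξ : EP N} (hξ : ‖ξ‖ ≤ 1/2) :
    ∫ x, (rr ξ x ^ N - 1 - N * inner ℝ ξ (om x)) * (1 / ell x) ^ N = 0 := by
  have : ∀ x : EE N, (rr ξ x ^ N - 1 - N * inner ℝ ξ (om x)) * (1 / ell x) ^ N
    = (rr ξ x / ell x) ^ N - (1 / ell x) ^ N - N * (inner ℝ ξ (om x) * (1 / ell x) ^ N) := by
    intro x; simp only [div_pow, one_pow]; ring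
  simp only [this]
  have i1 : Integrable (fun x : EE N => (rr ξ x / ell x) ^ N) := by
    have := int_bdd (iN hN) ((rr_cont (ξ := ξ) (by linarith)).pow N) (rr_pow_abs hξ N)
    refine this.congr (Filter.Eventually.of_forall fun x => ?_)
    simp [div_pow]; rfl
  have i2 := int_bdd (iN hN) (inner_cont ξ) (inner_om_le ξ)
  have i12 : Integrable (fun x : EE N => (rr ξ x / ell x) ^ N - (1 / ell x) ^ N) := i1.sub (iN hN)
  have i2' : Integrable (fun x : EE N => N * (inner ℝ ξ (om x) * (1 / ell x) ^ N)) := i2.const_mul _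
  rw [integral_sub i12 i2', integral_sub i1 (iN hN), integral_const_mul, mass (by linarith), mean_zero hN hξ]
  ring

lemma g_est {N : ℕ} (hN : 3 ≤ N) : ∃ C : ℝ, 0 < C ∧ ∀ u : EE N → ℝ, Adm u →
    ∫ x, |u x * UU x| ^ (qq N) = 1 → ∀ δ : ℝ,
    (∀ ξ : EP N, |∫ x, inner ℝ ξ (om x) * |u x * UU x| ^ (qq N)| ≤ δ * ‖ξ‖) →
    ∀ ξ : EP N, ‖ξ‖ ≤ 1/2 →
    |(∫ x, rr ξ x ^ N * |u x * UU x| ^ (qq N)) - 1| ≤ C * ‖ξ‖ ^ 2 * √(DD u) + N * (δ * ‖ξ‖) := by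
  obtain ⟨C1, hC1, hcl⟩ := close hN
  obtain ⟨C2, hC2, hl1⟩ := l1close hN hC1
  obtain ⟨C3, hC3, hexp⟩ := rr_exp N N
  have hq := qq_gt hN
  refine ⟨C3 * (1 + C2), by positivity, fun u hu h1 δ hδ ξ hξ => ?_⟩
  set w := fun x => |u x * UU x| ^ (qq N) with hw
  have iw : Integrable w := by
    by_contra h
    rw [integral_undef h] at h1; norm_num at h1
  have hr := rr_cont (ξ := ξ) (by linarith)
  have i1 : Integrable (fun x => rr ξ x ^ N * w x) := int_bdd iw (hr.pow N) (rr_pow_abs hξ N)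
  have i2 : Integrable (fun x => inner ℝ ξ (om x) * w x) := int_bdd iw (inner_cont ξ) (inner_om_le ξ)
  have hin := inner_cont ξ
  have cJ : Continuous (fun x => rr ξ x ^ N - 1 - N * inner ℝ ξ (om x)) := by fun_prop
  have e : (∫ x, rr ξ x ^ N * w x) - 1 = (∫ x, (rr ξ x ^ N - 1 - N * inner ℝ ξ (om x)) * w x)
      + N * ∫ x, inner ℝ ξ (om x) * w x := by
    have : ∀ x, (rr ξ x ^ N - 1 - N * inner ℝ ξ (om x)) * w x = rr ξ x ^ N * w x - w x - N * (inner ℝ ξ (om x) * w x) := by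
      intro x; ring
    simp only [this]
    have i12 : Integrable (fun x => rr ξ x ^ N * w x - w x) := i1.sub iw
    have i2' : Integrable (fun x => N * (inner ℝ ξ (om x) * w x)) := i2.const_mul _
    rw [integral_sub i12 i2', integral_sub i1 iw, integral_const_mul, h1]
    ring
  have hJ : |∫ x, (rr ξ x ^ N - 1 - N * inner ℝ ξ (om x)) * w x| ≤ C3 * (1 + C2) * ‖ξ‖ ^ 2 * √(DD u) := by
    rcases le_total 1 (DD u) with hD | hD
    · have b := abs_int_bdd iw (hexp ξ hξ)
      have : ∫ x, |w x| = 1 := by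
        rw [← h1]; congr 1; ext x; exact abs_of_nonneg (Real.rpow_nonneg (abs_nonneg _) _)
      rw [this] at b
      have hs : 1 ≤ √(DD u) := Real.one_le_sqrt.2 hD
      refine b.trans ?_
      have : 0 ≤ C3 * ‖ξ‖ ^ 2 := by positivity
      have : 0 ≤ C3 * C2 * ‖ξ‖ ^ 2 * √(DD u) := by positivity
      nlinarith
    · obtain ⟨c, -, hi, hc, -⟩ := hcl u hu
      have l := hl1 u hu c hi hc h1 hD
      have ew0 : ∀ x : EE N, |c * UU x| ^ (qq N) = |c| ^ (qq N) * (1 / ell x) ^ N := by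
        intro x
        rw [abs_mul, Real.mul_rpow (abs_nonneg _) (abs_nonneg _), abs_of_pos (UU_pos x), UU_q hN]
      have iw0 : Integrable (fun x : EE N => |c * UU x| ^ (qq N)) := by
        simp only [ew0]; exact (iN hN).const_mul _
      have idf : Integrable (fun x => w x - |c * UU x| ^ (qq N)) := iw.sub iw0
      have b := abs_int_bdd idf (hexp ξ hξ)
      have iJw : Integrable (fun x => (rr ξ x ^ N - 1 - N * inner ℝ ξ (om x)) * w x) := int_bdd iw cJ (hexp ξ hξ)
      have iJ0 : Integrable (fun x => (rr ξ x ^ N - 1 - N * inner ℝ ξ (om x)) * |c * UU x| ^ (qq N)) := int_bdd iw0 cJ (hexp ξ hξ)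
      have z : ∫ x, (rr ξ x ^ N - 1 - N * inner ℝ ξ (om x)) * |c * UU x| ^ (qq N) = 0 := by
        have : ∀ x, (rr ξ x ^ N - 1 - N * inner ℝ ξ (om x)) * |c * UU x| ^ (qq N) =
          |c| ^ (qq N) * ((rr ξ x ^ N - 1 - N * inner ℝ ξ (om x)) * (1 / ell x) ^ N) := by
          intro x; rw [ew0]; ring
        simp only [this]
        rw [integral_const_mul, J_zero hN hξ, mul_zero]
      have e2 : ∫ x, (rr ξ x ^ N - 1 - N * inner ℝ ξ (om x)) * (w x - |c * UU x| ^ (qq N)) =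
         ∫ x, (rr ξ x ^ N - 1 - N * inner ℝ ξ (om x)) * w x := by
        simp only [mul_sub]
        rw [integral_sub iJw iJ0, z, sub_zero]
      rw [e2] at b
      refine b.trans ?_
      have : C3 * ‖ξ‖ ^ 2 * ∫ x, |w x - |c * UU x| ^ (qq N)| ≤ C3 * ‖ξ‖ ^ 2 * (C2 * √(DD u)) :=
        mul_le_mul_of_nonneg_left l (by positivity)
      have : 0 ≤ C3 * ‖ξ‖ ^ 2 * √(DD u) := by positivity
      nlinarith
  rw [e]
  refine (abs_add_le _ _).trans (add_le_add hJ ?_)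
  rw [abs_mul, abs_of_nonneg (Nat.cast_nonneg N)]
  exact mul_le_mul_of_nonneg_left (hδ ξ) (Nat.cast_nonneg N)

def SS (N : ℕ) : ℝ := sInf {v | ∃ φ : EE N → ℝ, Adm φ ∧ ∫ x, |φ x| ^ (qq N) = 1 ∧ v = ∫ x, ‖gradient φ x‖ ^ 2}

lemma SS_bdd (N : ℕ) : BddBelow {v | ∃ φ : EE N → ℝ, Adm φ ∧ ∫ x, |φ x| ^ (qq N) = 1 ∧ v = ∫ x, ‖gradient φ x‖ ^ 2} :=
  ⟨0, by rintro v ⟨φ, -, -, rfl⟩; exact integral_nonneg fun x => by positivity⟩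

lemma SS_nonneg (N : ℕ) : 0 ≤ SS N :=
  Real.sInf_nonneg (by rintro v ⟨φ, -, -, rfl⟩; exact integral_nonneg fun x => by positivity)

lemma grad_cmul {N : ℕ} {f : EE N → ℝ} (hf : Differentiable ℝ f) (a : ℝ) (x : EE N) :
    gradient (fun y => a * f y) x = a • gradient f x := by
  unfold gradient
  rw [fderiv_const_mul (hf x)]; simp

lemma Adm.cmul {N : ℕ} {f : EE N → ℝ} (hf : Adm f) (a : ℝ) : Adm (fun y => a * f y) :=
  ⟨contDiff_const.mul hf.1, hf.2.mul_left⟩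

lemma normalz {N : ℕ} (hN : 3 ≤ N) {φ : EE N → ℝ} (hφ : Adm φ) (hI : 0 < ∫ x, |φ x| ^ (qq N)) :
    ∃ a : ℝ, 0 < a ∧ a ^ 2 * (∫ x, |φ x| ^ (qq N)) ^ (2 / qq N) = 1 ∧
    ∫ x, |a * φ x| ^ (qq N) = 1 ∧
    ∫ x, ‖gradient (fun y => a * φ y) x‖ ^ 2 = a ^ 2 * ∫ x, ‖gradient φ x‖ ^ 2 := by
  have hq := qq_gt hN
  set I := ∫ x, |φ x| ^ (qq N)
  refine ⟨I ^ (-(1 / qq N)), by positivity, ?_, ?_, ?_⟩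
  · rw [← Real.rpow_natCast, ← Real.rpow_mul hI.le, ← Real.rpow_add hI]
    convert Real.rpow_zero I using 2; push_cast; ring
  · have : ∀ x, |I ^ (-(1 / qq N)) * φ x| ^ (qq N) = I⁻¹ * |φ x| ^ (qq N) := by
      intro x
      rw [abs_mul, Real.mul_rpow (abs_nonneg _) (abs_nonneg _), abs_of_pos (by positivity), ← Real.rpow_mul hI.le]
      congr 1
      rw [← Real.rpow_neg_one]; congr 1; field_simp
    simp only [this]
    rw [integral_const_mul]
    exact inv_mul_cancel₀ hI.ne'
  · rw [← integral_const_mul]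
    congr 1; ext x
    rw [grad_cmul (hφ.1.differentiable (by simp)), norm_smul, mul_pow, Real.norm_eq_abs, sq_abs]

lemma SS_le {N : ℕ} (hN : 3 ≤ N) {φ : EE N → ℝ} (hφ : Adm φ) :
    SS N * (∫ x, |φ x| ^ (qq N)) ^ (2 / qq N) ≤ ∫ x, ‖gradient φ x‖ ^ 2 := by
  have hq := qq_gt hN
  have h0 : 0 ≤ ∫ x, |φ x| ^ (qq N) := integral_nonneg fun x => Real.rpow_nonneg (abs_nonneg _) _
  rcases eq_or_lt_of_le h0 with h | h
  · rw [← h, Real.zero_rpow (by positivity), mul_zero]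
    exact integral_nonneg fun x => by positivity
  · obtain ⟨a, ha, h1, h2, h3⟩ := normalz hN hφ h
    have : SS N ≤ a ^ 2 * ∫ x, ‖gradient φ x‖ ^ 2 :=
      csInf_le (SS_bdd N) ⟨_, hφ.cmul a, h2, h3.symm⟩
    have h4 := mul_le_mul_of_nonneg_right this (Real.rpow_nonneg h0 (2 / qq N))
    calc _ ≤ _ := h4
      _ = (a ^ 2 * (∫ x, |φ x| ^ (qq N)) ^ (2 / qq N)) * ∫ x, ‖gradient φ x‖ ^ 2 := by ring
      _ = _ := by rw [h1, one_mul]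


def FF (ε : ℝ) (k : ℕ) (σ ρ : ℝ) : ℝ := (√(1 - (ε * ρ) ^ 2) / (1 - ε * σ)) ^ k

lemma FF_meas (ε : ℝ) (k : ℕ) : Measurable (Function.uncurry (FF ε k)) := by
  unfold FF Function.uncurry
  fun_prop

lemma FF_bd {ε : ℝ} (h0 : 0 < ε) (h1 : ε ≤ 1/2) (k : ℕ) : ∀ σ ρ : ℝ, |σ| ≤ ρ → ρ < 1 → |FF ε k σ ρ| ≤ 2 ^ k := by
  intro σ ρ h h2
  obtain ⟨a, b⟩ := abs_le.1 h
  have hd : 1/2 ≤ 1 - ε * σ := by nlinarith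
  have hs : √(1 - (ε * ρ) ^ 2) ≤ 1 := Real.sqrt_le_one.2 (by nlinarith [sq_nonneg (ε * ρ)])
  have hs0 := Real.sqrt_nonneg (1 - (ε * ρ) ^ 2)
  have hq : 0 ≤ √(1 - (ε * ρ) ^ 2) / (1 - ε * σ) := div_nonneg hs0 (by linarith)
  unfold FF
  rw [abs_of_nonneg (pow_nonneg hq k)]
  refine pow_le_pow_left₀ hq ?_ k
  rw [div_le_iff₀ (by linarith)]; linarith

lemma FF_rr {N : ℕ} {ε : ℝ} (h0 : 0 < ε) (k : ℕ) (η : EP N) (x : EE N) :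
    FF ε k (inner ℝ η (om x)) ‖η‖ = rr (ε • η) x ^ k := by
  unfold FF rr sx
  rw [norm_smul, Real.norm_eq_abs, abs_of_pos h0, inner_smul_left]; simp

lemma small {N : ℕ} {ε : ℝ} (h0 : 0 < ε) (h1 : ε ≤ 1/2) {η : EP N} (h : ‖η‖ < 1) : ‖ε • η‖ ≤ ε := by
  rw [norm_smul, Real.norm_eq_abs, abs_of_pos h0]; nlinarith

def mm (N k : ℕ) (ε : ℝ) : ℝ := ∫ η, FF ε k (inner ℝ η (om (0 : EE N))) ‖η‖ ∂(nu N)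

lemma mm_int {N : ℕ} (k : ℕ) {ε : ℝ} (h0 : 0 < ε) (h1 : ε ≤ 1/2) :
    Integrable (fun η => FF ε k (inner ℝ η (om (0 : EE N))) ‖η‖) (nu N) := by
  refine Integrable.of_bound (C := 2 ^ k) ?_ ?_
  · have h2 : Measurable (fun η : EP N => (inner ℝ η (om (0 : EE N)), ‖η‖)) := by fun_prop
    exact ((FF_meas ε k).comp h2).aestronglyMeasurable
  · filter_upwards [nu_ae N] with η hη
    exact FF_bd h0 h1 k _ _ (inner_om_le _ _) hη

lemma avg {N : ℕ} (k : ℕ) {ε : ℝ} (h0 : 0 < ε) (h1 : ε ≤ 1/2) {f : EE N → ℝ} (hf : Integrable f) :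
    Integrable (fun η => ∫ x, rr (ε • η) x ^ k * f x) (nu N) ∧
    ∫ η, (∫ x, rr (ε • η) x ^ k * f x) ∂(nu N) = mm N k ε * ∫ x, f x := by
  have := fubini_avg (FF ε k) (FF_meas ε k) (FF_bd h0 h1 k) hf
  simp only [FF_rr h0] at this
  unfold mm
  simp only [FF_rr h0]
  exact this

lemma mm_N {N : ℕ} (hN : 3 ≤ N) {ε : ℝ} (h0 : 0 < ε) (h1 : ε ≤ 1/2) : mm N N ε = 1 := by
  have h := (avg N h0 h1 (iN hN)).2
  have hM := MM_pos hN
  have e : ∫ η, (∫ x, rr (ε • η) x ^ N * (1 / ell x) ^ N) ∂(nu N) = ∫ η, MM N ∂(nu N) := by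
    refine integral_congr_ae ?_
    filter_upwards [nu_ae N] with η hη
    have := small h0 h1 hη
    rw [MM, ← mass (ξ := ε • η) (by linarith)]
    congr 1; ext x; simp only [div_pow, one_pow]; ring
  rw [e, integral_const] at h
  simp at h
  change MM N = mm N N ε * ∫ x : EE N, (ell x ^ N)⁻¹ at h
  have : ∫ x : EE N, (ell x ^ N)⁻¹ = MM N := by unfold MM; congr 1; ext x; simp
  rw [this] at h
  field_simp at h
  linarith

lemma mm_bd {N : ℕ} (hN : 3 ≤ N) {ε : ℝ} (h0 : 0 < ε) (h1 : ε ≤ 1/2) :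
    8/9 * (ε ^ 2 * kap N / 2 - ε ^ 4) ≤ N * (1 - mm N (N-2) ε) := by
  have hm := mm_N hN h0 h1
  obtain ⟨n, rfl⟩ : ∃ n, N = n + 2 := ⟨N - 2, by omega⟩
  rw [show n + 2 - 2 = n by omega]
  have hpt : ∀ᵐ η ∂(nu (n+2)), 8/9 * (ε ^ 2 * (inner ℝ η (om (0 : EE (n+2)))) ^ 2 / 2 - ε ^ 4) ≤
      n * FF ε (n+2) (inner ℝ η (om (0 : EE (n+2)))) ‖η‖ - (n+2) * FF ε n (inner ℝ η (om (0 : EE (n+2)))) ‖η‖ + 2 := by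
    filter_upwards [nu_ae (n+2)] with η hη
    have hs := small h0 h1 hη
    rw [FF_rr h0, FF_rr h0]
    obtain ⟨r0, -, -, r4⟩ := rr_facts (hs.trans h1) (0 : EE (n+2))
    have := sc_a r0 n (by omega)
    have h4 : ‖ε • η‖ ^ 4 ≤ ε ^ 4 := pow_le_pow_left₀ (norm_nonneg _) hs 4
    rw [inner_smul_left] at r4
    simp only [RCLike.conj_to_real] at r4
    rw [mul_pow] at r4
    linarith
  have i1 := (mm_int (N := n+2) (n+2) h0 h1).const_mul (n:ℝ)
  have i2 := (mm_int (N := n+2) n h0 h1).const_mul ((n:ℝ)+2)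
  have i3 := kap_int (n+2)
  have i12 : Integrable (fun η => n * FF ε (n+2) (inner ℝ η (om (0 : EE (n+2)))) ‖η‖ - (n+2) * FF ε n (inner ℝ η (om (0 : EE (n+2)))) ‖η‖) (nu (n+2)) := i1.sub i2
  have i4 : Integrable (fun η => n * FF ε (n+2) (inner ℝ η (om (0 : EE (n+2)))) ‖η‖ - (n+2) * FF ε n (inner ℝ η (om (0 : EE (n+2)))) ‖η‖ + 2) (nu (n+2)) := i12.add (integrable_const _)
  have i5 : Integrable (fun η => ε ^ 2 * (inner ℝ η (om (0 : EE (n+2)))) ^ 2 / 2) (nu (n+2)) := (i3.const_mul _).div_const _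
  have i6 : Integrable (fun η => 8/9 * (ε ^ 2 * (inner ℝ η (om (0 : EE (n+2)))) ^ 2 / 2 - ε ^ 4)) (nu (n+2)) :=
    (i5.sub (integrable_const _)).const_mul _
  have := integral_mono_ae i6 i4 hpt
  rw [integral_const_mul, integral_sub i5 (integrable_const _), integral_div, integral_const_mul, integral_add i12 (integrable_const _),
    integral_sub i1 i2, integral_const_mul, integral_const_mul] at this
  simp only [integral_const, probReal_univ, one_smul] at this
  change 8/9 * (ε ^ 2 * kap (n+2) / 2 - ε ^ 4) ≤ n * mm (n+2) (n+2) ε - (n+2) * mm (n+2) n ε + 2 at this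
  rw [hm] at this
  push_cast
  linarith

lemma gr_ineq {N : ℕ} (hN : 3 ≤ N) {u : EE N → ℝ} (hu : Adm u) {ξ : EP N} (h : ‖ξ‖ ≤ 1/2) :
    SS N * (∫ x, rr ξ x ^ N * |u x * UU x| ^ (qq N)) ^ (2 / qq N) ≤
    (∫ x, rr ξ x ^ (N-2) * ((1 / ell x) ^ (N-2) * ‖gradient u x‖ ^ 2)) +
      (N * ((N:ℝ) - 2)) * ∫ x, rr ξ x ^ N * (u x ^ 2 * (1 / ell x) ^ N) := by
  have hlt : ‖ξ‖ < 1 := by linarith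
  have hpos := PP_pos hlt
  have hs := sx_pos hlt
  have g := ground hN hs hpos (PP_rel hlt) hu
  have hV : ContDiff ℝ 1 (VV (sx ξ) (1 - ξ.snd) (1 + ξ.snd) ξ.fst) := VV_cont hs hpos
  have b := SS_le hN (hu.mul hV)
  rw [g] at b
  have e1 : ∀ x, |u x * VV (sx ξ) (1 - ξ.snd) (1 + ξ.snd) ξ.fst x| ^ (qq N) = rr ξ x ^ N * |u x * UU x| ^ (qq N) := by
    intro x
    rw [abs_mul, abs_mul, Real.mul_rpow (abs_nonneg _) (abs_nonneg _), Real.mul_rpow (abs_nonneg _) (abs_nonneg _),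
      abs_of_pos (UU_pos x), UU_q hN, abs_of_pos (VV_pos hs (hpos x)), VV_q hN hs (hpos x), s_div_PP]
    simp only [div_pow, one_pow]; ring
  have e2 : ∀ x, (sx ξ / PP (1 - ξ.snd) (1 + ξ.snd) ξ.fst x) ^ (N-2) * ‖gradient u x‖ ^ 2 =
      rr ξ x ^ (N-2) * ((1 / ell x) ^ (N-2) * ‖gradient u x‖ ^ 2) := by
    intro x; rw [s_div_PP]; simp only [div_pow, one_pow]; ring
  have e3 : ∀ x, u x ^ 2 * (sx ξ / PP (1 - ξ.snd) (1 + ξ.snd) ξ.fst x) ^ N =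
      rr ξ x ^ N * (u x ^ 2 * (1 / ell x) ^ N) := by
    intro x; rw [s_div_PP]; simp only [div_pow, one_pow]; ring
  simp only [e1, e2, e3] at b
  exact b

lemma Adm.i1 {N : ℕ} {u : EE N → ℝ} (hu : Adm u) : Integrable (fun x => (1 / ell x) ^ (N-2) * ‖gradient u x‖ ^ 2) := by
  have hgu := continuous_grad hu.1
  have hgc := grad_compact hu.2
  apply Continuous.integrable_of_hasCompactSupport
  · exact (cpow (N-2)).mul (hgu.norm.pow 2)
  apply HasCompactSupport.mul_left
  exact hgc.comp_left (g := fun y => ‖y‖ ^ 2) (by simp)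

lemma Adm.i2 {N : ℕ} {u : EE N → ℝ} (hu : Adm u) : Integrable (fun x => u x ^ 2 * (1 / ell x) ^ N) := by
  apply Continuous.integrable_of_hasCompactSupport
  · exact (hu.1.continuous.pow 2).mul (cpow N)
  apply HasCompactSupport.mul_right
  exact hu.2.comp_left (g := fun y => y ^ 2) (by simp)

lemma key {N : ℕ} (hN : 3 ≤ N) : ∃ c C : ℝ, 0 < c ∧ 0 ≤ C ∧ ∀ u : EE N → ℝ, Adm u →
    ∫ x, |u x * UU x| ^ (qq N) = 1 → ∀ δ : ℝ,
    (∀ ξ : EP N, |∫ x, inner ℝ ξ (om x) * |u x * UU x| ^ (qq N)| ≤ δ * ‖ξ‖) →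
    c * DD u ≤ (∫ x, ‖gradient (fun y => u y * UU y) x‖ ^ 2) - SS N + C * δ ^ 2 := by
  obtain ⟨C, hC, hg⟩ := g_est hN
  have hS := SS_nonneg N
  have hk := kap_pos N
  have hq := qq_gt hN
  have hNp : (0:ℝ) < N := by exact_mod_cast (by omega : 0 < N)
  set B : ℝ := 8/(9*N) + 2 * SS N * C ^ 2 with hB
  have hBp : 0 < B := by positivity
  -- choose ε
  obtain ⟨ε, h0, h1, he⟩ : ∃ ε : ℝ, 0 < ε ∧ ε ≤ 1/2 ∧ ε ^ 2 * B ≤ 2 * kap N / (9 * N) := by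
    set a := 2 * kap N / (9 * N) with ha
    have hap : 0 < a := by positivity
    refine ⟨min (1/2) (a / B), by positivity, min_le_left _ _, ?_⟩
    set m := min (1/2) (a / B)
    have m0 : 0 < m := by positivity
    have m1 : m ≤ 1/2 := min_le_left _ _
    have m2 : m ≤ a / B := min_le_right _ _
    rw [le_div_iff₀ hBp] at m2
    nlinarith [mul_pos m0 hBp]
  refine ⟨ε ^ 2 * (2 * kap N / (9 * N)), 2 * SS N * N ^ 2 * ε ^ 2, by positivity, by positivity, fun u hu hone δ hδ => ?_⟩
  have hDn := DD_nonneg u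
  set D := DD u with hD
  set w := fun x => |u x * UU x| ^ (qq N) with hw
  have iw : Integrable w := by
    by_contra h
    rw [integral_undef h] at hone; norm_num at hone
  have if1 := hu.i1
  have if2 := hu.i2
  have hδ0 : 0 ≤ δ := by
    have := (abs_nonneg _).trans (hδ (om 0)); rw [om_norm] at this; linarith
  set E := (C * ε ^ 2 * √D + N * (δ * ε)) ^ 2 with hE
  obtain ⟨ia, ea⟩ := avg N h0 h1 iw
  obtain ⟨ib, eb⟩ := avg (N-2) h0 h1 if1
  obtain ⟨ic, ec⟩ := avg N h0 h1 if2
  have hp0 : 0 < 2 / qq N := by positivity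
  have hp1 : 2 / qq N < 1 := by rw [div_lt_one (by linarith)]; exact hq
  set p := 2 / qq N with hp
  have hpt : ∀ᵐ η ∂(nu N), SS N * ((1 - p - E) + p * ∫ x, rr (ε • η) x ^ N * w x) ≤
      (∫ x, rr (ε • η) x ^ (N-2) * ((1 / ell x) ^ (N-2) * ‖gradient u x‖ ^ 2)) +
      (N * ((N:ℝ) - 2)) * ∫ x, rr (ε • η) x ^ N * (u x ^ 2 * (1 / ell x) ^ N) := by
    filter_upwards [nu_ae N] with η hη
    have hs := small h0 h1 hη
    have b := gr_ineq hN hu (hs.trans h1)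
    refine le_trans (mul_le_mul_of_nonneg_left ?_ hS) b
    have b2 := hg u hu hone δ hδ (ε • η) (hs.trans h1)
    set g := ∫ x, rr (ε • η) x ^ N * |u x * UU x| ^ (qq N) with hgd
    have g0 : 0 ≤ g := integral_nonneg fun x =>
      mul_nonneg (pow_nonneg (rr_facts (hs.trans h1) x).1 N) (Real.rpow_nonneg (abs_nonneg _) _)
    have b3 : (g - 1) ^ 2 ≤ E := by
      rw [← sq_abs]
      refine pow_le_pow_left₀ (abs_nonneg _) (b2.trans ?_) 2
      gcongr
    have b4 := sc_b g0 hp0 hp1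
    change 1 - p - E + p * g ≤ g ^ p
    linarith
  have il : Integrable (fun η => p * ∫ x, rr (ε • η) x ^ N * w x) (nu N) := ia.const_mul p
  have il2 : Integrable (fun η => (1 - p - E) + p * ∫ x, rr (ε • η) x ^ N * w x) (nu N) := (integrable_const _).add il
  have ic' : Integrable (fun η => (N * ((N:ℝ) - 2)) * ∫ x, rr (ε • η) x ^ N * (u x ^ 2 * (1 / ell x) ^ N)) (nu N) := ic.const_mul _
  have fin := integral_mono_ae (il2.const_mul (SS N)) (ib.add ic') hpt
  simp only [Pi.add_apply] at fin
  rw [integral_const_mul, integral_add (integrable_const _) il, integral_const_mul, ea, integral_add ib ic', eb,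
    integral_const_mul, ec, hone, mm_N hN h0 h1] at fin
  simp only [integral_const, probReal_univ, one_smul] at fin
  rw [ground0 hN hu]
  change SS N * (1 - p - E + p * (1 * 1)) ≤ mm N (N-2) ε * D + _ at fin
  change _ ≤ D + _ - _ + _
  have hm := mm_bd hN h0 h1
  set m := mm N (N-2) ε
  set Q := ∫ x, u x ^ 2 * (1 / ell x) ^ N
  have hE2 : E ≤ 2 * C ^ 2 * ε ^ 4 * D + 2 * N ^ 2 * ε ^ 2 * δ ^ 2 := by
    have hsq : √D ^ 2 = D := Real.sq_sqrt hDn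
    have := sq_nonneg (C * ε ^ 2 * √D - N * (δ * ε))
    calc E ≤ 2 * (C * ε ^ 2 * √D) ^ 2 + 2 * (N * (δ * ε)) ^ 2 := by rw [hE]; nlinarith
      _ = 2 * C ^ 2 * ε ^ 4 * √D ^ 2 + 2 * N ^ 2 * ε ^ 2 * δ ^ 2 := by ring
      _ = _ := by rw [hsq]
  have hE3 := mul_le_mul_of_nonneg_left hE2 hS
  have hm2 : 8/(9*N) * (ε ^ 2 * kap N / 2 - ε ^ 4) ≤ 1 - m := by
    rw [show 8/(9*(N:ℝ)) * (ε ^ 2 * kap N / 2 - ε ^ 4) = (8/9 * (ε ^ 2 * kap N / 2 - ε ^ 4)) / N by field_simp,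
      div_le_iff₀ hNp]
    linarith
  have hm3 := mul_le_mul_of_nonneg_right hm2 hDn
  have he2 := mul_le_mul_of_nonneg_right (mul_le_mul_of_nonneg_left he (sq_nonneg ε)) hDn
  have id1 : ε ^ 2 * (ε ^ 2 * B) * D = 8/(9*N) * ε ^ 4 * D + SS N * (2 * C ^ 2 * ε ^ 4 * D) := by rw [hB]; ring
  have id2 : 8/(9*N) * (ε ^ 2 * kap N / 2 - ε ^ 4) * D = 2 * (ε ^ 2 * (2 * kap N / (9 * N)) * D) - 8/(9*N) * ε ^ 4 * D := by
    field_simp; ring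
  nlinarith


lemma resc {N : ℕ} (hN : 3 ≤ N) {φ : EE N → ℝ} (hφ : Adm φ) {t : ℝ} (ht : 0 < t) (y : EE N) :
    ∃ ψ : EE N → ℝ, Adm ψ ∧
    (∀ G : EE N → ℝ, ∫ x, G (t • (x - y)) * |φ x| ^ (qq N) = ∫ z, G z * |ψ z| ^ (qq N)) ∧
    (∀ z : ℝ, ∫ x, ‖gradient φ x - z • gradient (sobolevBubble N t y) x‖ ^ 2 =
      ∫ x, ‖gradient ψ x - z • gradient UU x‖ ^ 2) := by
  have hq := qq_gt hN
  have h3 : (3:ℝ) ≤ N := by exact_mod_cast hN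
  set b : ℝ := t ^ (kk N) with hb
  have hbp : 0 < b := by positivity
  set ψ : EE N → ℝ := fun z => b⁻¹ * φ (t⁻¹ • z + y) with hψ
  have hψA : Adm ψ := by
    refine Adm.cmul (f := fun z => φ (t⁻¹ • z + y)) ⟨?_, ?_⟩ _
    · have := hφ.1
      exact this.comp (by fun_prop)
    · have := hφ.2.comp_homeomorph ((Homeomorph.smulOfNeZero t⁻¹ (inv_ne_zero ht.ne')).trans (Homeomorph.addRight y))
      exact this
  have e1 : ∀ x, φ x = b * ψ (t • (x - y)) := by
    intro x
    simp only [hψ, smul_smul, inv_mul_cancel₀ ht.ne', one_smul, sub_add_cancel]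
    field_simp
  have e2 : ∀ x, sobolevBubble N t y x = b * UU (t • (x - y)) := by
    intro x
    rw [UU_bubble]
    unfold sobolevBubble
    rw [hb, kk, ← Real.mul_rpow ht.le (by positivity), sub_zero, norm_smul, Real.norm_eq_abs, abs_of_pos ht]
    congr 1; ring
  have hbq : b ^ (qq N) = t ^ N := by
    rw [hb, ← Real.rpow_mul ht.le, ← Real.rpow_natCast]
    congr 1
    rw [kk, qq]; field_simp [show (N:ℝ) - 2 ≠ 0 by linarith]
  have hb2 : (b * t) ^ 2 = t ^ N := by
    rw [mul_pow, hb, ← Real.rpow_natCast (t ^ kk N), ← Real.rpow_mul ht.le, ← Real.rpow_natCast t 2, ← Real.rpow_add ht,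
      ← Real.rpow_natCast]
    congr 1
    rw [kk]; push_cast; ring
  have hUd : Differentiable ℝ (UU : EE N → ℝ) := UU_cd.differentiable (by simp)
  have hψd : Differentiable ℝ ψ := hψA.1.differentiable (by simp)
  clear_value ψ b
  have hc : ∀ (f : EE N → ℝ), Differentiable ℝ f → ∀ x, gradient (fun x => b * f (t • (x - y))) x = (b * t) • gradient f (t • (x - y)) := by
    intro f hf x
    rw [grad_cmul (f := fun x => f (t • (x - y))) (hf.comp (by fun_prop)), grad_aff hf, smul_smul]
  refine ⟨ψ, hψA, fun G => ?_, fun z => ?_⟩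
  · have : ∀ x, G (t • (x - y)) * |φ x| ^ (qq N) = t ^ N * (fun z => G z * |ψ z| ^ (qq N)) (t • (x - y)) := by
      intro x
      rw [e1, abs_mul, Real.mul_rpow (abs_nonneg _) (abs_nonneg _), abs_of_pos hbp, hbq]; ring
    simp only [this]
    rw [integral_const_mul, int_scale (fun z => G z * |ψ z| ^ (qq N)) ht y]
    field_simp
  · have : ∀ x, ‖gradient φ x - z • gradient (sobolevBubble N t y) x‖ ^ 2 =
        t ^ N * (fun x => ‖gradient ψ x - z • gradient UU x‖ ^ 2) (t • (x - y)) := by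
      intro x
      rw [show φ = fun x => b * ψ (t • (x - y)) from funext e1,
        show sobolevBubble N t y = fun x => b * UU (t • (x - y)) from funext e2, hc ψ hψd, hc UU hUd, smul_comm z,
        ← smul_sub, norm_smul, mul_pow, Real.norm_eq_abs, sq_abs, hb2]
    simp only [this]
    rw [integral_const_mul, int_scale (fun x => ‖gradient ψ x - z • gradient UU x‖ ^ 2) ht y]
    field_simp

lemma adm_w {N : ℕ} (hN : 3 ≤ N) {φ : EE N → ℝ} (hφ : Adm φ) :
    Continuous (fun x => |φ x| ^ (qq N)) ∧ HasCompactSupport (fun x => |φ x| ^ (qq N)) := by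
  have hq := qq_gt hN
  refine ⟨hφ.1.continuous.abs.rpow_const (fun x => Or.inr (by linarith)), ?_⟩
  exact hφ.2.comp_left (g := fun v => |v| ^ (qq N)) (by simp; rw [Real.zero_rpow (by linarith)])

def hh {N : ℕ} (t : ℝ) (y x : EE N) : ℝ := (1 + t ^ 2 * ‖x - y‖ ^ 2) / t

lemma hh_pos {N : ℕ} {t : ℝ} (ht : 0 < t) (y x : EE N) : 0 < hh t y x := by unfold hh; positivity

lemma hh_cont {N : ℕ} (t : ℝ) (y : EE N) : Continuous (hh t y) := by unfold hh; fun_prop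

lemma hh_log_cont {N : ℕ} {t : ℝ} (ht : 0 < t) (y : EE N) : Continuous (fun x => Real.log (hh t y x)) :=
  (hh_cont t y).log (fun x => (hh_pos ht y x).ne')

lemma hh_mass {N : ℕ} (hN : 3 ≤ N) {t : ℝ} (ht : 0 < t) (y : EE N) :
    Integrable (fun x => (1 / hh t y x) ^ N) ∧ ∫ x, (1 / hh t y x) ^ N = MM N := by
  have e : ∀ x, (1 / hh t y x) ^ N = t ^ N * (fun z => (1 / ell z) ^ N) (t • (x - y)) := by
    intro x
    unfold hh ell
    simp only
    rw [norm_smul, Real.norm_eq_abs, abs_of_pos ht, mul_pow t, ← mul_pow]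
    congr 1; field_simp
    simp only [div_pow, one_pow]; ring
  have h2 : ∫ x, (1 / hh t y x) ^ N = MM N := by
    simp only [e]
    rw [integral_const_mul, int_scale (fun z => (1 / ell z) ^ N) ht y, MM]
    field_simp
  refine ⟨?_, h2⟩
  by_contra h
  rw [integral_undef h] at h2
  linarith [MM_pos hN]

lemma psi_bdd {N : ℕ} (hN : 3 ≤ N) {φ : EE N → ℝ} (hφ : Adm φ) (h1 : ∫ x, |φ x| ^ (qq N) = 1) :
    ∃ B : ℝ, ∀ t : ℝ, 0 < t → ∀ y, B ≤ ∫ x, Real.log (hh t y x) * |φ x| ^ (qq N) := by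
  obtain ⟨wc, ws⟩ := adm_w hN hφ
  obtain ⟨K, hK⟩ := ws.exists_bound_of_continuous wc
  have hNp : (0:ℝ) < N := by exact_mod_cast (by omega : 0 < N)
  refine ⟨(1 - K * MM N) / N, fun t ht y => ?_⟩
  obtain ⟨im, em⟩ := hh_mass hN ht y
  set w := fun x => |φ x| ^ (qq N) with hw
  have w0 : ∀ x, 0 ≤ w x := fun x => Real.rpow_nonneg (abs_nonneg _) _
  have iw : Integrable w := wc.integrable_of_hasCompactSupport ws
  have il : Integrable (fun x => Real.log (hh t y x) * w x) :=
    ((hh_log_cont ht y).mul wc).integrable_of_hasCompactSupport ws.mul_left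
  have e0 : 1 - K * MM N = ∫ x, (w x - K * (1 / hh t y x) ^ N) := by
    rw [integral_sub iw (im.const_mul K), integral_const_mul, em, h1]
  rw [div_le_iff₀ hNp, e0, ← integral_mul_const]
  refine integral_mono (iw.sub (im.const_mul K)) (il.mul_const _) fun x => ?_
  have hp := hh_pos ht y x
  have l : 1 - (1 / hh t y x) ^ N ≤ N * Real.log (hh t y x) := by
    have := Real.one_sub_inv_le_log_of_pos (pow_pos hp N)
    rw [Real.log_pow] at this
    simpa using this
  have hKx := hK x
  rw [Real.norm_eq_abs, abs_of_nonneg (w0 x)] at hKx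
  have hq0 : 0 ≤ (1 / hh t y x) ^ N := by positivity
  show w x - K * (1 / hh t y x) ^ N ≤ Real.log (hh t y x) * w x * N
  have := mul_le_mul_of_nonneg_right l (w0 x)
  have := mul_le_mul_of_nonneg_right hKx hq0
  nlinarith

lemma hh_pert {N : ℕ} {t : ℝ} (ht : 0 < t) (y x : EE N) {ξ : EP N} (h : ‖ξ‖ ≤ 1/2) :
    ∃ t' : ℝ, 0 < t' ∧ ∃ y' : EE N, ∀ x, Real.log (hh t' y' x) ≤
      Real.log (hh t y x) - inner ℝ ξ (om (t • (x - y))) + 2 * ‖ξ‖ ^ 2 := by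
  have hlt : ‖ξ‖ < 1 := by linarith
  have hs := sx_pos hlt
  have hs2 := sx_sq hlt
  have hb := snd_lt hlt
  refine ⟨t * ((1 - ξ.snd) / sx ξ), by positivity, y + t⁻¹ • ((1 - ξ.snd)⁻¹ • ξ.fst), fun x => ?_⟩
  have hr := rr_bubble hlt (t • (x - y))
  set T := (1 - ξ.snd) / sx ξ with hT
  set Y := (1 - ξ.snd)⁻¹ • ξ.fst
  have hT0 : 0 < T := by positivity
  set z := t • (x - y) with hz
  have ez : ‖z - Y‖ ^ 2 = t ^ 2 * ‖x - (y + t⁻¹ • Y)‖ ^ 2 := by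
    have : z - Y = t • (x - (y + t⁻¹ • Y)) := by
      rw [hz, smul_sub, smul_sub, smul_add, smul_smul, mul_inv_cancel₀ ht.ne', one_smul]; abel
    rw [this, norm_smul, mul_pow, Real.norm_eq_abs, sq_abs]
  have ez2 : ell z = 1 + t ^ 2 * ‖x - y‖ ^ 2 := by
    rw [ell, hz, norm_smul, mul_pow, Real.norm_eq_abs, sq_abs]
  have hi := inner_om_le ξ z
  set τ := inner ℝ ξ (om z) with hτ
  have ht1 : 0 < 1 - τ := by linarith [(abs_le.1 hi).2]
  have er : rr ξ z = sx ξ / (1 - τ) := rfl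
  have e : hh (t * T) (y + t⁻¹ • Y) x = hh t y x * ((1 - τ) / sx ξ) := by
    unfold hh
    rw [← ez2, mul_pow, mul_comm (t ^ 2), mul_assoc, ← ez]
    have hP : 0 < 1 + T ^ 2 * ‖z - Y‖ ^ 2 := by positivity
    have hel := ell_pos z
    rw [er] at hr
    have : 1 + T ^ 2 * ‖z - Y‖ ^ 2 = T * (ell z * ((1 - τ) / sx ξ)) := by
      field_simp at hr ⊢
      linarith
    rw [this]
    field_simp
  rw [e, Real.log_mul (hh_pos ht y x).ne' (by positivity), Real.log_div ht1.ne' hs.ne']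
  have l1 := Real.log_le_sub_one_of_pos ht1
  have l2 := Real.one_sub_inv_le_log_of_pos hs
  have n0 := norm_nonneg ξ
  have s1 : sx ξ ≤ 1 := by nlinarith
  have s2 : 1 - ‖ξ‖ ^ 2 ≤ sx ξ := by nlinarith
  have l3 : (sx ξ)⁻¹ ≤ 1 + 2 * ‖ξ‖ ^ 2 := by
    rw [inv_le_iff_one_le_mul₀ hs]
    have : ‖ξ‖ ^ 2 ≤ 1/4 := by nlinarith
    nlinarith [sq_nonneg ‖ξ‖]
  linarith

lemma balance {N : ℕ} (hN : 3 ≤ N) {φ : EE N → ℝ} (hφ : Adm φ) (h1 : ∫ x, |φ x| ^ (qq N) = 1) {δ : ℝ} (hδ : 0 < δ) :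
    ∃ t : ℝ, 0 < t ∧ ∃ y : EE N, ∀ ξ : EP N, |∫ x, inner ℝ ξ (om (t • (x - y))) * |φ x| ^ (qq N)| ≤ δ * ‖ξ‖ := by
  obtain ⟨B, hB⟩ := psi_bdd hN hφ h1
  obtain ⟨wc, ws⟩ := adm_w hN hφ
  set w := fun x => |φ x| ^ (qq N) with hw
  have w0 : ∀ x, 0 ≤ w x := fun x => Real.rpow_nonneg (abs_nonneg _) _
  have iw : Integrable w := wc.integrable_of_hasCompactSupport ws
  have il : ∀ t : ℝ, 0 < t → ∀ y, Integrable (fun x => Real.log (hh t y x) * w x) := fun t ht y =>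
    ((hh_log_cont ht y).mul wc).integrable_of_hasCompactSupport ws.mul_left
  set r := min (1/2) (δ / 3) with hr
  have r0 : 0 < r := by positivity
  have r1 : r ≤ 1/2 := min_le_left _ _
  have r2 : r ≤ δ / 3 := min_le_right _ _
  set T : Set ℝ := {v | ∃ t : ℝ, 0 < t ∧ ∃ y : EE N, v = ∫ x, Real.log (hh t y x) * w x} with hT
  have Tb : BddBelow T := ⟨B, by rintro v ⟨t, ht, y, rfl⟩; exact hB t ht y⟩
  have Tn : T.Nonempty := ⟨_, 1, one_pos, 0, rfl⟩
  obtain ⟨v, ⟨t, ht, y, rfl⟩, hv⟩ := exists_lt_of_csInf_lt Tn (lt_add_of_pos_right (sInf T) (by positivity : 0 < r ^ 2))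
  refine ⟨t, ht, y, ?_⟩
  have hin : ∀ ξ : EP N, Continuous (fun x => inner ℝ ξ (om (t • (x - y)))) := fun ξ =>
    (inner_cont ξ).comp (by fun_prop)
  have iin : ∀ ξ : EP N, Integrable (fun x => inner ℝ ξ (om (t • (x - y))) * w x) := fun ξ =>
    ((hin ξ).mul wc).integrable_of_hasCompactSupport ws.mul_left
  have A : ∀ ξ : EP N, ‖ξ‖ = r → ∫ x, inner ℝ ξ (om (t • (x - y))) * w x ≤ 3 * r ^ 2 := by
    intro ξ hξ
    obtain ⟨t', ht', y', hp⟩ := hh_pert ht y 0 (ξ := ξ) (by rw [hξ]; exact r1)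
    have l1 : sInf T ≤ ∫ x, Real.log (hh t' y' x) * w x := csInf_le Tb ⟨t', ht', y', rfl⟩
    have id : Integrable (fun x => Real.log (hh t y x) * w x - inner ℝ ξ (om (t • (x - y))) * w x) := (il t ht y).sub (iin ξ)
    have ic : Integrable (fun x => 2 * ‖ξ‖ ^ 2 * w x) := iw.const_mul _
    have l2 : ∫ x, Real.log (hh t' y' x) * w x ≤ ∫ x, (Real.log (hh t y x) * w x - inner ℝ ξ (om (t • (x - y))) * w x + 2 * ‖ξ‖ ^ 2 * w x) := by
      refine integral_mono (il t' ht' y') (id.add ic) fun x => ?_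
      have := mul_le_mul_of_nonneg_right (hp x) (w0 x)
      simp only [Pi.add_apply]
      linarith
    rw [integral_add id ic, integral_sub (il t ht y) (iin ξ), integral_const_mul, h1, hξ] at l2
    linarith
  have A2 : ∀ ξ : EP N, ∫ x, inner ℝ ξ (om (t • (x - y))) * w x ≤ δ * ‖ξ‖ := by
    intro ξ
    rcases eq_or_ne ξ 0 with rfl | hne
    · simp
    have hp : 0 < ‖ξ‖ := norm_pos_iff.2 hne
    have a := A ((r / ‖ξ‖) • ξ) (by rw [norm_smul, Real.norm_eq_abs, abs_of_pos (by positivity)]; field_simp)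
    have e : ∀ x, inner ℝ ((r / ‖ξ‖) • ξ) (om (t • (x - y))) * w x = (r / ‖ξ‖) * (inner ℝ ξ (om (t • (x - y))) * w x) := by
      intro x; rw [inner_smul_left]; simp; ring
    simp only [e] at a
    rw [integral_const_mul, div_mul_eq_mul_div, div_le_iff₀ hp] at a
    have : r * ∫ x, inner ℝ ξ (om (t • (x - y))) * w x ≤ r * (3 * r * ‖ξ‖) := by linarith
    have := le_of_mul_le_mul_left this r0
    nlinarith
  intro ξ
  rw [abs_le]
  refine ⟨?_, A2 ξ⟩
  have := A2 (-ξ)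
  simp only [inner_neg_left, neg_mul, integral_neg, norm_neg] at this
  linarith


lemma core {N : ℕ} (hN : 3 ≤ N) : ∃ c : ℝ, 0 < c ∧ ∀ φ : EE N → ℝ, Adm φ → ∫ x, |φ x| ^ (qq N) = 1 →
    ∀ η : ℝ, 0 < η → ∃ t : ℝ, ∃ _ : 0 < t, ∃ y : EE N, ∃ u : EE N → ℝ, Adm u ∧ ∫ x, |u x * UU x| ^ (qq N) = 1 ∧
    (∀ z : ℝ, ∫ x, ‖gradient φ x - z • gradient (sobolevBubble N t y) x‖ ^ 2 =
      ∫ x, ‖gradient (fun y => u y * UU y) x - z • gradient UU x‖ ^ 2) ∧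
    c * DD u ≤ (∫ x, ‖gradient φ x‖ ^ 2) - SS N + η := by
  obtain ⟨c, C, hc, hC, hk⟩ := key hN
  refine ⟨c, hc, fun φ hφ h1 η hη => ?_⟩
  set δ := √(η / (C + 1)) with hδ
  have hδ0 : 0 < δ := Real.sqrt_pos.2 (by positivity)
  have hδ2 : C * δ ^ 2 ≤ η := by
    rw [hδ, Real.sq_sqrt (by positivity), mul_div_assoc', div_le_iff₀ (by positivity)]
    nlinarith
  obtain ⟨t, ht, y, hb⟩ := balance hN hφ h1 hδ0
  obtain ⟨ψ, hψ, hG, hgr⟩ := resc hN hφ ht y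
  have hinv : ContDiff ℝ 1 (fun x : EE N => (UU x)⁻¹) := UU_cd.inv (fun x => (UU_pos x).ne')
  have eu : (fun x => (ψ x * (UU x)⁻¹) * UU x) = ψ := by
    ext x; have := (UU_pos x).ne'; field_simp
  have ew : ∀ x, |(ψ x * (UU x)⁻¹) * UU x| ^ (qq N) = |ψ x| ^ (qq N) := fun x => by rw [congrFun eu x]
  have h1' : ∫ x, |(ψ x * (UU x)⁻¹) * UU x| ^ (qq N) = 1 := by
    simp only [ew]
    have := hG (fun _ => 1)
    simp only [one_mul] at this
    rw [← this, h1]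
  refine ⟨t, ht, y, fun x => ψ x * (UU x)⁻¹, hψ.mul hinv, h1', ?_, ?_⟩
  · simp only [eu]; exact hgr
  · have := hk _ (hψ.mul hinv) h1' δ (fun ξ => by
      simp only [ew]
      rw [← hG (fun z => inner ℝ ξ (om z))]; exact hb ξ)
    simp only [eu] at this
    have g0 := hgr 0
    simp only [zero_smul, sub_zero] at g0
    rw [g0]
    linarith

lemma SS_nonempty {N : ℕ} (hN : 3 ≤ N) :
    {v | ∃ φ : EE N → ℝ, Adm φ ∧ ∫ x, |φ x| ^ (qq N) = 1 ∧ v = ∫ x, ‖gradient φ x‖ ^ 2}.Nonempty := by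
  have hq := qq_gt hN
  set f : ContDiffBump (0 : EE N) := default
  have hf : Adm (f : EE N → ℝ) := ⟨f.contDiff, f.hasCompactSupport⟩
  obtain ⟨wc, ws⟩ := adm_w hN hf
  have hI : 0 < ∫ x, |f x| ^ (qq N) := by
    refine wc.integral_pos_of_hasCompactSupport_nonneg_nonzero ws (fun x => Real.rpow_nonneg (abs_nonneg _) _) (x := 0) ?_
    rw [f.one_of_mem_closedBall (by simp [f.rIn_pos.le])]; simp
  obtain ⟨a, -, -, h2, -⟩ := normalz hN hf hI
  exact ⟨_, _, hf.cmul a, h2, rfl⟩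

lemma S_low {N : ℕ} (hN : 3 ≤ N) :
    (N * ((N:ℝ) - 2)) * MM N * (1 / MM N) ^ (2 / qq N) ≤ SS N := by
  obtain ⟨c, hc, hcore⟩ := core hN
  obtain ⟨C1, hC1, hcl⟩ := close hN
  obtain ⟨C2, hC2, hl1⟩ := l1close hN hC1
  have hq := qq_gt hN
  have hM := MM_pos hN
  have hS := SS_nonneg N
  have h3 : (3:ℝ) ≤ N := by exact_mod_cast hN
  set A : ℝ := N * ((N:ℝ) - 2) with hA
  have hA0 : 0 < A := mul_pos (by linarith) (by linarith)
  have hp : 0 < 2 / qq N := by positivity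
  have main : ∀ s : ℝ, 0 < s → s ≤ 1 → A * MM N * (max 0 ((1 - C2 * s) / MM N)) ^ (2 / qq N) ≤
      (1 + s) * (SS N + c * s ^ 2 / 2) + A * ((s ^ 2 + s) * C1) := by
    intro s s0 s1
    set η := c * s ^ 2 / 2 with hη
    have hη0 : 0 < η := by positivity
    obtain ⟨v, ⟨φ, hφ, h1, rfl⟩, hv⟩ := exists_lt_of_csInf_lt (SS_nonempty hN) (lt_add_of_pos_right (SS N) hη0)
    obtain ⟨t, ht, y, u, hu, hu1, hz, hD⟩ := hcore φ hφ h1 η hη0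
    have hDs : DD u ≤ s ^ 2 := by
      have : c * DD u ≤ c * s ^ 2 := by linarith
      exact le_of_mul_le_mul_left this hc
    have hD0 := DD_nonneg u
    have hD1 : DD u ≤ 1 := hDs.trans (by nlinarith)
    have hsD : √(DD u) ≤ s := by rw [Real.sqrt_le_left s0.le]; exact hDs
    obtain ⟨b, -, hi, he, h2⟩ := hcl u hu
    have l := hl1 u hu b hi he hu1 hD1
    have ew0 : ∀ x : EE N, |b * UU x| ^ (qq N) = |b| ^ (qq N) * (1 / ell x) ^ N := by
      intro x
      rw [abs_mul, Real.mul_rpow (abs_nonneg _) (abs_nonneg _), abs_of_pos (UU_pos x), UU_q hN]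
    have iw0 : Integrable (fun x : EE N => |b * UU x| ^ (qq N)) := by
      simp only [ew0]; exact (iN hN).const_mul _
    have iw : Integrable (fun x => |u x * UU x| ^ (qq N)) := by
      by_contra h
      rw [integral_undef h] at hu1; norm_num at hu1
    have m0 : ∫ x : EE N, |b * UU x| ^ (qq N) = |b| ^ (qq N) * MM N := by
      simp only [ew0]; rw [integral_const_mul]; rfl
    have l2 : 1 - |b| ^ (qq N) * MM N ≤ C2 * s := by
      rw [← hu1, ← m0, ← integral_sub iw iw0]
      refine (le_abs_self _).trans ((abs_integral_le_integral_abs).trans (l.trans ?_))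
      gcongr
    have l3 : max 0 ((1 - C2 * s) / MM N) ≤ |b| ^ (qq N) := by
      refine max_le (by positivity) ?_
      rw [div_le_iff₀ hM]; linarith
    have l4 : (max 0 ((1 - C2 * s) / MM N)) ^ (2 / qq N) ≤ b ^ 2 := by
      refine (Real.rpow_le_rpow (le_max_left _ _) l3 hp.le).trans (le_of_eq ?_)
      rw [← Real.rpow_mul (abs_nonneg _), mul_div_cancel₀ _ (by linarith)]
      simp
    -- Q bound
    have g := ground0 hN hu
    have z0 := hz 0
    simp only [zero_smul, sub_zero] at z0
    have iQ := hu.i2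
    set Q := ∫ x, u x ^ 2 * (1 / ell x) ^ N with hQ
    have lQ : A * Q ≤ SS N + η := by
      have : 0 ≤ ∫ x, (1 / ell x) ^ (N-2) * ‖gradient u x‖ ^ 2 := hD0
      linarith
    have iuc : Integrable (fun x => (u x - b) ^ 2 * (1 / ell x) ^ N) := by
      have ic : Integrable (fun x => (u x * (1 / ell x) ^ N)) := by
        apply Continuous.integrable_of_hasCompactSupport
        · exact hu.1.continuous.mul (cpow N)
        exact hu.2.mul_right
      have := (iQ.sub (ic.const_mul (2 * b))).add ((iN hN).const_mul (b ^ 2))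
      refine this.congr (Filter.Eventually.of_forall fun x => ?_)
      simp only [Pi.add_apply, Pi.sub_apply]; ring
    have lb : b ^ 2 * MM N ≤ (1 + s) * Q + (1 + 1 / s) * (C1 * s ^ 2) := by
      have j1 : Integrable (fun x => (1 + s) * (u x ^ 2 * (1 / ell x) ^ N)) := iQ.const_mul _
      have j2 : Integrable (fun x => (1 + 1/s) * ((u x - b) ^ 2 * (1 / ell x) ^ N)) := iuc.const_mul _
      calc b ^ 2 * MM N = ∫ x : EE N, b ^ 2 * (1 / ell x) ^ N := by rw [integral_const_mul]; rfl
        _ ≤ ∫ x, ((1 + s) * (u x ^ 2 * (1 / ell x) ^ N) + (1 + 1/s) * ((u x - b) ^ 2 * (1 / ell x) ^ N)) := by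
            refine integral_mono ((iN hN).const_mul _) (j1.add j2) fun x => ?_
            have hw := (inv_ell_pos N x).le
            have : b ^ 2 ≤ (1 + s) * u x ^ 2 + (1 + 1/s) * (u x - b) ^ 2 := by
              have e : (1 + s) * u x ^ 2 + (1 + 1/s) * (u x - b) ^ 2 - b ^ 2 = (s * u x + (u x - b)) ^ 2 / s := by
                field_simp; ring
              have : 0 ≤ (s * u x + (u x - b)) ^ 2 / s := by positivity
              linarith
            have := mul_le_mul_of_nonneg_right this hw
            show b ^ 2 * (1 / ell x) ^ N ≤ (1 + s) * (u x ^ 2 * (1 / ell x) ^ N) + (1 + 1/s) * ((u x - b) ^ 2 * (1 / ell x) ^ N)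
            linarith
        _ = (1 + s) * Q + (1 + 1 / s) * ∫ x, (u x - b) ^ 2 * (1 / ell x) ^ N := by
            rw [integral_add j1 j2, integral_const_mul, integral_const_mul]
        _ ≤ _ := by
            have : ∫ x, (u x - b) ^ 2 * (1 / ell x) ^ N ≤ C1 * s ^ 2 := h2.trans (by gcongr)
            have h9 : 0 ≤ 1 + 1 / s := by positivity
            linarith [mul_le_mul_of_nonneg_left this h9]
    have e5 : (1 + 1 / s) * (C1 * s ^ 2) = (s ^ 2 + s) * C1 := by field_simp
    rw [e5] at lb
    calc A * MM N * (max 0 ((1 - C2 * s) / MM N)) ^ (2 / qq N) ≤ A * MM N * b ^ 2 := by gcongr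
      _ = A * (b ^ 2 * MM N) := by ring
      _ ≤ A * ((1 + s) * Q + (s ^ 2 + s) * C1) := by gcongr
      _ = (1 + s) * (A * Q) + A * ((s ^ 2 + s) * C1) := by ring
      _ ≤ _ := by gcongr
  have t1 : Continuous (fun s : ℝ => A * MM N * (max 0 ((1 - C2 * s) / MM N)) ^ (2 / qq N)) := by
    refine continuous_const.mul (Continuous.rpow_const (by fun_prop) fun x => Or.inr hp.le)
  have t2 : Continuous (fun s : ℝ => (1 + s) * (SS N + c * s ^ 2 / 2) + A * ((s ^ 2 + s) * C1)) := by fun_prop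
  have := le_of_tendsto_of_tendsto ((t1.tendsto 0).mono_left (nhdsWithin_le_nhds (s := Set.Ioi 0)))
    ((t2.tendsto 0).mono_left (nhdsWithin_le_nhds (s := Set.Ioi 0))) (by
      filter_upwards [Ioc_mem_nhdsGT one_pos] with s hs using main s hs.1 hs.2)
  simp only [mul_zero, sub_zero] at this
  rw [max_eq_right (by positivity)] at this
  simpa using this

lemma GU {N : ℕ} (hN : 3 ≤ N) : 0 < ∫ x : EE N, ‖gradient UU x‖ ^ 2 ∧
    ∫ x : EE N, ‖gradient UU x‖ ^ 2 ≤ (N * ((N:ℝ) - 2)) * MM N := by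
  obtain ⟨K, hK, hv⟩ := vlem hN
  have hz : Adm (fun _ : EE N => (0:ℝ)) := ⟨contDiff_const, HasCompactSupport.zero⟩
  have h3 : (3:ℝ) ≤ N := by exact_mod_cast hN
  have h := (hv _ hz 1 ((N * ((N:ℝ) - 2)) * MM N) (by simp [MM, gradient])).1
  have e : ∀ x : EE N, ‖gradient (fun y : EE N => (0:ℝ) * UU y) x - (1:ℝ) • gradient UU x‖ ^ 2 = ‖gradient UU x‖ ^ 2 := by
    intro x
    have : gradient (fun y : EE N => (0:ℝ) * UU y) x = 0 := by simp [gradient]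
    rw [this, zero_sub, norm_neg, one_smul]
  simp only [e] at h
  refine ⟨?_, h.2⟩
  have hcont : Continuous (fun x : EE N => ‖gradient UU x‖ ^ 2) := (continuous_grad UU_cd).norm.pow 2
  refine (integral_pos_iff_support_of_nonneg (fun x => sq_nonneg _) h.1).2 ?_
  haveI : Nonempty (Fin N) := ⟨⟨0, by omega⟩⟩
  obtain ⟨x, hx⟩ := exists_ne (0 : EE N)
  refine hcont.isOpen_support.measure_pos volume ⟨x, ?_⟩
  have hg := (hasGrad_VV (s := 1) one_pos x (PP_one_pos x)).gradient
  have hU := UU_pos x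
  have hP := PP_one_pos x
  rw [Function.mem_support]
  change gradient UU x = _ at hg
  rw [hg]
  have hk : 0 < kk N := by unfold kk; linarith
  have : 0 < 2 * kk N * VV 1 1 1 0 x / PP 1 1 0 x := by
    have : 0 < VV 1 1 1 0 x := hU
    positivity
  simp [hx, this.ne', hk.ne', hP.ne']

lemma dist_le {N : ℕ} (φ : EE N → ℝ) (z : ℝ) {t : ℝ} (ht : 0 < t) (y : EE N) :
    distToExtremalsSq N φ ≤ ∫ x, ‖gradient φ x - z • gradient (sobolevBubble N t y) x‖ ^ 2 := by
  refine ciInf_le (f := fun p : ℝ × {t : ℝ // 0 < t} × EuclideanSpace ℝ (Fin N) =>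
    ∫ x, ‖gradient φ x - p.1 • gradient (sobolevBubble N p.2.1.1 p.2.2) x‖ ^ 2) ⟨0, ?_⟩ (z, ⟨t, ht⟩, y)
  rintro _ ⟨p, rfl⟩
  exact integral_nonneg fun x => sq_nonneg _

lemma stab {N : ℕ} (hN : 3 ≤ N) : ∃ K : ℝ, 0 < K ∧ ∀ φ : EE N → ℝ, Adm φ →
    distToExtremalsSq N φ ≤ K * ((∫ x, ‖gradient φ x‖ ^ 2) - SS N * (∫ x, |φ x| ^ (qq N)) ^ (2 / qq N)) := by
  obtain ⟨c, hc, hcore⟩ := core hN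
  obtain ⟨C1, hC1, hcl⟩ := close hN
  have hq := qq_gt hN
  refine ⟨C1 / c + 1, by positivity, fun φ hφ => ?_⟩
  have h0 : 0 ≤ ∫ x, |φ x| ^ (qq N) := integral_nonneg fun x => Real.rpow_nonneg (abs_nonneg _) _
  have hSl := SS_le hN hφ
  rcases eq_or_lt_of_le h0 with h | h
  · rw [← h, Real.zero_rpow (by positivity), mul_zero, sub_zero]
    have d := dist_le φ 0 one_pos 0
    simp only [zero_smul, sub_zero] at d
    have : 0 ≤ ∫ x, ‖gradient φ x‖ ^ 2 := integral_nonneg fun x => sq_nonneg _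
    have : 0 ≤ C1 / c * ∫ x, ‖gradient φ x‖ ^ 2 := by positivity
    linarith
  · obtain ⟨a, ha, h1, h2, h3⟩ := normalz hN hφ h
    set J := (∫ x, |φ x| ^ (qq N)) ^ (2 / qq N) with hJ
    set G := ∫ x, ‖gradient φ x‖ ^ 2 with hG
    have hJ0 : 0 < J := Real.rpow_pos_of_pos h _
    have step : ∀ η : ℝ, 0 < η → a ^ 2 * distToExtremalsSq N φ ≤ C1 / c * (a ^ 2 * G - SS N) + η := by
      intro η hη
      obtain ⟨t, ht, y, u, hu, hu1, hz, hD⟩ := hcore _ (hφ.cmul a) h2 (η * c / C1) (by positivity)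
      obtain ⟨b, hb, -⟩ := hcl u hu
      rw [← hz b] at hb
      have d := dist_le φ (b / a) ht y
      have e : ∀ x, ‖gradient (fun y => a * φ y) x - b • gradient (sobolevBubble N t y) x‖ ^ 2 =
          a ^ 2 * ‖gradient φ x - (b / a) • gradient (sobolevBubble N t y) x‖ ^ 2 := by
        intro x
        rw [grad_cmul (hφ.1.differentiable (by simp)), show b = a * (b / a) by field_simp, ← smul_smul, ← smul_sub,
          norm_smul, mul_pow, Real.norm_eq_abs, sq_abs]
        simp only [mul_div_cancel_left₀ _ ha.ne']
      simp only [e] at hb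
      rw [integral_const_mul] at hb
      rw [h3] at hD
      have hDc : DD u ≤ (a ^ 2 * G - SS N + η * c / C1) / c := by rw [le_div_iff₀ hc]; linarith
      calc _ ≤ _ := mul_le_mul_of_nonneg_left d (sq_nonneg a)
        _ ≤ _ := hb
        _ ≤ C1 * ((a ^ 2 * G - SS N + η * c / C1) / c) := mul_le_mul_of_nonneg_left hDc hC1.le
        _ = _ := by field_simp
    have s2 := le_of_forall_pos_le_add step
    have s3 := mul_le_mul_of_nonneg_left s2 hJ0.le
    have e1 : J * (a ^ 2 * distToExtremalsSq N φ) = distToExtremalsSq N φ := by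
      rw [show J * (a ^ 2 * distToExtremalsSq N φ) = (a ^ 2 * J) * distToExtremalsSq N φ by ring, h1, one_mul]
    have e2 : J * (C1 / c * (a ^ 2 * G - SS N)) = C1 / c * (G - SS N * J) := by
      rw [show J * (C1 / c * (a ^ 2 * G - SS N)) = C1 / c * ((a ^ 2 * J) * G - SS N * J) by ring, h1, one_mul]
    rw [e1, e2] at s3
    nlinarith

theorem bianchi_egnell_stability (N : ℕ) (hN : 3 ≤ N) :
    ∃ α : ℝ, 0 < α ∧
      ∀ φ : EuclideanSpace ℝ (Fin N) → ℝ,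
        ContDiff ℝ (⊤ : ℕ∞) φ → HasCompactSupport φ →
        (LqNorm N (2 * N / ((N : ℝ) - 2)) (sobolevBubble N 1 0) /
              gradL2 N (sobolevBubble N 1 0)) ^ 2 * gradL2 N φ ^ 2 -
            LqNorm N (2 * N / ((N : ℝ) - 2)) φ ^ 2 ≥
          α * distToExtremalsSq N φ := by
  obtain ⟨K, hK, hst⟩ := stab hN
  obtain ⟨G0, G1⟩ := GU hN
  have hM := MM_pos hN
  have hlow := S_low hN
  have hq := qq_gt hN
  have hsq : ∀ f : EE N → ℝ, gradL2 N f ^ 2 = ∫ x, ‖gradient f x‖ ^ 2 := fun f =>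
    Real.sq_sqrt (integral_nonneg fun x => sq_nonneg _)
  have hlq : ∀ f : EE N → ℝ, LqNorm N (2 * N / ((N : ℝ) - 2)) f ^ 2 = (∫ x, |f x| ^ (qq N)) ^ (2 / qq N) := by
    intro f
    have h0 : 0 ≤ ∫ x, |f x| ^ (qq N) := integral_nonneg fun x => Real.rpow_nonneg (abs_nonneg _) _
    change ((∫ x, |f x| ^ (qq N)) ^ (1 / qq N)) ^ 2 = _
    rw [← Real.rpow_natCast, ← Real.rpow_mul h0]
    congr 1; push_cast; ring
  have hmU : ∫ x : EE N, |UU x| ^ (qq N) = MM N := by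
    unfold MM; congr 1; ext x; rw [abs_of_pos (UU_pos x), UU_q hN]
  rw [← UU_bubble]
  rw [div_pow, hsq, hlq, hmU]
  set g := ∫ x : EE N, ‖gradient UU x‖ ^ 2 with hg
  set m := MM N ^ (2 / qq N) with hm
  have hm0 : 0 < m := Real.rpow_pos_of_pos hM _
  have hSm : g ≤ SS N * m := by
    rw [Real.div_rpow zero_le_one hM.le, Real.one_rpow, mul_one_div, div_le_iff₀ hm0] at hlow
    exact G1.trans hlow
  refine ⟨m / g / K, by positivity, fun φ hφ hc => ?_⟩
  have hA : Adm φ := ⟨hφ.of_le (by exact_mod_cast le_top), hc⟩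
  have s := hst φ hA
  rw [hsq, hlq]
  set G := ∫ x, ‖gradient φ x‖ ^ 2
  set J := (∫ x, |φ x| ^ (qq N)) ^ (2 / qq N) with hJ
  have hJ0 : 0 ≤ J := Real.rpow_nonneg (integral_nonneg fun x => Real.rpow_nonneg (abs_nonneg _) _) _
  have s1 : m / g / K * distToExtremalsSq N φ ≤ m / g * (G - SS N * J) := by
    rw [div_mul_eq_mul_div, div_le_iff₀ hK]
    have := mul_le_mul_of_nonneg_left s (by positivity : 0 ≤ m / g)
    linarith
  have s2 : J ≤ m / g * (SS N * J) := by
    have : 1 ≤ m / g * SS N := by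
      rw [div_mul_eq_mul_div, le_div_iff₀ G0]; linarith
    nlinarith
  have : m / g * (G - SS N * J) = m / g * G - m / g * (SS N * J) := by ring
  linarith
end
end

section
/- Let N > 2 be a real number and let 1 < p < N; set p* = pN/(N−p). Then for every smooth compactly supported function φ : (0,∞) → ℝ one has (∫₀^∞ |φ(ρ)|^{p*} ρ^{N−1} dρ)^{1/p*} ≤ C · (∫₀^∞ |φ'(ρ)|^p ρ^{N−1} dρ)^{1/p}, where C = (∫₀^∞ F₁(ρ)^{p*} ρ^{N−1} dρ)^{1/p*} / (∫₀^∞ |F₁'(ρ)|^p ρ^{N−1} dρ)^{1/p} and F₁(ρ) = (1 + ρ^{p/(p−1)})^{−(N−p)/p}. -/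
open MeasureTheory

noncomputable section

/-- Bliss extremal `F₁(ρ) = (1 + ρ^{p/(p−1)})^{−(N−p)/p}`. -/
def blissExtremal (N p : ℝ) : ℝ → ℝ :=
  fun ρ => (1 + ρ ^ (p / (p - 1))) ^ (-(N - p) / p)

/-- Weighted `L^q((0,∞), ρ^{N−1} dρ)` norm. -/
def radialLqNorm (N q : ℝ) (φ : ℝ → ℝ) : ℝ :=
  (∫ ρ in Set.Ioi (0 : ℝ), |φ ρ| ^ q * ρ ^ (N - 1)) ^ (1 / q)

/-- Weighted `L^p` norm of the derivative, `(∫₀^∞ |φ'(ρ)|^p ρ^{N−1} dρ)^{1/p}`. -/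
def radialGradLpNorm (N p : ℝ) (φ : ℝ → ℝ) : ℝ :=
  (∫ ρ in Set.Ioi (0 : ℝ), |deriv φ ρ| ^ p * ρ ^ (N - 1)) ^ (1 / p)

theorem exists_transport (h : ℝ → ℝ) (hc : ContinuousOn h (Set.Ioi 0)) (hpos : ∀ y, 0 < y → 0 < h y)
    (r R : ℝ) (hr : 0 < r) (hrR : r < R) (F : ℝ → ℝ) (hF : Continuous F) (hF0 : ∀ x, 0 ≤ F x)
    (a b : ℝ) (hI : ∫ x in a..b, F x = ∫ y in r..R, h y) :
    ∃ τ τ' : ℝ → ℝ, (∀ x, HasDerivAt τ (τ' x) x) ∧ Continuous τ' ∧ τ a = r ∧ τ b = R ∧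
      ∀ x ∈ Set.Icc a b, r ≤ τ x ∧ τ x ≤ R ∧ h (τ x) * τ' x = F x ∧ 0 ≤ τ' x := by
  set H : ℝ → ℝ := fun y => h (max r (min y R)) with hH
  have hHc : Continuous H := by
    apply hc.comp_continuous (by fun_prop)
    intro y; exact lt_of_lt_of_le hr (le_max_left _ _)
  have hHpos : ∀ y, 0 < H y := fun y => hpos _ (lt_of_lt_of_le hr (le_max_left _ _))
  have hHin : ∀ y, r ≤ y → y ≤ R → H y = h y := by
    intro y h1 h2; simp [hH, min_eq_left h2, max_eq_right h1]
  set G : ℝ → ℝ := fun y => ∫ t in r..y, H t with hG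
  have hGd : ∀ y, HasDerivAt G (H y) y := fun y =>
    intervalIntegral.integral_hasDerivAt_right (hHc.intervalIntegrable _ _)
      hHc.stronglyMeasurable.stronglyMeasurableAtFilter hHc.continuousAt
  have hGc : Continuous G := continuous_iff_continuousAt.2 fun y => (hGd y).continuousAt
  have hGm : StrictMono G := strictMono_of_deriv_pos fun y => by
    rw [(hGd y).deriv]; exact hHpos y
  have hGR : ∀ y, R ≤ y → G y = G R + (y - R) * h R := by
    intro y hy
    have : G y = G R + ∫ t in R..y, H t := by
      simp only [hG]
      rw [intervalIntegral.integral_add_adjacent_intervals] <;> exact hHc.intervalIntegrable _ _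
    rw [this]
    congr 1
    have : ∫ t in R..y, H t = ∫ t in R..y, h R := by
      apply intervalIntegral.integral_congr
      intro t ht
      rw [Set.uIcc_of_le hy] at ht
      simp [hH, min_eq_right ht.1, max_eq_right hrR.le]
    rw [this]; simp
  have hGr : ∀ y, y ≤ r → G y = (y - r) * h r := by
    intro y hy
    have : ∫ t in r..y, H t = ∫ t in r..y, h r := by
      apply intervalIntegral.integral_congr
      intro t ht
      rw [Set.uIcc_of_ge hy] at ht
      simp [hH, min_eq_left (ht.2.trans hrR.le), max_eq_left ht.2]
    simp only [hG]
    rw [this]; simp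
  have hsurj : Function.Surjective G := by
    intro v
    have hR := hpos R (hr.trans hrR)
    have hr' := hpos r hr
    apply mem_range_of_exists_le_of_exists_ge hGc
    · refine ⟨min r (r + v / h r), ?_⟩
      rw [hGr _ (min_le_left _ _)]
      have : min r (r + v / h r) - r ≤ v / h r := by
        have := min_le_right r (r + v / h r); linarith
      calc _ ≤ v / h r * h r := by gcongr
        _ = v := by field_simp
    · refine ⟨max R (R + (v - G R) / h R), ?_⟩
      rw [hGR _ (le_max_left _ _)]
      have : (v - G R) / h R ≤ max R (R + (v - G R) / h R) - R := by
        have := le_max_right R (R + (v - G R) / h R); linarith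
      calc v = G R + (v - G R) / h R * h R := by field_simp; ring
        _ ≤ _ := by gcongr
  let e := hGm.orderIsoOfSurjective G hsurj
  have he : ∀ y, e y = G y := fun y => rfl
  have hTc : Continuous e.symm := e.symm.continuous
  have hGT : ∀ v, G (e.symm v) = v := fun v => e.apply_symm_apply v
  have hTG : ∀ v, e.symm (G v) = v := fun v => e.symm_apply_apply v
  have hTd : ∀ v, HasDerivAt e.symm (H (e.symm v))⁻¹ v := fun v =>
    HasDerivAt.of_local_left_inverse hTc.continuousAt (hGd _) (hHpos _).ne'
      (Filter.Eventually.of_forall hGT)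
  set A : ℝ → ℝ := fun x => ∫ t in a..x, F t with hA
  have hAd : ∀ y, HasDerivAt A (F y) y := fun y =>
    intervalIntegral.integral_hasDerivAt_right (hF.intervalIntegrable _ _)
      hF.stronglyMeasurable.stronglyMeasurableAtFilter hF.continuousAt
  have hAc : Continuous A := continuous_iff_continuousAt.2 fun y => (hAd y).continuousAt
  have hAm : Monotone A := monotone_of_deriv_nonneg (fun y => (hAd y).differentiableAt) fun y => by
    rw [(hAd y).deriv]; exact hF0 y
  have ha : e.symm (A a) = r := by
    have : A a = G r := by simp [hA, hG]
    rw [this, hTG]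
  have hb : e.symm (A b) = R := by
    have : A b = G R := by
      simp only [hA, hG]
      rw [hI]
      apply intervalIntegral.integral_congr
      intro t ht
      rw [Set.uIcc_of_le hrR.le] at ht
      exact (hHin t ht.1 ht.2).symm
    rw [this, hTG]
  refine ⟨fun x => e.symm (A x), fun x => (H (e.symm (A x)))⁻¹ * F x,
    fun x => (hTd (A x)).comp x (hAd x), ?_, ha, hb, ?_⟩
  · exact ((hHc.comp (hTc.comp hAc)).inv₀ (fun x => (hHpos _).ne')).mul hF
  · intro x hx
    have h1 : r ≤ e.symm (A x) := by rw [← ha]; exact e.symm.monotone (hAm hx.1)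
    have h2 : e.symm (A x) ≤ R := by rw [← hb]; exact e.symm.monotone (hAm hx.2)
    refine ⟨h1, h2, ?_, mul_nonneg (inv_nonneg.2 (hHpos _).le) (hF0 x)⟩
    rw [← hHin _ h1 h2]
    have := (hHpos (e.symm (A x))).ne'
    field_simp

theorem amgm_pt (N q s κ x t d v W : ℝ) (hN : 2 < N) (hs : 0 < s) (hq : 0 < q) (hsq : s + q / N = q)
    (hκ : 0 < κ) (hx : 0 < x) (ht : 0 < t) (hd : 0 ≤ d) (hv : 0 ≤ v) (hW : 0 < W)
    (he : t ^ (N - 1) * W ^ (-N) * d = κ * v ^ q * x ^ (N - 1)) :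
    W * (κ * v ^ q * x ^ (N - 1)) ≤
      κ ^ (1 - 1 / N) / N * (v ^ s * ((N - 1) * x ^ (N - 2) * t + x ^ (N - 1) * d)) := by
  rcases hv.eq_or_lt with rfl | hv
  · simp [Real.zero_rpow hs.ne', Real.zero_rpow hq.ne']
  have hN0 : 0 < N := by linarith
  have hxx : x ^ (N - 1) = x ^ (N - 2) * x := by
    rw [← Real.rpow_add_one hx.ne']; congr 1; ring
  have key : d * (t / x) ^ (N - 1) = κ * v ^ q * W ^ N := by
    rw [Real.div_rpow ht.le hx.le]
    rw [Real.rpow_neg hW.le] at he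
    have h1 : 0 < x ^ (N - 1) := by positivity
    have h2 : 0 < W ^ N := by positivity
    field_simp at he ⊢
    linarith
  have am := Real.geom_mean_le_arith_mean2_weighted (w₁ := 1 / N) (w₂ := 1 - 1 / N) (p₁ := d) (p₂ := t / x)
    (by positivity) (by rw [sub_nonneg, div_le_one hN0]; linarith) hd (by positivity) (by ring)
  have e1 : d ^ (1 / N) * (t / x) ^ (1 - 1 / N) = κ ^ (1 / N) * v ^ (q / N) * W := by
    have : (t / x) ^ (1 - 1 / N) = ((t / x) ^ (N - 1)) ^ (1 / N) := by
      rw [← Real.rpow_mul (by positivity)]; congr 1; field_simp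
    rw [this, ← Real.mul_rpow hd (by positivity), key, Real.mul_rpow (by positivity) (by positivity),
      Real.mul_rpow (by positivity) (by positivity), ← Real.rpow_mul hv.le, ← Real.rpow_mul hW.le]
    congr 2
    · congr 1; ring
    · rw [mul_one_div_cancel hN0.ne', Real.rpow_one]
  rw [e1] at am
  have e2 : κ = κ ^ (1 - 1 / N) * κ ^ (1 / N) := by
    rw [← Real.rpow_add hκ]; simp
  have e3 : v ^ q = v ^ s * v ^ (q / N) := by
    rw [← Real.rpow_add hv, hsq]
  calc W * (κ * v ^ q * x ^ (N - 1))
      = κ ^ (1 - 1 / N) * v ^ s * x ^ (N - 1) * (κ ^ (1 / N) * v ^ (q / N) * W) := by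
        rw [e3]; nth_rw 1 [e2]; ring
    _ ≤ κ ^ (1 - 1 / N) * v ^ s * x ^ (N - 1) * (1 / N * d + (1 - 1 / N) * (t / x)) := by
        gcongr
    _ = _ := by
        rw [hxx]; field_simp; ring

theorem cont_memLp (f : ℝ → ℝ) (hf : Continuous f) (a b : ℝ) (P : ENNReal) :
    MemLp f P (volume.restrict (Set.Ioc a b)) := by
  obtain ⟨C, hC⟩ := (isCompact_Icc (a := a) (b := b)).exists_bound_of_continuousOn hf.continuousOn
  refine MemLp.of_bound hf.aestronglyMeasurable C ?_
  filter_upwards [ae_restrict_mem measurableSet_Ioc] with x hx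
  exact hC x ⟨hx.1.le, hx.2⟩

theorem holder_pt (N p P q s a b : ℝ) (hp : p.HolderConjugate P) (hN : 2 < N) (ha : 0 < a) (hab : a < b)
    (hs : 1 < s) (hsP : (s - 1) * P = q) (f f' τ : ℝ → ℝ) (hf : Continuous f)
    (hf' : Continuous f') (hτ : Continuous τ) (hτ0 : ∀ x ∈ Set.Icc a b, 0 ≤ τ x) :
    ∫ x in a..b, |f x| ^ (s - 1) * |f' x| * (x ^ (N - 1) * τ x) ≤
      (∫ x in a..b, |f' x| ^ p * x ^ (N - 1)) ^ (1 / p) *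
      (∫ x in a..b, τ x ^ P * (|f x| ^ q * x ^ (N - 1))) ^ (1 / P) := by
  have hp0 := hp.pos
  have hP0 := hp.symm.pos
  have hpP : 1 / p + 1 / P = 1 := by simpa using hp.inv_add_inv_eq_one
  simp only [intervalIntegral.integral_of_le hab.le]
  have := integral_mul_le_Lp_mul_Lq_of_nonneg (μ := volume.restrict (Set.Ioc a b)) hp
    (f := fun x => |f' x| * x ^ ((N - 1) / p))
    (g := fun x => |f x| ^ (s - 1) * τ x * x ^ ((N - 1) / P)) ?_ ?_ ?_ ?_
  · refine le_trans (le_of_eq ?_) (this.trans (le_of_eq ?_))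
    · apply setIntegral_congr_fun measurableSet_Ioc
      intro x hx
      have hx0 : 0 < x := ha.trans hx.1
      have : x ^ (N - 1) = x ^ ((N - 1) / p) * x ^ ((N - 1) / P) := by
        rw [← Real.rpow_add hx0]; congr 1
        calc N - 1 = (N - 1) * (1 / p + 1 / P) := by rw [hpP, mul_one]
          _ = _ := by ring
      simp only [this]; ring
    · congr 2
      · apply setIntegral_congr_fun measurableSet_Ioc
        intro x hx
        have hx0 : 0 < x := ha.trans hx.1
        simp only
        rw [Real.mul_rpow (by positivity) (by positivity), ← Real.rpow_mul hx0.le,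
          div_mul_cancel₀ _ hp0.ne']
      · apply setIntegral_congr_fun measurableSet_Ioc
        intro x hx
        have hx0 : 0 < x := ha.trans hx.1
        have ht := hτ0 x ⟨hx.1.le, hx.2⟩
        simp only
        rw [Real.mul_rpow (by positivity) (by positivity), Real.mul_rpow (by positivity) ht,
          ← Real.rpow_mul hx0.le, ← Real.rpow_mul (abs_nonneg _), hsP,
          div_mul_cancel₀ _ hP0.ne']
        ring
  · filter_upwards [ae_restrict_mem measurableSet_Ioc] with x hx
    have hx0 : 0 < x := ha.trans hx.1
    simp only [Pi.zero_apply]; positivity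
  · filter_upwards [ae_restrict_mem measurableSet_Ioc] with x hx
    have hx0 : 0 < x := ha.trans hx.1
    have ht := hτ0 x ⟨hx.1.le, hx.2⟩
    simp only [Pi.zero_apply]; positivity
  · apply cont_memLp
    exact hf'.abs.mul (continuous_id.rpow_const fun x => Or.inr (by apply div_nonneg <;> linarith))
  · apply cont_memLp
    exact ((hf.abs.rpow_const fun x => Or.inr (by linarith)).mul hτ).mul
      (continuous_id.rpow_const fun x => Or.inr (by apply div_nonneg <;> linarith))

theorem ibp_bound (N s a b : ℝ) (hN : 2 < N) (ha : 0 < a) (hab : a < b)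
    (hs : 1 < s) (f τ τ' : ℝ → ℝ) (hf : ContDiff ℝ 1 f) (hfa : f a = 0) (hfb : f b = 0)
    (hτ : ∀ x, HasDerivAt τ (τ' x) x) (hτ' : Continuous τ') (hτ0 : ∀ x ∈ Set.Icc a b, 0 ≤ τ x) :
    ∫ x in a..b, |f x| ^ s * ((N - 1) * x ^ (N - 2) * τ x + x ^ (N - 1) * τ' x) ≤
      s * ∫ x in a..b, |f x| ^ (s - 1) * |deriv f x| * (x ^ (N - 1) * τ x) := by
  have hτc : Continuous τ := continuous_iff_continuousAt.2 fun y => (hτ y).continuousAt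
  have hu : ContDiff ℝ 1 (fun x => |f x| ^ s) := by
    simpa [Real.norm_eq_abs] using hf.norm_rpow hs
  have hx1 : Continuous fun x : ℝ => x ^ (N - 1) :=
    continuous_id.rpow_const fun x => Or.inr (by linarith)
  have hx2 : Continuous fun x : ℝ => x ^ (N - 2) :=
    continuous_id.rpow_const fun x => Or.inr (by linarith)
  have hu' : Continuous (deriv (fun x => |f x| ^ s)) := hu.continuous_deriv le_rfl
  have hf' : Continuous (deriv f) := hf.continuous_deriv le_rfl
  have := intervalIntegral.integral_mul_deriv_eq_deriv_mul (a := a) (b := b)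
    (u := fun x => |f x| ^ s) (u' := deriv (fun x => |f x| ^ s))
    (v := fun x => x ^ (N - 1) * τ x)
    (v' := fun x => (N - 1) * x ^ (N - 2) * τ x + x ^ (N - 1) * τ' x)
    (fun x _ => (hu.differentiable one_ne_zero x).hasDerivAt) ?_
    (hu'.intervalIntegrable _ _) ?_
  · rw [this]
    simp only [hfa, hfb, abs_zero, Real.zero_rpow (by linarith : s ≠ 0), zero_mul, sub_zero, zero_sub]
    rw [← intervalIntegral.integral_neg, ← intervalIntegral.integral_const_mul]
    apply intervalIntegral.integral_mono_on hab.le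
    · exact ((hu'.mul (hx1.mul hτc)).neg).intervalIntegrable _ _
    · exact (continuous_const.mul (((hf.continuous.abs.rpow_const fun x => Or.inr (by linarith)).mul
        hf'.abs).mul (hx1.mul hτc))).intervalIntegrable _ _
    · intro x hx
      have hx0 : 0 < x := ha.trans_le hx.1
      have ht := hτ0 x hx
      have hd : deriv (fun x => |f x| ^ s) x = s * |f x| ^ (s - 2) * f x * deriv f x :=
        ((hasDerivAt_abs_rpow (f x) hs).comp x (hf.differentiable one_ne_zero x).hasDerivAt).deriv
      have hle : -deriv (fun x => |f x| ^ s) x ≤ s * (|f x| ^ (s - 1) * |deriv f x|) := by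
        refine (neg_le_abs _).trans (le_of_eq ?_)
        rw [hd, abs_mul, abs_mul, abs_mul, abs_of_pos (by linarith : 0 < s),
          abs_of_nonneg (by positivity : 0 ≤ |f x| ^ (s - 2))]
        rcases eq_or_ne (f x) 0 with h0 | h0
        · simp [h0, Real.zero_rpow (by linarith : s - 1 ≠ 0)]
        · have : |f x| ^ (s - 1) = |f x| ^ (s - 2) * |f x| := by
            rw [← Real.rpow_add_one (abs_pos.2 h0).ne']; congr 1; ring
          rw [this]; ring
      calc _ = -deriv (fun x => |f x| ^ s) x * (x ^ (N - 1) * τ x) := by ring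
        _ ≤ s * (|f x| ^ (s - 1) * |deriv f x|) * (x ^ (N - 1) * τ x) := by gcongr
        _ = _ := by ring
  · intro x hx
    rw [Set.uIcc_of_le hab.le] at hx
    have hx0 : 0 < x := ha.trans_le hx.1
    have := (Real.hasDerivAt_rpow_const (x := x) (p := N - 1) (Or.inl hx0.ne')).mul (hτ x)
    convert this using 3
    congr 1; ring_nf
  · exact (((continuous_const.mul hx2).mul hτc).add (hx1.mul hτ')).intervalIntegrable _ _

def bh (N P : ℝ) : ℝ → ℝ := fun y => y ^ (N - 1) * (1 + y ^ P) ^ (-N)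

theorem bh_cont (N P : ℝ) (hN : 2 < N) (hP : 1 < P) : ContinuousOn (bh N P) (Set.Ici 0) := by
  unfold bh
  refine ContinuousOn.mul ?_ (ContinuousOn.rpow_const ?_ ?_)
  · exact (continuous_id.rpow_const fun x => Or.inr (by linarith)).continuousOn
  · exact (continuous_const.add (continuous_id.rpow_const fun x => Or.inr (by linarith))).continuousOn
  · intro x hx
    have : 0 ≤ x ^ P := Real.rpow_nonneg hx P
    left; positivity

theorem bh_pos (N P : ℝ) (y : ℝ) (hy : 0 < y) : 0 < bh N P y := by
  unfold bh; positivity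

theorem int_aux (g : ℝ → ℝ) (hg : ContinuousOn g (Set.Ici 0)) (e : ℝ) (he : e < -1)
    (hb : ∀ y, 1 < y → |g y| ≤ y ^ e) : IntegrableOn g (Set.Ioi 0) := by
  rw [← Set.Ioc_union_Ioi_eq_Ioi (zero_le_one (α := ℝ))]
  apply IntegrableOn.union
  · exact ((hg.mono Set.Icc_subset_Ici_self).integrableOn_Icc).mono_set Set.Ioc_subset_Icc_self
  · refine Integrable.mono' (integrableOn_Ioi_rpow_of_lt he zero_lt_one) ?_ ?_
    · exact (hg.mono (Set.Ioi_subset_Ici zero_le_one)).aestronglyMeasurable measurableSet_Ioi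
    · filter_upwards [ae_restrict_mem measurableSet_Ioi] with x hx
      exact hb x hx

theorem bk_le (N P : ℝ) (hN : 2 < N) (hP : 1 < P) (y : ℝ) (hy : 0 < y) :
    y ^ P * bh N P y ≤ y ^ (N - 1 - P * (N - 1)) := by
  unfold bh
  have : (1 + y ^ P) ^ (-N) ≤ (y ^ P) ^ (-N) :=
    Real.rpow_le_rpow_of_nonpos (by positivity) (by linarith) (by linarith)
  calc y ^ P * (y ^ (N - 1) * (1 + y ^ P) ^ (-N)) ≤ y ^ P * (y ^ (N - 1) * (y ^ P) ^ (-N)) := by gcongr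
    _ = _ := by
      rw [← Real.rpow_mul hy.le, ← Real.rpow_add hy, ← Real.rpow_add hy]; congr 1; ring

theorem bk_cont (N P : ℝ) (hN : 2 < N) (hP : 1 < P) :
    ContinuousOn (fun y => y ^ P * bh N P y) (Set.Ici 0) :=
  (continuous_id.rpow_const fun x => Or.inr (by linarith)).continuousOn.mul (bh_cont N P hN hP)

theorem bk_int (N P : ℝ) (hN : 2 < N) (hP : 1 < P) (hNP : N < P * (N - 1)) :
    IntegrableOn (fun y => y ^ P * bh N P y) (Set.Ioi 0) := by
  apply int_aux _ (bk_cont N P hN hP) (N - 1 - P * (N - 1)) (by linarith)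
  intro y hy
  have hy0 : 0 < y := by linarith
  rw [abs_of_nonneg (mul_nonneg (by positivity) (bh_pos N P y hy0).le)]
  exact bk_le N P hN hP y hy0

theorem bh_int (N P : ℝ) (hN : 2 < N) (hP : 1 < P) (hNP : N < P * (N - 1)) :
    IntegrableOn (bh N P) (Set.Ioi 0) := by
  apply int_aux _ (bh_cont N P hN hP) (N - 1 - P * (N - 1)) (by linarith)
  intro y hy
  have hy0 : 0 < y := by linarith
  have := bh_pos N P y hy0
  rw [abs_of_nonneg this.le]
  refine le_trans ?_ (bk_le N P hN hP y hy0)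
  have : 1 ≤ y ^ P := Real.one_le_rpow hy.le (by linarith)
  nlinarith

theorem bk_pos (N P : ℝ) (hN : 2 < N) (hP : 1 < P) (hNP : N < P * (N - 1)) :
    0 < ∫ y in Set.Ioi 0, y ^ P * bh N P y := by
  rw [setIntegral_pos_iff_support_of_nonneg_ae _ (bk_int N P hN hP hNP)]
  · have : Set.Ioi 0 ⊆ (Function.support fun y => y ^ P * bh N P y) ∩ Set.Ioi 0 := by
      intro y hy
      refine ⟨?_, hy⟩
      have := bh_pos N P y hy
      have h0 : 0 < y := hy
      simp only [Function.mem_support]; positivity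
    exact lt_of_lt_of_le (by simp) (measure_mono this)
  · filter_upwards [ae_restrict_mem measurableSet_Ioi] with y hy
    have := bh_pos N P y hy
    have h0 : 0 < y := hy
    simp only [Pi.zero_apply]; positivity

theorem bh_identity (N P : ℝ) (hN : 2 < N) (hP : 1 < P) (hNP : N < P * (N - 1)) :
    N * ((∫ y in Set.Ioi 0, bh N P y) + ∫ y in Set.Ioi 0, y ^ P * bh N P y) =
      (N - 1) * P * ∫ y in Set.Ioi 0, y ^ P * bh N P y := by
  have h1 := bh_int N P hN hP hNP
  have h2 := bk_int N P hN hP hNP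
  have h3 : IntegrableOn (fun y => bh N P y + y ^ P * bh N P y) (Set.Ioi 0) := h1.add h2
  have := integral_Ioi_of_hasDerivAt_of_tendsto (a := 0) (m := 0)
    (f := fun y : ℝ => y ^ N * (1 + y ^ P) ^ (-(N - 1)))
    (f' := fun y => N * (bh N P y + y ^ P * bh N P y) - (N - 1) * P * (y ^ P * bh N P y))
    ?_ ?_ ?_ ?_
  · rw [integral_sub (h3.const_mul N) (h2.const_mul _), integral_const_mul, integral_const_mul,
      integral_add h1 h2, Real.zero_rpow (by linarith)] at this
    linarith
  · have : ContinuousOn (fun y : ℝ => y ^ N * (1 + y ^ P) ^ (-(N - 1))) (Set.Ici 0) := by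
      refine ContinuousOn.mul ?_ (ContinuousOn.rpow_const ?_ ?_)
      · exact (continuous_id.rpow_const fun x => Or.inr (by linarith)).continuousOn
      · exact (continuous_const.add (continuous_id.rpow_const fun x => Or.inr (by linarith))).continuousOn
      · intro x hx
        have : 0 ≤ x ^ P := Real.rpow_nonneg hx P
        left; positivity
    exact this 0 Set.self_mem_Ici
  · intro y hy
    have hy : 0 < y := hy
    have hW : 0 < 1 + y ^ P := by positivity
    have d1 := Real.hasDerivAt_rpow_const (x := y) (p := N) (Or.inl hy.ne')
    have d2 := ((Real.hasDerivAt_rpow_const (x := y) (p := P) (Or.inl hy.ne')).const_add 1).rpow_const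
      (p := -(N - 1)) (Or.inl hW.ne')
    refine (d1.mul d2).congr_deriv ?_
    unfold bh
    have e1 : (1 + y ^ P) ^ (-(N - 1)) = (1 + y ^ P) ^ (-N) * (1 + y ^ P) := by
      rw [← Real.rpow_add_one hW.ne']; congr 1; ring
    have e2 : (1 + y ^ P) ^ (-(N - 1) - 1) = (1 + y ^ P) ^ (-N) := by congr 1; ring
    have e3 : y ^ N = y ^ (N - 1) * y := by
      rw [← Real.rpow_add_one hy.ne']; congr 1; ring
    have e4 : y ^ P = y ^ (P - 1) * y := by
      rw [← Real.rpow_add_one hy.ne']; congr 1; ring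
    rw [e1, e2, e3]
    generalize (1 + y ^ P) ^ (-N) = w
    rw [e4]
    ring
  · exact (h3.const_mul N).sub (h2.const_mul _)
  · have ht := tendsto_rpow_neg_atTop (y := P * (N - 1) - N) (by linarith)
    refine squeeze_zero' ?_ ?_ ht
    · filter_upwards [Filter.eventually_gt_atTop 0] with y hy
      positivity
    · filter_upwards [Filter.eventually_gt_atTop 0] with y hy
      have : (1 + y ^ P) ^ (-(N - 1)) ≤ (y ^ P) ^ (-(N - 1)) :=
        Real.rpow_le_rpow_of_nonpos (by positivity) (by linarith) (by linarith)
      calc y ^ N * (1 + y ^ P) ^ (-(N - 1)) ≤ y ^ N * (y ^ P) ^ (-(N - 1)) := by gcongr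
        _ = _ := by
          rw [← Real.rpow_mul hy.le, ← Real.rpow_add hy]; congr 1; ring

theorem core_bound (N p P q s a b r R : ℝ) (hN : 2 < N) (hp : p.HolderConjugate P)
    (hNP : N < P * (N - 1)) (hs : 1 < s) (hsP : (s - 1) * P = q) (hsq : s + q / N = q)
    (hq1 : 1 - 1 / N - 1 / P = 1 / q)
    (ha : 0 < a) (hab : a < b) (hr : 0 < r) (hrR : r < R)
    (f : ℝ → ℝ) (hf : ContDiff ℝ 1 f) (hfa : f a = 0) (hfb : f b = 0)
    (hI : 0 < ∫ x in a..b, |f x| ^ q * x ^ (N - 1)) :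
    ∫ y in r..R, (bh N P y + y ^ P * bh N P y) ≤
      s / N * ((∫ y in Set.Ioi 0, bh N P y) / (∫ x in a..b, |f x| ^ q * x ^ (N - 1))) ^ (1 / q) *
      (∫ x in a..b, |deriv f x| ^ p * x ^ (N - 1)) ^ (1 / p) *
      (∫ y in Set.Ioi 0, y ^ P * bh N P y) ^ (1 / P) := by
  have hP1 : 1 < P := hp.symm.lt
  have hP0 : 0 < P := by linarith
  have hp0 := hp.pos
  have hN0 : 0 < N := by linarith
  have hq0 : 0 < q := by rw [← hsP]; apply mul_pos <;> linarith
  have hbc : ContinuousOn (bh N P) (Set.Ioi 0) := (bh_cont N P hN hP1).mono Set.Ioi_subset_Ici_self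
  have hkc : ContinuousOn (fun y => y ^ P * bh N P y) (Set.Ioi 0) :=
    (bk_cont N P hN hP1).mono Set.Ioi_subset_Ici_self
  have hsub : Set.uIcc r R ⊆ Set.Ioi 0 := by
    rw [Set.uIcc_of_le hrR.le]; intro y hy; exact hr.trans_le hy.1
  set I := ∫ x in a..b, |f x| ^ q * x ^ (N - 1) with hIdef
  set m := ∫ y in r..R, bh N P y with hm
  have hm0 : 0 < m := by
    apply intervalIntegral.intervalIntegral_pos_of_pos_on
    · exact (hbc.mono hsub).intervalIntegrable
    · intro y hy; exact bh_pos N P y (hr.trans hy.1)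
    · exact hrR
  have hle : ∀ g : ℝ → ℝ, IntegrableOn g (Set.Ioi 0) → (∀ y, 0 < y → 0 ≤ g y) →
      ∫ y in r..R, g y ≤ ∫ y in Set.Ioi 0, g y := by
    intro g hg h0
    rw [intervalIntegral.integral_of_le hrR.le]
    apply setIntegral_mono_set hg
    · filter_upwards [ae_restrict_mem measurableSet_Ioi] with y hy using h0 y hy
    · exact Filter.Eventually.of_forall fun y hy => hr.trans hy.1
  have hmM : m ≤ ∫ y in Set.Ioi 0, bh N P y :=
    hle _ (bh_int N P hN hP1 hNP) fun y hy => (bh_pos N P y hy).le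
  have hkK : ∫ y in r..R, y ^ P * bh N P y ≤ ∫ y in Set.Ioi 0, y ^ P * bh N P y :=
    hle _ (bk_int N P hN hP1 hNP) fun y hy => mul_nonneg (by positivity) (bh_pos N P y hy).le
  have hk0 : 0 ≤ ∫ y in r..R, y ^ P * bh N P y := by
    apply intervalIntegral.integral_nonneg hrR.le
    intro y hy
    have hy : 0 < y := hr.trans_le hy.1
    exact mul_nonneg (by positivity) (bh_pos N P y hy).le
  set κ := m / I with hκdef
  have hκ : 0 < κ := div_pos hm0 hI
  have hx1 : Continuous fun x : ℝ => x ^ (N - 1) :=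
    continuous_id.rpow_const fun x => Or.inr (by linarith)
  have hx2 : Continuous fun x : ℝ => x ^ (N - 2) :=
    continuous_id.rpow_const fun x => Or.inr (by linarith)
  have hfq : Continuous fun x => |f x| ^ q := hf.continuous.abs.rpow_const fun x => Or.inr hq0.le
  have hfs : Continuous fun x => |f x| ^ s := hf.continuous.abs.rpow_const fun x => Or.inr (by linarith)
  have hmpos : ∀ x ∈ Set.Icc a b, max x 0 = x := fun x hx => max_eq_left (ha.le.trans hx.1)
  obtain ⟨τ, τ', hτ, hτ', hτa, hτb, hτp⟩ := exists_transport (bh N P) hbc (bh_pos N P) r R hr hrR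
    (fun x => κ * (|f x| ^ q * (max x 0) ^ (N - 1)))
    (continuous_const.mul (hfq.mul (hx1.comp (continuous_id.max continuous_const))))
    (fun x => by have : 0 ≤ max x 0 := le_max_right _ _
                 positivity) a b (by
      rw [intervalIntegral.integral_const_mul]
      have : ∫ x in a..b, |f x| ^ q * (max x 0) ^ (N - 1) = I := by
        apply intervalIntegral.integral_congr
        intro x hx
        rw [Set.uIcc_of_le hab.le] at hx
        simp only [hmpos x hx]
      rw [this, hκdef, div_mul_cancel₀ _ hI.ne'])
  have hτc : Continuous τ := continuous_iff_continuousAt.2 fun y => (hτ y).continuousAt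
  have hτpos : ∀ x ∈ Set.Icc a b, 0 < τ x := fun x hx => hr.trans_le (hτp x hx).1
  have heq : ∀ x ∈ Set.Icc a b, bh N P (τ x) * τ' x = κ * |f x| ^ q * x ^ (N - 1) := by
    intro x hx
    rw [(hτp x hx).2.2.1, hmpos x hx, mul_assoc]
  have cv : ∀ g : ℝ → ℝ, ContinuousOn g (Set.Ioi 0) →
      ∫ y in r..R, g y * bh N P y = ∫ x in a..b, g (τ x) * (κ * |f x| ^ q * x ^ (N - 1)) := by
    intro g hg
    rw [← hτa, ← hτb, ← intervalIntegral.integral_comp_mul_deriv' (f := τ) (f' := τ')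
      (fun x _ => hτ x) hτ'.continuousOn]
    · apply intervalIntegral.integral_congr
      intro x hx
      rw [Set.uIcc_of_le hab.le] at hx
      simp only [Function.comp]
      rw [← heq x hx]; ring
    · apply (hg.mul hbc).mono
      rw [Set.uIcc_of_le hab.le]
      rintro _ ⟨x, hx, rfl⟩
      exact hτpos x hx
  have hyP : Continuous fun y : ℝ => y ^ P := continuous_id.rpow_const fun x => Or.inr hP0.le
  have cv1 := cv (fun y => 1 + y ^ P) (continuous_const.add hyP).continuousOn
  have cv2 := cv (fun y => y ^ P) hyP.continuousOn
  have hτP : Continuous fun x => τ x ^ P := hyP.comp hτc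
  have st1 : ∫ x in a..b, (1 + τ x ^ P) * (κ * |f x| ^ q * x ^ (N - 1)) ≤
      ∫ x in a..b, κ ^ (1 - 1 / N) / N *
        (|f x| ^ s * ((N - 1) * x ^ (N - 2) * τ x + x ^ (N - 1) * τ' x)) := by
    apply intervalIntegral.integral_mono_on hab.le
    · exact ((continuous_const.add hτP).mul ((continuous_const.mul hfq).mul hx1)).intervalIntegrable _ _
    · exact (continuous_const.mul (hfs.mul (((continuous_const.mul hx2).mul hτc).add
        (hx1.mul hτ')))).intervalIntegrable _ _
    · intro x hx
      have ht := hτpos x hx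
      apply amgm_pt N q s κ x (τ x) (τ' x) |f x| (1 + τ x ^ P) hN (by linarith) hq0 hsq hκ
        (ha.trans_le hx.1) ht (hτp x hx).2.2.2 (abs_nonneg _) (by positivity)
      rw [← heq x hx]; rfl
  have st2 := ibp_bound N s a b hN ha hab hs f τ τ' hf hfa hfb hτ hτ' (fun x hx => (hτpos x hx).le)
  have st3 := holder_pt N p P q s a b hp hN ha hab hs hsP f (deriv f) τ hf.continuous
    (hf.continuous_deriv le_rfl) hτc (fun x hx => (hτpos x hx).le)
  set D := (∫ x in a..b, |deriv f x| ^ p * x ^ (N - 1)) ^ (1 / p) with hD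
  have hD0 : 0 ≤ D := by
    apply Real.rpow_nonneg
    apply intervalIntegral.integral_nonneg hab.le
    intro x hx
    have hx : 0 < x := ha.trans_le hx.1
    positivity
  set J := ∫ x in a..b, τ x ^ P * (|f x| ^ q * x ^ (N - 1)) with hJ
  have hJκ : ∫ y in r..R, y ^ P * bh N P y = κ * J := by
    rw [cv2, hJ, ← intervalIntegral.integral_const_mul]
    congr 1; ext x; ring
  have hJe : J = κ⁻¹ * ∫ y in r..R, y ^ P * bh N P y := by
    rw [hJκ]; field_simp
  have hJle : J ^ (1 / P) ≤ κ ^ (-(1 / P)) * (∫ y in Set.Ioi 0, y ^ P * bh N P y) ^ (1 / P) := by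
    rw [hJe, Real.mul_rpow (by positivity) hk0, Real.inv_rpow hκ.le, ← Real.rpow_neg hκ.le]
    gcongr
  set K := ∫ y in Set.Ioi 0, y ^ P * bh N P y with hK
  have hK0 : 0 ≤ K := hk0.trans hkK
  calc ∫ y in r..R, (bh N P y + y ^ P * bh N P y)
      = ∫ y in r..R, (1 + y ^ P) * bh N P y := by congr 1; ext y; ring
    _ ≤ κ ^ (1 - 1 / N) / N * (s * (D * (κ ^ (-(1 / P)) * K ^ (1 / P)))) := by
        rw [cv1]
        refine st1.trans ?_
        rw [intervalIntegral.integral_const_mul]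
        have h1 := mul_le_mul_of_nonneg_left hJle hD0
        have h2 := mul_le_mul_of_nonneg_left (st3.trans h1) (by linarith : 0 ≤ s)
        exact mul_le_mul_of_nonneg_left (st2.trans h2) (by positivity)
    _ = s / N * κ ^ (1 / q) * D * K ^ (1 / P) := by
        have : κ ^ (1 / q) = κ ^ (1 - 1 / N) * κ ^ (-(1 / P)) := by
          rw [← Real.rpow_add hκ, ← hq1]; congr 1
        rw [this]; ring
    _ ≤ _ := by
        have : 0 ≤ s := by linarith
        have hκM : κ ≤ (∫ y in Set.Ioi 0, bh N P y) / I := div_le_div_of_nonneg_right hmM hI.le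
        gcongr

theorem core_bound' (g : ℝ → ℝ) (hg : IntegrableOn g (Set.Ioi 0)) (B : ℝ)
    (h : ∀ r R, 0 < r → r < R → ∫ y in r..R, g y ≤ B) : ∫ y in Set.Ioi 0, g y ≤ B := by
  have h1 : ∀ R, 0 < R → ∫ y in (0:ℝ)..R, g y ≤ B := by
    intro R hR
    have hi : ∀ u v, 0 ≤ u → 0 ≤ v → IntervalIntegrable g volume u v := by
      intro u v hu hv
      rw [intervalIntegrable_iff]
      apply hg.mono_set
      intro y hy
      exact (le_min hu hv).trans_lt hy.1
    have hc : Filter.Tendsto (fun r => ∫ y in r..R, g y) (nhdsWithin 0 (Set.Ioi 0))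
        (nhds (∫ y in (0:ℝ)..R, g y)) := by
      have hii : IntegrableOn g (Set.uIcc 0 R) := by
        rw [Set.uIcc_of_le hR.le, integrableOn_Icc_iff_integrableOn_Ioc]
        exact hg.mono_set fun y hy => hy.1
      have := intervalIntegral.continuousOn_primitive_interval_left hii
      have h0 : ContinuousWithinAt (fun r => ∫ y in r..R, g y) (Set.uIcc 0 R) 0 := this 0 (by simp)
      refine Filter.Tendsto.mono_left h0 ?_
      rw [Set.uIcc_of_le hR.le]
      rw [nhdsWithin_le_iff]
      filter_upwards [Ioo_mem_nhdsGT hR] with x hx using ⟨hx.1.le, hx.2.le⟩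
    refine le_of_tendsto hc ?_
    filter_upwards [Ioo_mem_nhdsGT hR] with r hr using h r R hr.1 hr.2
  refine le_of_tendsto (intervalIntegral_tendsto_integral_Ioi 0 hg Filter.tendsto_id) ?_
  filter_upwards [Filter.eventually_gt_atTop 0] with R hR using h1 R hR

theorem bliss_pow (N p : ℝ) (hp1 : 1 < p) (hpN : p < N) (y : ℝ) (hy : 0 < y) :
    |blissExtremal N p y| ^ (p * N / (N - p)) * y ^ (N - 1) = bh N (p / (p - 1)) y := by
  unfold blissExtremal bh
  have hW : 0 < 1 + y ^ (p / (p - 1)) := by positivity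
  rw [abs_of_pos (by positivity), ← Real.rpow_mul hW.le, mul_comm]
  congr 2
  have : N - p ≠ 0 := by linarith
  field_simp

theorem bliss_deriv (N p : ℝ) (hp1 : 1 < p) (hpN : p < N) (y : ℝ) (hy : 0 < y) :
    |deriv (blissExtremal N p) y| ^ p * y ^ (N - 1) =
      ((N - p) / (p - 1)) ^ p * (y ^ (p / (p - 1)) * bh N (p / (p - 1)) y) := by
  have hp' : 0 < p - 1 := by linarith
  have hNp : 0 < N - p := by linarith
  have hW : 0 < 1 + y ^ (p / (p - 1)) := by positivity
  have d2 := ((Real.hasDerivAt_rpow_const (x := y) (p := p / (p - 1)) (Or.inl hy.ne')).const_add 1).rpow_const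
      (p := -(N - p) / p) (Or.inl hW.ne')
  have hd : deriv (blissExtremal N p) y =
      -((N - p) / (p - 1) * y ^ (1 / (p - 1)) * (1 + y ^ (p / (p - 1))) ^ (-N / p)) := by
    unfold blissExtremal
    rw [d2.deriv]
    have e1 : p / (p - 1) - 1 = 1 / (p - 1) := by field_simp; ring
    have e2 : -(N - p) / p - 1 = -N / p := by field_simp; ring
    rw [e1, e2]
    field_simp
  rw [hd, abs_neg, abs_of_nonneg (by positivity), Real.mul_rpow (by positivity) (by positivity),
    Real.mul_rpow (by positivity) (by positivity), ← Real.rpow_mul hy.le, ← Real.rpow_mul hW.le]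
  unfold bh
  have e3 : 1 / (p - 1) * p = p / (p - 1) := by ring
  have e4 : -N / p * p = -N := by field_simp
  rw [e3, e4]; ring

theorem sharp_sobolev_radial_continuous_dim (N p : ℝ) (hN : 2 < N)
    (hp1 : 1 < p) (hpN : p < N)
    (φ : ℝ → ℝ) (hφ_smooth : ContDiff ℝ (⊤ : ℕ∞) φ) (hφ_supp : HasCompactSupport φ)
    (hφ_pos : tsupport φ ⊆ Set.Ioi 0) :
    radialLqNorm N (p * N / (N - p)) φ ≤
      (radialLqNorm N (p * N / (N - p)) (blissExtremal N p) /
          radialGradLpNorm N p (blissExtremal N p)) *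
        radialGradLpNorm N p φ := by
  have hp' : 0 < p - 1 := by linarith
  have hNp : 0 < N - p := by linarith
  have hp0 : 0 < p := by linarith
  have hN0 : 0 < N := by linarith
  set P := p / (p - 1) with hP
  set q := p * N / (N - p) with hq
  have hq0 : 0 < q := by positivity
  have hPp : p.HolderConjugate P := Real.HolderConjugate.conjExponent hp1
  have hP1 : 1 < P := hPp.symm.lt
  have hNP : N < P * (N - 1) := by
    rw [hP, div_mul_eq_mul_div, lt_div_iff₀ hp']; nlinarith
  obtain ⟨a, b, ha, hab, hsupp⟩ : ∃ a b : ℝ, 0 < a ∧ a < b ∧ tsupport φ ⊆ Set.Ioo a b := by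
    rcases (tsupport φ).eq_empty_or_nonempty with he | hne
    · exact ⟨1, 2, by norm_num, by norm_num, by rw [he]; exact Set.empty_subset _⟩
    · obtain ⟨u, hu⟩ := hφ_supp.isCompact.exists_isLeast hne
      obtain ⟨v, hv⟩ := hφ_supp.isCompact.exists_isGreatest hne
      have hu0 : 0 < u := hφ_pos hu.1
      have huv : u ≤ v := hu.2 hv.1
      refine ⟨u / 2, v + 1, by positivity, by linarith, fun x hx => ⟨?_, ?_⟩⟩
      · have := hu.2 hx; linarith
      · have := hv.2 hx; linarith
  have hz : ∀ x, x ∉ Set.Ioo a b → φ x = 0 := fun x hx =>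
    image_eq_zero_of_notMem_tsupport fun h => hx (hsupp h)
  have hz' : ∀ x, x ∉ Set.Ioo a b → deriv φ x = 0 := fun x hx =>
    image_eq_zero_of_notMem_tsupport fun h => hx (hsupp (tsupport_deriv_subset h))
  have hloc : ∀ g : ℝ → ℝ, (∀ x, x ∉ Set.Ioo a b → g x = 0) →
      ∫ x in Set.Ioi 0, g x = ∫ x in a..b, g x := by
    intro g hg
    rw [intervalIntegral.integral_of_le hab.le]
    apply setIntegral_eq_of_subset_of_forall_sdiff_eq_zero measurableSet_Ioi
    · intro x hx; exact ha.trans hx.1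
    · intro x hx
      exact hg x fun h => hx.2 ⟨h.1, h.2.le⟩
  have hIeq := hloc (fun x => |φ x| ^ q * x ^ (N - 1)) fun x hx => by
    simp [hz x hx, Real.zero_rpow hq0.ne']
  have hDeq := hloc (fun x => |deriv φ x| ^ p * x ^ (N - 1)) fun x hx => by
    simp [hz' x hx, Real.zero_rpow hp0.ne']
  have hM : ∫ y in Set.Ioi 0, |blissExtremal N p y| ^ q * y ^ (N - 1) = ∫ y in Set.Ioi 0, bh N P y :=
    setIntegral_congr_fun measurableSet_Ioi fun y hy => bliss_pow N p hp1 hpN y hy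
  have hKd : ∫ y in Set.Ioi 0, |deriv (blissExtremal N p) y| ^ p * y ^ (N - 1) =
      ((N - p) / (p - 1)) ^ p * ∫ y in Set.Ioi 0, y ^ P * bh N P y := by
    rw [← integral_const_mul]
    exact setIntegral_congr_fun measurableSet_Ioi fun y hy => bliss_deriv N p hp1 hpN y hy
  have hKpos := bk_pos N P hN hP1 hNP
  have hid := bh_identity N P hN hP1 hNP
  have hM0 : 0 ≤ ∫ y in Set.Ioi 0, bh N P y :=
    setIntegral_nonneg measurableSet_Ioi fun y hy => (bh_pos N P y hy).le
  have hcb := fun hI => core_bound' (fun y => bh N P y + y ^ P * bh N P y)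
    ((bh_int N P hN hP1 hNP).add (bk_int N P hN hP1 hNP)) _ fun r R hr hrR =>
    core_bound N p P q (p * (N - 1) / (N - p)) a b r R hN hPp hNP
      (by rw [lt_div_iff₀ hNp]; nlinarith) (by rw [hP, hq]; field_simp; ring)
      (by rw [hq]; field_simp; ring) (by rw [hP, hq]; field_simp; ring) ha hab hr hrR φ
      (hφ_smooth.of_le (by exact_mod_cast le_top)) (hz a (by simp)) (hz b (by simp)) hI
  unfold radialLqNorm radialGradLpNorm
  rw [hM, hKd, hIeq, hDeq]
  rw [integral_add (bh_int N P hN hP1 hNP) (bk_int N P hN hP1 hNP)] at hcb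
  have hI0 : 0 ≤ ∫ x in a..b, |φ x| ^ q * x ^ (N - 1) := by
    apply intervalIntegral.integral_nonneg hab.le
    intro x hx
    have hx : 0 < x := ha.trans_le hx.1
    positivity
  have hD0 : 0 ≤ ∫ x in a..b, |deriv φ x| ^ p * x ^ (N - 1) := by
    apply intervalIntegral.integral_nonneg hab.le
    intro x hx
    have hx : 0 < x := ha.trans_le hx.1
    positivity
  generalize (∫ x in a..b, |φ x| ^ q * x ^ (N - 1)) = I at *
  generalize (∫ x in a..b, |deriv φ x| ^ p * x ^ (N - 1)) = D at *
  generalize (∫ y in Set.Ioi 0, bh N P y) = M at *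
  generalize (∫ y in Set.Ioi 0, y ^ P * bh N P y) = K at *
  rcases hI0.eq_or_lt with h0 | hI
  · rw [← h0, Real.zero_rpow (by positivity)]
    positivity
  have hcb := hcb hI
  have hc0 : 0 < (N - p) / (p - 1) := by positivity
  rw [Real.mul_rpow (by positivity) hKpos.le, ← Real.rpow_mul hc0.le, mul_one_div_cancel hp0.ne',
    Real.rpow_one]
  rw [Real.div_rpow hM0 hI.le] at hcb
  have hKK : K = K ^ (1 / p) * K ^ (1 / P) := by
    rw [← Real.rpow_add hKpos]
    have : 1 / p + 1 / P = 1 := by simpa using hPp.inv_add_inv_eq_one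
    rw [this, Real.rpow_one]
  have hMK : M + K = p * (N - 1) / (N - p) / N * ((N - p) / (p - 1)) * K := by
    rw [hP] at hid
    field_simp at hid ⊢
    linarith
  rw [hMK] at hcb
  have k1 : 0 < K ^ (1 / p) := by positivity
  have k2 : 0 < K ^ (1 / P) := by positivity
  have i1 : 0 < I ^ (1 / q) := by positivity
  have sN : 0 < p * (N - 1) / (N - p) / N := by
    have : 0 < N - 1 := by linarith
    positivity
  have h3 : (N - p) / (p - 1) * K ^ (1 / p) ≤ M ^ (1 / q) / I ^ (1 / q) * D ^ (1 / p) := by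
    have : (p * (N - 1) / (N - p) / N * K ^ (1 / P)) * ((N - p) / (p - 1) * K ^ (1 / p)) ≤
        (p * (N - 1) / (N - p) / N * K ^ (1 / P)) * (M ^ (1 / q) / I ^ (1 / q) * D ^ (1 / p)) := by
      calc _ = p * (N - 1) / (N - p) / N * ((N - p) / (p - 1)) * (K ^ (1 / p) * K ^ (1 / P)) := by ring
        _ = p * (N - 1) / (N - p) / N * ((N - p) / (p - 1)) * K := by rw [← hKK]
        _ ≤ _ := hcb
        _ = _ := by ring
    exact le_of_mul_le_mul_left this (by positivity)
  rw [div_mul_eq_mul_div, le_div_iff₀ (by positivity)]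
  rw [div_mul_eq_mul_div (M ^ (1 / q)), le_div_iff₀ i1] at h3
  linarith
end
end
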